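/- Let c be a real number with 1 < c < 39/29 and c ≠ 4/3. Then for every sufficiently small η > 0 there exist constants C > 0, c₀ > 0 and V₀ > 0 such that for all V ≥ V₀ the following holds: for every R ∈ [V, 2V] outside an exceptional set of Lebesgue measure at most C·V·exp(−C⁻¹(log V)^{1/4}), the number 𝒜₂(R) of ordered pairs (p₁, p₂) of primes with X/8 < pⱼ ≤ X (j = 1,2), where X = R^{1/c}, satisfying |p₁^c + p₂^c − R| < R^{−η}, is at least c₀ · R^{2/c − 1 − η}/(log R)². -/

import Mathlib

open Real MeasureTheory

/-- `countSol c η R s` is the number of ordered `s`-tuples of primes `p₁, …, pₛ` with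
`X/8 < pⱼ ≤ X` (where `X = R^{1/c}`) and `|p₁^c + ⋯ + pₛ^c − R| < R^{−η}`. -/
noncomputable def countSol (c η R : ℝ) (s : ℕ) : ℕ :=
  Nat.card {p : Fin s → ℕ //
    (∀ j, (p j).Prime ∧ R ^ (1/c) / 8 < (p j : ℝ) ∧ (p j : ℝ) ≤ R ^ (1/c)) ∧
    |(∑ j, (p j : ℝ) ^ c) - R| < R ^ (-η)}


section
open Real MeasureTheory

noncomputable def ee (x : ℝ) : ℂ := Complex.exp (2 * π * x * Complex.I)

lemma ee_add (x y : ℝ) : ee (x + y) = ee x * ee y := by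
  unfold ee; rw [← Complex.exp_add]; push_cast; ring_nf

lemma ee_zero : ee 0 = 1 := by simp [ee]

lemma norm_ee (x : ℝ) : ‖ee x‖ = 1 := by
  unfold ee
  have : (2 * π * x * Complex.I : ℂ) = ((2 * π * x : ℝ) : ℂ) * Complex.I := by push_cast; ring
  rw [this, Complex.norm_exp_ofReal_mul_I]

lemma conj_ee (x : ℝ) : (starRingEnd ℂ) (ee x) = ee (-x) := by
  unfold ee; rw [← Complex.exp_conj]; simp [Complex.conj_ofNat]

lemma ee_ne_zero (x : ℝ) : ee x ≠ 0 := Complex.exp_ne_zero _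

lemma ee_eq_cos_sin (x : ℝ) : ee x = (cos (2 * π * x) : ℝ) + (sin (2 * π * x) : ℝ) * Complex.I := by
  unfold ee
  have : (2 * π * x * Complex.I : ℂ) = ((2 * π * x : ℝ) : ℂ) * Complex.I := by push_cast; ring
  rw [this, Complex.exp_mul_I]; push_cast; rfl

/-- the weight in the Kusmin-Landau argument -/
noncomputable def klW (g : ℝ) : ℂ := -1/2 - (tan (π / 2 - π * g) / 2 : ℝ) * Complex.I

lemma klW_mul {g : ℝ} (h0 : 0 < g) (h1 : g < 1) : klW g * (ee g - 1) = 1 := by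
  have hs : 0 < sin (π * g) := sin_pos_of_pos_of_lt_pi (by positivity) (by nlinarith [pi_pos])
  unfold klW
  rw [ee_eq_cos_sin, tan_eq_sin_div_cos, sin_pi_div_two_sub, cos_pi_div_two_sub]
  have e1 : 2 * π * g = 2 * (π * g) := by ring
  rw [e1, cos_two_mul, sin_two_mul]
  set s := sin (π * g) with hsd
  set t := cos (π * g)
  have hst : s ^ 2 + t ^ 2 = 1 := sin_sq_add_cos_sq _
  have hs' : s ≠ 0 := hs.ne'
  clear_value s t
  have hsC : (s : ℂ) ≠ 0 := by exact_mod_cast hs'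
  have hstC : (s : ℂ) ^ 2 + (t : ℂ) ^ 2 = 1 := by exact_mod_cast hst
  have hI := Complex.I_sq
  push_cast
  field_simp
  linear_combination (- 2 * t * Complex.I) * hstC + (-2 * (t:ℂ)^2 * s) * hI

lemma norm_klW_le {g δ : ℝ} (hδ : 0 < δ) (h0 : δ ≤ g) (h1 : g ≤ 1 - δ) : ‖klW g‖ ≤ 1 / (4 * δ) := by
  have hm := klW_mul (g := g) (by linarith) (by linarith)
  have hs : 2 * δ ≤ sin (π * g) := by
    have key : ∀ t : ℝ, δ ≤ t → t ≤ 1/2 → 2 * δ ≤ sin (π * t) := by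
      intro t ht ht2
      have := Real.mul_le_sin (x := π * t) (by have := pi_pos; nlinarith) (by have := pi_pos; nlinarith)
      have e : 2 / π * (π * t) = 2 * t := by field_simp
      linarith
    by_cases h : g ≤ 1/2
    · exact key g h0 h
    · have := key (1 - g) (by linarith) (by linarith)
      have e : π * (1 - g) = π - π * g := by ring
      rwa [e, sin_pi_sub] at this
  have hn : ‖ee g - 1‖ = 2 * sin (π * g) := by
    have : ee g - 1 = ee (g / 2) * ((2 * sin (π * g) : ℝ) * Complex.I) := by
      rw [ee_eq_cos_sin, ee_eq_cos_sin]
      have e1 : 2 * π * g = 2 * (π * g) := by ring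
      have e2 : 2 * π * (g / 2) = π * g := by ring
      rw [e1, e2, cos_two_mul, sin_two_mul]
      have hst := sin_sq_add_cos_sq (π * g)
      generalize sin (π * g) = s at hst ⊢
      generalize cos (π * g) = t at hst ⊢
      have hstC : (s : ℂ) ^ 2 + (t : ℂ) ^ 2 = 1 := by exact_mod_cast hst
      have hI := Complex.I_sq
      push_cast
      linear_combination (2:ℂ) * hstC + (-2 * (s:ℂ)^2) * hI
    rw [this, norm_mul, norm_ee, norm_mul, Complex.norm_I, Complex.norm_real, Real.norm_eq_abs, abs_of_nonneg (by linarith)]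
    ring
  have h2 : ‖klW g‖ * (2 * sin (π * g)) = 1 := by
    rw [← hn, ← norm_mul, hm, norm_one]
  rw [le_div_iff₀ (by positivity)]
  nlinarith [norm_nonneg (klW g)]

lemma klW_sub_norm_anti {g g' : ℝ} (h0 : 0 < g) (h1 : g' < 1) (h : g ≤ g') :
    ‖klW g' - klW g‖ = (klW g').im - (klW g).im := by
  have hm : tan (π / 2 - π * g') ≤ tan (π / 2 - π * g) := by
    have hp := pi_pos
    apply Real.strictMonoOn_tan.monotoneOn
    · constructor <;> nlinarith
    · constructor <;> nlinarith
    · nlinarith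
  have : klW g' - klW g = ((tan (π / 2 - π * g) / 2 - tan (π / 2 - π * g') / 2 : ℝ) : ℂ) * Complex.I := by
    unfold klW; push_cast; ring
  rw [this, norm_mul, Complex.norm_I, Complex.norm_real, Real.norm_eq_abs, abs_of_nonneg (by linarith)]
  unfold klW
  generalize tan (π / 2 - π * g) = s
  generalize tan (π / 2 - π * g') = t
  have e : ∀ u : ℝ, ((-1/2 - (u / 2 : ℝ) * Complex.I : ℂ)).im = - (u / 2) := by
    intro u
    rw [Complex.sub_im, Complex.im_ofReal_mul, Complex.I_im]
    norm_num
  rw [e, e]; ring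

lemma kl_parts (w E : ℕ → ℂ) (a k : ℕ) :
    ∑ n ∈ Finset.Ico a (a + k + 1), w n * (E (n+1) - E n)
      = w (a + k) * E (a + k + 1) - w a * E a - ∑ n ∈ Finset.Ico a (a + k), (w (n+1) - w n) * E (n+1) := by
  induction k with
  | zero => simp; ring
  | succ k ih =>
    rw [Finset.sum_Ico_succ_top (by omega)]
    have : a + (k + 1) = a + k + 1 := rfl
    rw [this, ih, Finset.sum_Ico_succ_top (b := a + k) (by omega)]
    ring

/-- Kusmin-Landau, increasing differences. -/
lemma kusmin_landau_mono (f : ℕ → ℝ) (a b : ℕ) {δ : ℝ} (hδ : 0 < δ)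
    (hmono : ∀ n, a ≤ n → n + 1 < b → f (n+1) - f n ≤ f (n+2) - f (n+1))
    (hlo : ∀ n, a ≤ n → n < b → δ ≤ f (n+1) - f n)
    (hhi : ∀ n, a ≤ n → n < b → f (n+1) - f n ≤ 1 - δ) :
    ‖∑ n ∈ Finset.Ico a b, ee (f n)‖ ≤ 1 / δ := by
  by_cases hab : b ≤ a
  · rw [Finset.Ico_eq_empty_of_le hab]; simp; positivity
  obtain ⟨k, rfl⟩ : ∃ k, b = a + k + 1 := ⟨b - a - 1, by omega⟩
  set g : ℕ → ℝ := fun n => f (n+1) - f n with hg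
  have h1 : ∀ n ∈ Finset.Ico a (a + k + 1), ee (f n) = klW (g n) * (ee (f (n+1)) - ee (f n)) := by
    intro n hn
    rw [Finset.mem_Ico] at hn
    have : f (n+1) = f n + g n := by simp [hg]
    rw [this, ee_add]
    have := klW_mul (g := g n) (by have := hlo n hn.1 hn.2; linarith) (by have := hhi n hn.1 hn.2; linarith)
    linear_combination -(ee (f n)) * this
  rw [Finset.sum_congr rfl h1, kl_parts (fun n => klW (g n)) (fun n => ee (f n))]
  have hb1 : ‖klW (g (a+k))‖ ≤ 1 / (4 * δ) := norm_klW_le hδ (hlo _ (by omega) (by omega)) (hhi _ (by omega) (by omega))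
  have hb2 : ‖klW (g a)‖ ≤ 1 / (4 * δ) := norm_klW_le hδ (hlo _ (by omega) (by omega)) (hhi _ (by omega) (by omega))
  have hsum : ‖∑ n ∈ Finset.Ico a (a + k), (klW (g (n+1)) - klW (g n)) * ee (f (n+1))‖ ≤ (klW (g (a+k))).im - (klW (g a)).im := by
    calc _ ≤ ∑ n ∈ Finset.Ico a (a + k), ‖(klW (g (n+1)) - klW (g n)) * ee (f (n+1))‖ := norm_sum_le _ _
      _ = ∑ n ∈ Finset.Ico a (a + k), ((klW (g (n+1))).im - (klW (g n)).im) := by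
        apply Finset.sum_congr rfl
        intro n hn
        rw [Finset.mem_Ico] at hn
        rw [norm_mul, norm_ee, mul_one, klW_sub_norm_anti]
        · have := hlo n hn.1 (by omega); simp only [hg]; linarith
        · have := hhi (n+1) (by omega) (by omega); simp only [hg]; linarith
        · exact hmono n hn.1 (by omega)
      _ = _ := by
        rw [Finset.sum_Ico_eq_sum_range]
        have := Finset.sum_range_sub (fun i => (klW (g (a + i))).im) k
        simp only [Nat.add_sub_cancel_left]
        exact this
  have hi1 : (klW (g (a+k))).im ≤ 1 / (4 * δ) := (Complex.abs_im_le_norm _ |> (le_abs_self _).trans).trans hb1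
  have hi2 : -(klW (g a)).im ≤ 1 / (4 * δ) := (Complex.abs_im_le_norm _ |> (neg_le_abs _).trans).trans hb2
  have e4 : 1 / δ = 1 / (4 * δ) + 1 / (4 * δ) + (1 / (4 * δ) + 1 / (4 * δ)) := by field_simp; ring
  rw [e4]
  calc _ ≤ ‖klW (g (a+k)) * ee (f (a+k+1))‖ + ‖klW (g a) * ee (f a)‖ + _ := (norm_sub_le _ _).trans (add_le_add_left (norm_sub_le _ _) _)
    _ ≤ _ := by
      rw [norm_mul, norm_mul, norm_ee, norm_ee, mul_one, mul_one]
      linarith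

lemma norm_sum_ee_neg (s : Finset ℕ) (f : ℕ → ℝ) :
    ‖∑ n ∈ s, ee (- f n)‖ = ‖∑ n ∈ s, ee (f n)‖ := by
  rw [← Complex.norm_conj, map_sum]
  simp [conj_ee]

/-- Kusmin-Landau, decreasing differences: apply to `n - f n`. -/
lemma kusmin_landau_anti (f : ℕ → ℝ) (a b : ℕ) {δ : ℝ} (hδ : 0 < δ)
    (hmono : ∀ n, a ≤ n → n + 1 < b → f (n+2) - f (n+1) ≤ f (n+1) - f n)
    (hlo : ∀ n, a ≤ n → n < b → δ ≤ f (n+1) - f n)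
    (hhi : ∀ n, a ≤ n → n < b → f (n+1) - f n ≤ 1 - δ) :
    ‖∑ n ∈ Finset.Ico a b, ee (f n)‖ ≤ 1 / δ := by
  have hee : ∀ n : ℕ, ee n = 1 := by
    intro n
    unfold ee
    rw [Complex.exp_eq_one_iff]
    exact ⟨n, by push_cast; ring⟩
  have := kusmin_landau_mono (fun n => n - f n) a b hδ
    (by intro n h1 h2; have := hmono n h1 h2; push_cast; linarith)
    (by intro n h1 h2; have := hhi n h1 h2; push_cast; linarith)
    (by intro n h1 h2; have := hlo n h1 h2; push_cast; linarith)
  rw [← norm_sum_ee_neg]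
  convert this using 3 with n hn
  rw [sub_eq_add_neg, ee_add, hee, one_mul]
end

section
open Real MeasureTheory

lemma wvdc_shift (F : ℕ → ℂ) (a b H k d : ℕ) (hk : k < H) :
    ∑ m ∈ Finset.Ico (a+1) (b+H), (if a + H ≤ m + k ∧ m + k + d < b + H then F (m + k - H) else 0)
      = ∑ n ∈ Finset.Ico a (b - d), F n := by
  rw [← Finset.sum_filter]
  apply Finset.sum_nbij' (fun m => m + k - H) (fun n => n + H - k)
  · intro m hm; simp only [Finset.mem_filter, Finset.mem_Ico] at hm ⊢; omega
  · intro m hm; simp only [Finset.mem_filter, Finset.mem_Ico] at hm ⊢; omega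
  · intro m hm; simp only [Finset.mem_filter, Finset.mem_Ico] at hm ⊢; omega
  · intro m hm; simp only [Finset.mem_Ico] at hm ⊢; omega
  · intro m hm; rfl

lemma cauchy_norm_sq {ι : Type*} (s : Finset ι) (f : ι → ℂ) :
    ‖∑ i ∈ s, f i‖ ^ 2 ≤ (s.card : ℝ) * ∑ i ∈ s, ‖f i‖ ^ 2 := by
  calc ‖∑ i ∈ s, f i‖ ^ 2 ≤ (∑ i ∈ s, ‖f i‖) ^ 2 := by
        gcongr; exact norm_sum_le _ _
    _ ≤ _ := sq_sum_le_card_mul_sum_sq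

/-- Weyl - van der Corput inequality. -/
lemma weyl_vdc (ζ : ℕ → ℂ) (a b H : ℕ) (hH : 1 ≤ H) :
    (H : ℝ) * ‖∑ n ∈ Finset.Ico a b, ζ n‖ ^ 2 ≤ ((b - a : ℕ) + H : ℝ) *
      (∑ n ∈ Finset.Ico a b, ‖ζ n‖ ^ 2 + 2 * ∑ h ∈ Finset.Ico 1 H,
        ‖∑ n ∈ Finset.Ico a (b - h), ζ (n + h) * (starRingEnd ℂ) (ζ n)‖) := by
  by_cases hab : b ≤ a
  · rw [Finset.Ico_eq_empty_of_le hab]; simp; positivity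
  push Not at hab
  set r : ℕ → ℝ := fun h => ‖∑ n ∈ Finset.Ico a (b - h), ζ (n + h) * (starRingEnd ℂ) (ζ n)‖ with hr
  set Z : ℕ → ℂ := fun j => if a + H ≤ j ∧ j < b + H then ζ (j - H) else 0 with hZ
  set B := ∑ n ∈ Finset.Ico a b, ‖ζ n‖ ^ 2 + 2 * ∑ h ∈ Finset.Ico 1 H, r h with hB
  have hr0 : r 0 = ∑ n ∈ Finset.Ico a b, ‖ζ n‖ ^ 2 := by
    simp only [hr, Nat.sub_zero, add_zero]
    have : ∑ n ∈ Finset.Ico a b, ζ n * (starRingEnd ℂ) (ζ n) = ((∑ n ∈ Finset.Ico a b, ‖ζ n‖ ^ 2 : ℝ) : ℂ) := by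
      push_cast
      apply Finset.sum_congr rfl
      intro n _
      rw [Complex.mul_conj, Complex.normSq_eq_norm_sq]; push_cast; rfl
    rw [this, Complex.norm_real, Real.norm_eq_abs, abs_of_nonneg]
    exact Finset.sum_nonneg (fun _ _ => by positivity)
  have hrn : ∀ h, 0 ≤ r h := fun h => norm_nonneg _
  have step1 : ∀ k ∈ Finset.range H, ∑ m ∈ Finset.Ico (a+1) (b+H), Z (m + k) = ∑ n ∈ Finset.Ico a b, ζ n := by
    intro k hk
    exact wvdc_shift ζ a b H k 0 (Finset.mem_range.1 hk)
  have corr : ∀ k l, k < H → k ≤ l →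
      ∑ m ∈ Finset.Ico (a+1) (b+H), Z (m + l) * (starRingEnd ℂ) (Z (m + k)) =
        ∑ n ∈ Finset.Ico a (b - (l - k)), ζ (n + (l-k)) * (starRingEnd ℂ) (ζ n) := by
    intro k l hk hkl
    rw [← wvdc_shift (fun n => ζ (n + (l-k)) * (starRingEnd ℂ) (ζ n)) a b H k (l-k) hk]
    apply Finset.sum_congr rfl
    intro m _
    by_cases h : a + H ≤ m + k ∧ m + k + (l - k) < b + H
    · rw [if_pos h]
      simp only [hZ]
      rw [if_pos (by omega), if_pos (by omega)]
      have : m + l - H = m + k - H + (l - k) := by omega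
      rw [this]
    · rw [if_neg h]
      simp only [hZ]
      by_cases h2 : a + H ≤ m + k
      · rw [if_neg (by omega), zero_mul]
      · rw [if_neg (c := a + H ≤ m + k ∧ m + k < b + H) (by omega), map_zero, mul_zero]
  have corrn : ∀ k l, k < H → l < H →
      ‖∑ m ∈ Finset.Ico (a+1) (b+H), Z (m + l) * (starRingEnd ℂ) (Z (m + k))‖ = if k ≤ l then r (l - k) else r (k - l) := by
    intro k l hk hl
    split_ifs with h
    · rw [corr k l hk h]
    · rw [← Complex.norm_conj, map_sum]
      simp only [hr]
      rw [← corr l k hl (by omega)]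
      congr 1
      apply Finset.sum_congr rfl
      intro m _
      rw [map_mul, Complex.conj_conj, mul_comm]
  have rowsum : ∀ k, k < H → ∑ l ∈ Finset.range H, (if k ≤ l then r (l - k) else r (k - l)) ≤ B := by
    intro k hk
    have e : ∑ l ∈ Finset.range H, (if k ≤ l then r (l - k) else r (k - l))
       = ∑ l ∈ Finset.range k, r (k - l) + ∑ l ∈ Finset.Ico k H, r (l - k) := by
      rw [Finset.range_eq_Ico, ← Finset.sum_Ico_consecutive _ (Nat.zero_le k) hk.le, ← Finset.range_eq_Ico]
      congr 1
      · apply Finset.sum_congr rfl; intro l hl; rw [Finset.mem_range] at hl; rw [if_neg (by omega)]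
      · apply Finset.sum_congr rfl; intro l hl; rw [Finset.mem_Ico] at hl; rw [if_pos (by omega)]
    rw [e]
    have e1 : ∑ l ∈ Finset.range k, r (k - l) ≤ ∑ h ∈ Finset.Ico 1 H, r h := by
      calc _ = ∑ h ∈ Finset.Ico 1 (k+1), r h := by
            apply Finset.sum_nbij' (fun l => k - l) (fun h => k - h) <;> intro x hx <;> simp only [Finset.mem_range, Finset.mem_Ico] at hx ⊢ <;> omega
        _ ≤ _ := Finset.sum_le_sum_of_subset_of_nonneg (by intro x; simp only [Finset.mem_Ico]; omega) (fun i _ _ => hrn i)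
    have e2 : ∑ l ∈ Finset.Ico k H, r (l - k) ≤ r 0 + ∑ h ∈ Finset.Ico 1 H, r h := by
      calc _ = ∑ h ∈ Finset.Ico 0 (H - k), r h := by
            apply Finset.sum_nbij' (fun l => l - k) (fun h => h + k) <;> intro x hx <;> simp only [Finset.mem_Ico] at hx ⊢ <;> omega
        _ ≤ ∑ h ∈ Finset.Ico 0 H, r h := Finset.sum_le_sum_of_subset_of_nonneg (by intro x; simp only [Finset.mem_Ico]; omega) (fun i _ _ => hrn i)
        _ = _ := by rw [Finset.sum_eq_sum_Ico_succ_bot (by omega)]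
    rw [hB, ← hr0]; linarith
  have main : (H * ‖∑ n ∈ Finset.Ico a b, ζ n‖) ^ 2 ≤ ((b - a : ℕ) + H : ℝ) * (H * B) := by
    have e1 : (H : ℂ) * ∑ n ∈ Finset.Ico a b, ζ n = ∑ m ∈ Finset.Ico (a+1) (b+H), ∑ k ∈ Finset.range H, Z (m + k) := by
      rw [Finset.sum_comm, Finset.sum_congr rfl step1]; simp
    have e2 : H * ‖∑ n ∈ Finset.Ico a b, ζ n‖ = ‖∑ m ∈ Finset.Ico (a+1) (b+H), ∑ k ∈ Finset.range H, Z (m + k)‖ := by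
      rw [← e1, norm_mul]; simp
    rw [e2]
    refine (cauchy_norm_sq _ _).trans ?_
    have e3 : ∑ m ∈ Finset.Ico (a+1) (b+H), ‖∑ k ∈ Finset.range H, Z (m + k)‖ ^ 2 ≤ H * B := by
      have e4 : ((∑ m ∈ Finset.Ico (a+1) (b+H), ‖∑ k ∈ Finset.range H, Z (m + k)‖ ^ 2 : ℝ) : ℂ) =
          ∑ k ∈ Finset.range H, ∑ l ∈ Finset.range H, ∑ m ∈ Finset.Ico (a+1) (b+H), Z (m + l) * (starRingEnd ℂ) (Z (m + k)) := by
        push_cast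
        have : ∀ m ∈ Finset.Ico (a+1) (b+H), (‖∑ k ∈ Finset.range H, Z (m + k)‖ : ℂ) ^ 2 = ∑ k ∈ Finset.range H, ∑ l ∈ Finset.range H, Z (m + l) * (starRingEnd ℂ) (Z (m + k)) := by
          intro m _
          rw [← Complex.mul_conj', map_sum, Finset.sum_mul_sum, Finset.sum_comm]
        rw [Finset.sum_congr rfl this, Finset.sum_comm]
        apply Finset.sum_congr rfl; intro k _
        rw [Finset.sum_comm]
      have e5 : ∑ m ∈ Finset.Ico (a+1) (b+H), ‖∑ k ∈ Finset.range H, Z (m + k)‖ ^ 2 = ‖((∑ m ∈ Finset.Ico (a+1) (b+H), ‖∑ k ∈ Finset.range H, Z (m + k)‖ ^ 2 : ℝ) : ℂ)‖ := by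
        rw [Complex.norm_real, Real.norm_eq_abs, abs_of_nonneg]
        exact Finset.sum_nonneg (fun _ _ => by positivity)
      rw [e5, e4]
      calc _ ≤ ∑ k ∈ Finset.range H, ∑ l ∈ Finset.range H, ‖∑ m ∈ Finset.Ico (a+1) (b+H), Z (m + l) * (starRingEnd ℂ) (Z (m + k))‖ :=
            (norm_sum_le _ _).trans (Finset.sum_le_sum fun k _ => norm_sum_le _ _)
        _ ≤ ∑ k ∈ Finset.range H, B := by
            apply Finset.sum_le_sum
            intro k hk
            rw [Finset.mem_range] at hk
            refine le_trans (le_of_eq ?_) (rowsum k hk)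
            apply Finset.sum_congr rfl
            intro l hl
            exact corrn k l hk (Finset.mem_range.1 hl)
        _ = H * B := by simp
    have hcard : ((Finset.Ico (a+1) (b+H)).card : ℝ) ≤ (b - a : ℕ) + H := by
      rw [Nat.card_Ico]
      have : b + H - (a + 1) ≤ (b - a) + H := by omega
      exact_mod_cast this
    exact mul_le_mul hcard e3 (Finset.sum_nonneg (fun _ _ => by positivity)) (by positivity)
  have hHpos : (0:ℝ) < H := by exact_mod_cast hH
  have : (H:ℝ) * (H * ‖∑ n ∈ Finset.Ico a b, ζ n‖ ^ 2) ≤ H * (((b - a : ℕ) + H : ℝ) * B) := by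
    nlinarith
  exact le_of_mul_le_mul_left this hHpos
end

section
open Real MeasureTheory

/-- mean value for powers -/
lemma rpow_diff_mvt {e : ℝ} {x y : ℝ} (hx : 0 < x) (hxy : x < y) :
    ∃ ξ, x < ξ ∧ ξ < y ∧ y ^ e - x ^ e = e * ξ ^ (e - 1) * (y - x) := by
  obtain ⟨ξ, ⟨h1, h2⟩, h3⟩ := exists_hasDerivAt_eq_slope (fun t : ℝ => t ^ e) (fun t => e * t ^ (e-1)) hxy
    (by
      apply ContinuousOn.rpow_const continuousOn_id
      intro t ht; left; exact (lt_of_lt_of_le hx ht.1).ne')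
    (by
      intro t ht
      exact Real.hasDerivAt_rpow_const (Or.inl (hx.trans ht.1).ne'))
  refine ⟨ξ, h1, h2, ?_⟩
  have : y - x ≠ 0 := by linarith
  field_simp at h3
  linarith

noncomputable def pph (c t : ℝ) : ℝ := (t + 1) ^ c - t ^ c

lemma pph_mvt {c t : ℝ} (ht : 0 < t) : ∃ ξ, t < ξ ∧ ξ < t + 1 ∧ pph c t = c * ξ ^ (c-1) := by
  obtain ⟨ξ, h1, h2, h3⟩ := rpow_diff_mvt (e := c) ht (by linarith : t < t + 1)
  exact ⟨ξ, h1, h2, by unfold pph; rw [h3]; ring⟩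

lemma pph_hasDeriv {c t : ℝ} (ht : 0 < t) : HasDerivAt (pph c) (c * pph (c-1) t) t := by
  unfold pph
  have h1 : HasDerivAt (fun t : ℝ => (t + 1) ^ c) (c * (t+1) ^ (c-1)) t := by
    have := (Real.hasDerivAt_rpow_const (x := t + 1) (p := c) (Or.inl (by linarith))).comp_add_const t 1
    exact this
  have h2 : HasDerivAt (fun t : ℝ => t ^ c) (c * t ^ (c-1)) t := Real.hasDerivAt_rpow_const (Or.inl ht.ne')
  have h3 := h1.sub h2
  have e : c * pph (c-1) t = c * (t+1) ^ (c-1) - c * t ^ (c-1) := by unfold pph; ring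
  unfold pph at e
  rw [e]
  exact h3

/-- second difference mean value -/
lemma pph_diff_mvt {c t h : ℝ} (ht : 0 < t) (hh : 0 < h) :
    ∃ ξ, t < ξ ∧ ξ < t + h + 1 ∧ pph c (t + h) - pph c t = c * (c-1) * ξ ^ (c-2) * h := by
  obtain ⟨η, ⟨h1, h2⟩, h3⟩ := exists_hasDerivAt_eq_slope (pph c) (fun t => c * pph (c-1) t) (by linarith : t < t + h)
    (by intro u hu; exact (pph_hasDeriv (lt_of_lt_of_le ht hu.1)).continuousAt.continuousWithinAt)
    (by intro u hu; exact pph_hasDeriv (ht.trans hu.1))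
  obtain ⟨ξ, k1, k2, k3⟩ := pph_mvt (c := c - 1) (ht.trans h1)
  refine ⟨ξ, by linarith, by linarith, ?_⟩
  rw [k3] at h3
  have e : c - 1 - 1 = c - 2 := by ring
  rw [e] at h3
  have : t + h - t = h := by ring
  rw [this] at h3
  field_simp at h3
  linarith

lemma pph_mono {c s t : ℝ} (hc : 1 < c) (hs : 0 < s) (hst : s ≤ t) : pph c s ≤ pph c t := by
  rcases hst.eq_or_lt with rfl | h
  · rfl
  obtain ⟨ξ, k1, k2, k3⟩ := pph_diff_mvt (c := c) hs (sub_pos.2 h)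
  rw [add_sub_cancel] at k3
  have : 0 < ξ := hs.trans k1
  have : 0 ≤ c * (c-1) * ξ ^ (c-2) * (t - s) := by
    have : 0 < c - 1 := by linarith
    have := sub_pos.2 h
    positivity
  linarith

lemma pph_anti {e s t : ℝ} (he0 : 0 < e) (he : e < 1) (hs : 0 < s) (hst : s ≤ t) : pph e t ≤ pph e s := by
  rcases hst.eq_or_lt with rfl | h
  · rfl
  obtain ⟨ξ, k1, k2, k3⟩ := pph_diff_mvt (c := e) hs (sub_pos.2 h)
  rw [add_sub_cancel] at k3
  have : 0 < ξ := hs.trans k1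
  have : 0 ≤ e * (1-e) * ξ ^ (e-2) * (t - s) := by
    have : 0 < 1 - e := by linarith
    have := sub_pos.2 h
    positivity
  linarith

/-- `pph c (t+h) - pph c t` is decreasing in `t` -/
lemma pph_diff_anti {c h s t : ℝ} (hc : 1 < c) (hc2 : c < 2) (hh : 0 ≤ h) (hs : 0 < s) (hst : s ≤ t) :
    pph c (t + h) - pph c t ≤ pph c (s + h) - pph c s := by
  have := antitoneOn_of_deriv_nonpos (D := Set.Ioi (0:ℝ)) (convex_Ioi 0) (f := fun t => pph c (t + h) - pph c t)
    (by
      intro u hu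
      have hu' : 0 < u := hu
      exact (((pph_hasDeriv (c := c) (t := u + h) (by linarith)).comp_add_const u h).sub (pph_hasDeriv hu')).continuousAt.continuousWithinAt)
    (by
      intro u hu
      rw [interior_Ioi] at hu
      have hu' : 0 < u := hu
      exact (((pph_hasDeriv (c := c) (t := u + h) (by linarith)).comp_add_const u h).sub (pph_hasDeriv hu')).differentiableAt.differentiableWithinAt)
    (by
      intro u hu
      rw [interior_Ioi] at hu
      have hu' : 0 < u := hu
      have hd : HasDerivAt (fun t => pph c (t + h) - pph c t) _ u := ((pph_hasDeriv (c := c) (t := u + h) (by linarith)).comp_add_const u h).sub (pph_hasDeriv hu')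
      rw [hd.deriv]
      have := pph_anti (e := c - 1) (by linarith) (by linarith) hu' (by linarith : u ≤ u + h)
      nlinarith)
  exact this hs (lt_of_lt_of_le hs hst) hst

lemma rpow_scale {N e : ℝ} (hN : 0 < N) {k : ℝ} (hk : 0 < k) : (k * N) ^ e = k ^ e * N ^ e :=
  Real.mul_rpow hk.le hN.le

/-- first derivative range -/
lemma powerphase_fd {c N z : ℝ} (hc : 1 < c) (hc2 : c < 2) (hN : 1 ≤ N) (hz : 0 < z) (a b : ℕ)
    (ha : N / 16 ≤ a) (hb : (b : ℝ) ≤ N + 1) (hT : z * N ^ c ≤ N / 8) :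
    ‖∑ n ∈ Finset.Ico a b, ee (z * (n:ℝ) ^ c)‖ ≤ 16 * N / (z * N ^ c) := by
  have hN0 : 0 < N := by linarith
  have hNc : N ^ c = N ^ (c-1) * N := by
    rw [← Real.rpow_add_one hN0.ne']; ring_nf
  set P := N ^ (c-1) with hP
  have hP0 : 0 < P := by positivity
  rw [hNc] at hT ⊢
  have hzP : z * P ≤ 1/8 := by
    by_contra h; push Not at h; nlinarith
  have hn0 : ∀ n : ℕ, a ≤ n → (0:ℝ) < n := fun n hn => by
    have : (a:ℝ) ≤ n := by exact_mod_cast hn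
    linarith
  have hdiff : ∀ n : ℕ, z * ((n+1 : ℕ):ℝ) ^ c - z * (n:ℝ) ^ c = z * pph c n := by
    intro n; unfold pph; push_cast; ring
  have hb1 : ∀ n : ℕ, a ≤ n → n < b → P / 16 ≤ pph c n ∧ pph c n ≤ 4 * P := by
    intro n h1 h2
    obtain ⟨ξ, k1, k2, k3⟩ := pph_mvt (c := c) (hn0 n h1)
    have : (a:ℝ) ≤ n := by exact_mod_cast h1
    have : (n:ℝ) + 1 ≤ b := by exact_mod_cast h2
    rw [k3]
    have l1 : (1/16 * N) ^ (c-1) ≤ ξ ^ (c-1) := Real.rpow_le_rpow (by positivity) (by linarith) (by linarith)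
    have l2 : ξ ^ (c-1) ≤ (2 * N) ^ (c-1) := Real.rpow_le_rpow (by linarith) (by linarith) (by linarith)
    rw [rpow_scale hN0 (by norm_num)] at l1 l2
    have l3 : (1/16 : ℝ) ^ (1:ℝ) ≤ (1/16) ^ (c-1) := Real.rpow_le_rpow_of_exponent_ge (by norm_num) (by norm_num) (by linarith)
    have l4 : (2 : ℝ) ^ (c-1) ≤ 2 ^ (1:ℝ) := Real.rpow_le_rpow_of_exponent_le (by norm_num) (by linarith)
    rw [Real.rpow_one] at l3 l4
    have hξ : 0 < ξ ^ (c-1) := Real.rpow_pos_of_pos (by linarith) _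
    constructor <;> nlinarith
  have := kusmin_landau_mono (fun n => z * (n:ℝ) ^ c) a b (δ := z * P / 16) (by positivity)
    (by
      intro n h1 h2
      have e := hdiff (n+1)
      rw [hdiff]
      have e' : ((n + 1 + 1 : ℕ) : ℝ) = ((n + 2 : ℕ) : ℝ) := by norm_num [add_assoc]
      rw [e'] at e
      rw [e]
      have := pph_mono hc (hn0 n h1) (by push_cast; linarith : (n:ℝ) ≤ ((n+1 : ℕ) : ℝ))
      nlinarith)
    (by
      intro n h1 h2
      rw [hdiff]; have := (hb1 n h1 h2).1; nlinarith)
    (by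
      intro n h1 h2
      rw [hdiff]; have := (hb1 n h1 h2).2; nlinarith)
  refine this.trans (le_of_eq ?_)
  field_simp

lemma harmonic_Ico (H : ℕ) (hH : 1 ≤ H) : ∑ h ∈ Finset.Ico 1 H, (1:ℝ) / h ≤ 1 + log H := by
  have h1 : ∑ h ∈ Finset.Ico 1 H, (1:ℝ) / h ≤ ∑ h ∈ Finset.Icc 1 H, (1:ℝ)/h :=
    Finset.sum_le_sum_of_subset_of_nonneg (by intro x; simp only [Finset.mem_Ico, Finset.mem_Icc]; omega) (fun i _ _ => by positivity)
  have := harmonic_le_one_add_log H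
  rw [harmonic_eq_sum_Icc] at this
  push_cast at this
  simp only [one_div] at h1 ⊢
  linarith

/-- second derivative range, difference sums -/
lemma powerphase_corr {c N z : ℝ} (hc : 1 < c) (hc2 : c < 2) (hN : 1 ≤ N) (hz : 0 < z) (a b h : ℕ)
    (ha : N / 16 ≤ a) (hb : (b : ℝ) ≤ N + 1) (hh : 1 ≤ h) (hT : 64 * h * (z * N ^ c) ≤ N ^ 2) :
    ‖∑ n ∈ Finset.Ico a (b - h), ee (z * ((n + h : ℕ):ℝ) ^ c) * (starRingEnd ℂ) (ee (z * (n:ℝ) ^ c))‖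
      ≤ N ^ 2 * (2 / (c * (c-1))) / (z * N ^ c) * (1 / h) := by
  have hN0 : 0 < N := by linarith
  have hNc : N ^ c = N ^ (c-2) * N ^ 2 := by
    rw [← Real.rpow_natCast, ← Real.rpow_add hN0]; norm_num
  set P := N ^ (c-2) with hP
  have hP0 : 0 < P := by positivity
  rw [hNc] at hT ⊢
  have hh0 : (1:ℝ) ≤ h := by exact_mod_cast hh
  have hN2 : 0 < N ^ 2 := by positivity
  have hzP : 64 * h * (z * P) ≤ 1 := by
    by_contra hcon; push Not at hcon
    nlinarith
  have hn0 : ∀ n : ℕ, a ≤ n → (0:ℝ) < n := fun n hn => by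
    have : (a:ℝ) ≤ n := by exact_mod_cast hn
    linarith
  set f : ℕ → ℝ := fun n => z * ((n + h : ℕ):ℝ) ^ c - z * (n:ℝ) ^ c with hf
  have hfe : ∀ n, ee (z * ((n + h : ℕ):ℝ) ^ c) * (starRingEnd ℂ) (ee (z * (n:ℝ) ^ c)) = ee (f n) := by
    intro n; rw [conj_ee, ← ee_add]; rfl
  simp only [hfe]
  have hdiff : ∀ n : ℕ, f (n+1) - f n = z * (pph c (n + h) - pph c n) := by
    intro n; unfold pph; simp only [hf]; push_cast
    rw [show (n:ℝ) + 1 + h = n + h + 1 by ring]; ring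
  have hcc : 0 < c * (c-1) := by nlinarith
  have hcc2 : c * (c-1) < 2 := by nlinarith
  have hb1 : ∀ n : ℕ, a ≤ n → n < b - h → c * (c-1) / 2 * P * h ≤ pph c (n+h) - pph c n ∧ pph c (n+h) - pph c n ≤ 32 * P * h := by
    intro n h1 h2
    obtain ⟨ξ, k1, k2, k3⟩ := pph_diff_mvt (c := c) (hn0 n h1) (by linarith : (0:ℝ) < h)
    have : (a:ℝ) ≤ n := by exact_mod_cast h1
    have : (n:ℝ) + h + 1 ≤ b := by exact_mod_cast (by omega : n + h + 1 ≤ b)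
    rw [k3]
    have l1 : ξ ^ (c-2) ≤ (1/16 * N) ^ (c-2) := Real.rpow_le_rpow_of_nonpos (by positivity) (by linarith) (by linarith)
    have l2 : (2 * N) ^ (c-2) ≤ ξ ^ (c-2) := Real.rpow_le_rpow_of_nonpos (by linarith) (by linarith) (by linarith)
    rw [rpow_scale hN0 (by norm_num)] at l1 l2
    have l3 : (1/16 : ℝ) ^ (c-2) ≤ (1/16) ^ (-1:ℝ) := Real.rpow_le_rpow_of_exponent_ge (by norm_num) (by norm_num) (by linarith)
    have l4 : (2 : ℝ) ^ (-1:ℝ) ≤ 2 ^ (c-2) := Real.rpow_le_rpow_of_exponent_le (by norm_num) (by linarith)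
    rw [Real.rpow_neg_one] at l3 l4
    have hξ : 0 < ξ ^ (c-2) := Real.rpow_pos_of_pos (by linarith) _
    have m1 : ξ ^ (c-2) ≤ 16 * P := by
      refine l1.trans ?_
      have : (1/16:ℝ)⁻¹ = 16 := by norm_num
      rw [this] at l3
      exact mul_le_mul_of_nonneg_right l3 hP0.le
    have m2 : P / 2 ≤ ξ ^ (c-2) := by
      refine le_trans ?_ l2
      have := mul_le_mul_of_nonneg_right l4 hP0.le
      linarith
    have hccξ : c * (c-1) * ξ ^ (c-2) ≤ 32 * P := by
      calc _ ≤ 2 * (16 * P) := mul_le_mul hcc2.le m1 hξ.le (by norm_num)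
        _ = _ := by ring
    have hccξ2 : c * (c-1) / 2 * P ≤ c * (c-1) * ξ ^ (c-2) := by
      have := mul_le_mul_of_nonneg_left m2 hcc.le
      linarith
    constructor
    · exact mul_le_mul_of_nonneg_right hccξ2 (by linarith)
    · exact mul_le_mul_of_nonneg_right hccξ (by linarith)
  have := kusmin_landau_anti f a (b - h) (δ := z * (c * (c-1) / 2 * P * h)) (by positivity)
    (by
      intro n h1 h2
      have e := hdiff (n+1)
      have e' : n + 1 + 1 = n + 2 := by ring
      rw [e'] at e
      rw [hdiff n, e]
      have := pph_diff_anti hc hc2 (by linarith : (0:ℝ) ≤ h) (hn0 n h1) (by push_cast; linarith : (n:ℝ) ≤ ((n+1 : ℕ) : ℝ))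
      exact mul_le_mul_of_nonneg_left this hz.le)
    (by
      intro n h1 h2
      rw [hdiff]; exact mul_le_mul_of_nonneg_left (hb1 n h1 h2).1 hz.le)
    (by
      intro n h1 h2
      rw [hdiff]
      have q1 := mul_le_mul_of_nonneg_left (hb1 n h1 h2).2 hz.le
      have q2 := mul_le_mul_of_nonneg_left ((hb1 n h1 h2).1.trans (hb1 n h1 h2).2) hz.le
      linarith)
  refine this.trans (le_of_eq ?_)
  have : c ≠ 0 := by linarith
  have : c - 1 ≠ 0 := by linarith
  field_simp

/-- `ppC c`: explicit constant for the power phase bound -/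
noncomputable def ppC (c : ℝ) : ℝ := 1000 + 40000 * (2 / (c * (c-1)))

lemma powerphase_pos {c N z : ℝ} (hc : 1 < c) (hc2 : c < 2) (hN : 1 ≤ N) (hz : 0 < z) (a b : ℕ)
    (ha : N / 16 ≤ a) (hb : (b : ℝ) ≤ N + 1) :
    ‖∑ n ∈ Finset.Ico a b, ee (z * (n:ℝ) ^ c)‖ ≤ ppC c * (1 + log N) * (√(z * N ^ c) + N / (z * N ^ c)) := by
  have hN0 : 0 < N := by linarith
  set T := z * N ^ c with hTd
  have hT0 : 0 < T := by positivity
  have hcc : 0 < 2 / (c * (c-1)) := by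
    have : 0 < c - 1 := by linarith
    positivity
  set κ := 2 / (c * (c-1)) with hκ
  have hlog : 0 ≤ log N := Real.log_nonneg hN
  have hC : 1000 ≤ ppC c := by unfold ppC; linarith
  have hC1 : 1000 ≤ ppC c * (1 + log N) := by nlinarith
  by_cases h1 : T ≤ N / 8
  · refine (powerphase_fd hc hc2 hN hz a b ha hb h1).trans ?_
    rw [← hTd, mul_div_assoc]
    have : 0 < N / T := by positivity
    have : 0 ≤ √T := sqrt_nonneg _
    nlinarith
  push Not at h1
  have hlen : ((b - a : ℕ) : ℝ) ≤ 2 * N := by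
    have : b - a ≤ b := Nat.sub_le _ _
    have : ((b - a : ℕ) : ℝ) ≤ b := by exact_mod_cast this
    linarith
  have hsq : ∀ A : ℝ, 0 ≤ A → ‖∑ n ∈ Finset.Ico a b, ee (z * (n:ℝ) ^ c)‖ ^ 2 ≤ A ^ 2 * T → A ≤ ppC c * (1 + log N) → ‖∑ n ∈ Finset.Ico a b, ee (z * (n:ℝ) ^ c)‖ ≤ ppC c * (1 + log N) * (√T + N / T) := by
    intro A hA hs hA2
    have : ‖∑ n ∈ Finset.Ico a b, ee (z * (n:ℝ) ^ c)‖ ≤ A * √T := by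
      apply (sq_le_sq₀ (norm_nonneg _) (by positivity)).1
      rw [mul_pow, Real.sq_sqrt hT0.le]; exact hs
    have h2 : 0 < N / T := by positivity
    have h3 : 0 ≤ √T := sqrt_nonneg _
    calc _ ≤ A * √T := this
      _ ≤ ppC c * (1 + log N) * √T := by gcongr
      _ ≤ _ := by gcongr; linarith
  by_cases h2 : N ^ 2 / 64 < T
  · apply hsq 16 (by norm_num) _ (by linarith)
    have : ‖∑ n ∈ Finset.Ico a b, ee (z * (n:ℝ) ^ c)‖ ≤ 2 * N := by
      refine (norm_sum_le _ _).trans ?_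
      simp only [norm_ee]
      simp
      exact hlen
    calc _ ≤ (2 * N) ^ 2 := by gcongr
      _ ≤ _ := by nlinarith
  push Not at h2
  set H := ⌈N ^ 2 / (64 * T)⌉₊ with hH
  have hq1 : 1 ≤ N ^ 2 / (64 * T) := by rw [le_div_iff₀ (by positivity)]; linarith
  have hH1 : 1 ≤ H := by rw [hH, Nat.one_le_ceil_iff]; linarith
  have hHlo : N ^ 2 / (64 * T) ≤ H := Nat.le_ceil _
  have hHhi : (H : ℝ) ≤ 2 * (N ^ 2 / (64 * T)) := by
    have := Nat.ceil_lt_add_one (by linarith : (0:ℝ) ≤ N ^ 2 / (64 * T))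
    rw [← hH] at this; linarith
  have hHN : (H : ℝ) ≤ N := by
    refine hHhi.trans ?_
    rw [← mul_div_assoc, div_le_iff₀ (by positivity)]
    nlinarith
  have hHpos : (0:ℝ) < H := by linarith
  have hv := weyl_vdc (fun n => ee (z * (n:ℝ) ^ c)) a b H hH1
  have hcorr : ∑ h ∈ Finset.Ico 1 H, ‖∑ n ∈ Finset.Ico a (b - h), ee (z * ((n + h : ℕ):ℝ) ^ c) * (starRingEnd ℂ) (ee (z * (n:ℝ) ^ c))‖
      ≤ N ^ 2 * κ / T * (1 + log N) := by
    calc _ ≤ ∑ h ∈ Finset.Ico 1 H, N ^ 2 * κ / T * (1 / (h:ℝ)) := by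
          apply Finset.sum_le_sum
          intro h hh
          rw [Finset.mem_Ico] at hh
          apply powerphase_corr hc hc2 hN hz a b h ha hb hh.1
          have : h < ⌈N ^ 2 / (64 * T)⌉₊ := hh.2
          rw [Nat.lt_ceil, lt_div_iff₀ (by positivity)] at this
          rw [← hTd]; linarith
      _ = N ^ 2 * κ / T * ∑ h ∈ Finset.Ico 1 H, (1 / (h:ℝ)) := by rw [Finset.mul_sum]
      _ ≤ _ := by
          gcongr
          refine (harmonic_Ico H hH1).trans ?_
          have := Real.log_le_log hHpos hHN
          linarith
  simp only [norm_ee, one_pow] at hv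
  rw [Finset.sum_const, Nat.card_Ico, nsmul_eq_mul, mul_one] at hv
  set S0 := ‖∑ n ∈ Finset.Ico a b, ee (z * (n:ℝ) ^ c)‖ with hS
  have hv2 : (H:ℝ) * S0 ^ 2 ≤ (3 * N) * (2 * N + 2 * (N ^ 2 * κ / T * (1 + log N))) := by
    refine hv.trans ?_
    apply mul_le_mul
    · linarith
    · gcongr
    · positivity
    · positivity
  have hv3 : N ^ 2 / (64 * T) * S0 ^ 2 ≤ (3 * N) * (2 * N + 2 * (N ^ 2 * κ / T * (1 + log N))) :=
    le_trans (mul_le_mul_of_nonneg_right hHlo (by positivity)) hv2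
  have hv4 : S0 ^ 2 ≤ (384 + 3072 * κ * (1 + log N)) * T := by
    have e : S0 ^ 2 = (64 * T) / N ^ 2 * (N ^ 2 / (64 * T) * S0 ^ 2) := by field_simp
    rw [e]
    calc _ ≤ (64 * T) / N ^ 2 * ((3 * N) * (2 * N + 2 * (N ^ 2 * κ / T * (1 + log N)))) := by gcongr
      _ = 384 * T + 384 * N * κ * (1 + log N) := by field_simp; ring
      _ ≤ 384 * T + 384 * (8 * T) * κ * (1 + log N) := by gcongr; linarith
      _ = _ := by ring
  apply hsq (ppC c * (1 + log N)) (by linarith) _ le_rfl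
  refine hv4.trans ?_
  gcongr
  have : ppC c * (1 + log N) ≤ (ppC c * (1 + log N)) ^ 2 := by nlinarith
  refine le_trans ?_ this
  unfold ppC
  have : 0 ≤ κ * (1 + log N) := by positivity
  rw [← hκ]
  nlinarith

/-- power phase bound for any nonzero frequency -/
lemma powerphase {c N z : ℝ} (hc : 1 < c) (hc2 : c < 2) (hN : 1 ≤ N) (hz : z ≠ 0) (a b : ℕ)
    (ha : N / 16 ≤ a) (hb : (b : ℝ) ≤ N + 1) :
    ‖∑ n ∈ Finset.Ico a b, ee (z * (n:ℝ) ^ c)‖ ≤ ppC c * (1 + log N) * (√(|z| * N ^ c) + N / (|z| * N ^ c)) := by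
  rcases lt_or_gt_of_ne hz with h | h
  · rw [abs_of_neg h, ← norm_sum_ee_neg]
    have := powerphase_pos hc hc2 hN (neg_pos.2 h) a b ha hb
    simpa [neg_mul] using this
  · rw [abs_of_pos h]
    exact powerphase_pos hc hc2 hN h a b ha hb

lemma ppC_pos {c : ℝ} (hc : 1 < c) : 1000 ≤ ppC c := by
  unfold ppC
  have : 0 < 2 / (c * (c-1)) := by
    have : 0 < c - 1 := by linarith
    positivity
  linarith
end

section
open Real MeasureTheory

/-- bilinear sums over a hyperbolic range -/
noncomputable def bil (f g : ℕ → ℂ) (E : ℕ → ℂ) (A N : ℕ) : ℂ :=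
  ∑ m ∈ Finset.Ioc 0 N, ∑ n ∈ Finset.Ioc 0 N, if A < m * n ∧ m * n ≤ N then f m * g n * E (m * n) else 0

lemma conv_sum (f g : ArithmeticFunction ℝ) (E : ℕ → ℂ) (A N : ℕ) :
    ∑ n ∈ Finset.Ioc A N, (((f * g) n : ℝ) : ℂ) * E n = bil (fun m => f m) (fun n => g n) E A N := by
  unfold bil
  rw [← Finset.sum_product', ← Finset.sum_filter]
  trans ∑ n ∈ Finset.Ioc A N, ∑ x ∈ Finset.Ioc 0 N ×ˢ Finset.Ioc 0 N with x.1 * x.2 = n, (f x.1 : ℂ) * (g x.2 : ℂ) * E (x.1 * x.2)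
  · refine Finset.sum_congr rfl fun n hn ↦ ?_
    rw [Finset.mem_Ioc] at hn
    rw [ArithmeticFunction.mul_apply, Nat.divisorsAntidiagonal_eq_prod_filter_of_le (by omega) hn.2]
    push_cast
    rw [Finset.sum_mul]
    apply Finset.sum_congr rfl
    intro x hx
    rw [(Finset.mem_filter.1 hx).2]
  · simp_rw [Finset.sum_filter]
    rw [Finset.sum_comm]
    refine Finset.sum_congr rfl fun x _ ↦ ?_
    rw [Finset.sum_ite_eq]
    simp only [Finset.mem_Ioc]

lemma card_divisors_mul_le (a b : ℕ) : (a * b).divisors.card ≤ a.divisors.card * b.divisors.card := by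
  rw [Nat.divisors_mul]; exact Finset.card_mul_le

noncomputable def dd (n : ℕ) : ℝ := (n.divisors.card : ℝ)

lemma dd_nonneg (n : ℕ) : 0 ≤ dd n := by unfold dd; positivity

lemma dd_mul_le (a b : ℕ) : dd (a*b) ≤ dd a * dd b := by
  unfold dd; exact_mod_cast card_divisors_mul_le a b

lemma sum_divisors_swap (F : ℕ → ℕ → ℝ) (N : ℕ) :
    ∑ n ∈ Finset.Ioc 0 N, ∑ d ∈ n.divisors, F d n = ∑ d ∈ Finset.Ioc 0 N, ∑ k ∈ Finset.Ioc 0 (N / d), F d (d * k) := by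
  have h1 : ∀ n ∈ Finset.Ioc 0 N, ∑ d ∈ n.divisors, F d n = ∑ d ∈ Finset.Ioc 0 N, if d ∣ n then F d n else 0 := by
    intro n hn
    rw [Finset.mem_Ioc] at hn
    rw [← Finset.sum_filter]
    apply Finset.sum_congr _ (fun _ _ => rfl)
    ext d
    simp only [Nat.mem_divisors, Finset.mem_filter, Finset.mem_Ioc]
    constructor
    · rintro ⟨h, h0⟩; exact ⟨⟨Nat.pos_of_dvd_of_pos h hn.1, (Nat.le_of_dvd hn.1 h).trans hn.2⟩, h⟩
    · rintro ⟨_, h⟩; exact ⟨h, by omega⟩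
  rw [Finset.sum_congr rfl h1, Finset.sum_comm]
  apply Finset.sum_congr rfl
  intro d hd
  rw [Finset.mem_Ioc] at hd
  rw [← Finset.sum_filter]
  symm
  apply Finset.sum_nbij' (fun k => d * k) (fun n => n / d)
  · intro k hk
    simp only [Finset.mem_Ioc, Finset.mem_filter] at hk ⊢
    exact ⟨⟨Nat.mul_pos hd.1 hk.1, by have := (Nat.le_div_iff_mul_le hd.1).1 hk.2; rwa [mul_comm] at this⟩, dvd_mul_right _ _⟩
  · intro n hn
    simp only [Finset.mem_Ioc, Finset.mem_filter] at hn ⊢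
    exact ⟨Nat.div_pos (Nat.le_of_dvd hn.1.1 hn.2) hd.1, Nat.div_le_div_right hn.1.2⟩
  · intro k hk
    exact Nat.mul_div_cancel_left _ hd.1
  · intro n hn
    simp only [Finset.mem_Ioc, Finset.mem_filter] at hn
    exact Nat.mul_div_cancel' hn.2
  · intro k hk; rfl

lemma harmonic_Ioc (N : ℕ) : ∑ h ∈ Finset.Ioc 0 N, (1:ℝ) / h ≤ 1 + log N := by
  have := harmonic_le_one_add_log N
  rw [harmonic_eq_sum_Icc] at this
  push_cast at this
  simp only [one_div]
  exact this

lemma nat_div_le_real (N d : ℕ) : ((N / d : ℕ) : ℝ) ≤ (N:ℝ) / d := Nat.cast_div_le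

lemma log_mono_nat {a b : ℕ} (h : a ≤ b) : log a ≤ log b := by
  rcases Nat.eq_zero_or_pos a with rfl | ha
  · simp; exact Real.log_natCast_nonneg b
  · exact Real.log_le_log (by exact_mod_cast ha) (by exact_mod_cast h)

lemma sum_dd_le (N : ℕ) : ∑ n ∈ Finset.Ioc 0 N, dd n ≤ N * (1 + log N) := by
  have := sum_divisors_swap (fun _ _ => 1) N
  simp only [Finset.sum_const, nsmul_eq_mul, mul_one, Nat.card_Ioc, Nat.sub_zero] at this
  unfold dd
  rw [this]
  calc _ ≤ ∑ d ∈ Finset.Ioc 0 N, (N:ℝ) * (1 / d) := by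
        apply Finset.sum_le_sum; intro d _; rw [mul_one_div]; exact nat_div_le_real N d
    _ = N * ∑ d ∈ Finset.Ioc 0 N, (1:ℝ) / d := by rw [Finset.mul_sum]
    _ ≤ _ := by gcongr; exact harmonic_Ioc N

lemma sum_dd_div_le (N : ℕ) : ∑ n ∈ Finset.Ioc 0 N, dd n / n ≤ (1 + log N) ^ 2 := by
  have := sum_divisors_swap (fun _ n => 1 / (n:ℝ)) N
  simp only [Finset.sum_const, nsmul_eq_mul] at this
  have e : ∑ n ∈ Finset.Ioc 0 N, dd n / n = ∑ n ∈ Finset.Ioc 0 N, (n.divisors.card : ℝ) * (1 / (n:ℝ)) := by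
    apply Finset.sum_congr rfl; intro n _; unfold dd; ring
  rw [e, this]
  have hl : 0 ≤ log (N:ℝ) := Real.log_natCast_nonneg N
  calc _ ≤ ∑ d ∈ Finset.Ioc 0 N, (1 / (d:ℝ)) * (1 + log N) := by
        apply Finset.sum_le_sum; intro d _
        have : ∑ k ∈ Finset.Ioc 0 (N / d), 1 / (((d * k : ℕ)) : ℝ) = (1 / (d:ℝ)) * ∑ k ∈ Finset.Ioc 0 (N / d), 1 / (k:ℝ) := by
          rw [Finset.mul_sum]; apply Finset.sum_congr rfl; intro k _; push_cast; rw [one_div_mul_one_div]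
        rw [this]
        gcongr
        refine (harmonic_Ioc _).trans ?_
        have := log_mono_nat (Nat.div_le_self N d)
        linarith
    _ = (∑ d ∈ Finset.Ioc 0 N, 1 / (d:ℝ)) * (1 + log N) := by rw [Finset.sum_mul]
    _ ≤ _ := by rw [sq]; gcongr; exact harmonic_Ioc N

lemma sum_dd_sq_le (N : ℕ) : ∑ n ∈ Finset.Ioc 0 N, dd n ^ 2 ≤ N * (1 + log N) ^ 3 := by
  have := sum_divisors_swap (fun _ n => dd n) N
  have hl : 0 ≤ log (N:ℝ) := Real.log_natCast_nonneg N
  have e : ∑ n ∈ Finset.Ioc 0 N, dd n ^ 2 = ∑ n ∈ Finset.Ioc 0 N, ∑ d ∈ n.divisors, dd n := by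
    apply Finset.sum_congr rfl; intro n _; rw [Finset.sum_const, nsmul_eq_mul, sq]; rfl
  rw [e, this]
  calc _ ≤ ∑ d ∈ Finset.Ioc 0 N, dd d * (N / d * (1 + log N)) := by
        apply Finset.sum_le_sum; intro d _
        calc _ ≤ ∑ k ∈ Finset.Ioc 0 (N / d), dd d * dd k := Finset.sum_le_sum fun k _ => dd_mul_le d k
          _ = dd d * ∑ k ∈ Finset.Ioc 0 (N / d), dd k := by rw [Finset.mul_sum]
          _ ≤ _ := by
            apply mul_le_mul_of_nonneg_left _ (dd_nonneg d)
            refine (sum_dd_le _).trans ?_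
            have h1 := log_mono_nat (Nat.div_le_self N d)
            have h2 := nat_div_le_real N d
            have h3 : 0 ≤ log ((N / d : ℕ):ℝ) := Real.log_natCast_nonneg _
            gcongr
    _ = N * (1 + log N) * ∑ d ∈ Finset.Ioc 0 N, dd d / d := by
        rw [Finset.mul_sum]; apply Finset.sum_congr rfl; intro d _; ring
    _ ≤ N * (1 + log N) * (1 + log N) ^ 2 := by gcongr; exact sum_dd_div_le N
    _ = _ := by ring

open ArithmeticFunction in
/-- truncation of an arithmetic function to `n ≤ U` -/
noncomputable def trunc (f : ArithmeticFunction ℝ) (U : ℕ) : ArithmeticFunction ℝ :=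
  ⟨fun n => if n ≤ U then f n else 0, by simp⟩

lemma trunc_apply (f : ArithmeticFunction ℝ) (U n : ℕ) : trunc f U n = if n ≤ U then f n else 0 := rfl

noncomputable def muR : ArithmeticFunction ℝ := (ArithmeticFunction.moebius : ArithmeticFunction ℝ)
noncomputable def zetaR : ArithmeticFunction ℝ := (ArithmeticFunction.zeta : ArithmeticFunction ℝ)

lemma muR_mul_zetaR : muR * zetaR = 1 := ArithmeticFunction.coe_moebius_mul_coe_zeta

lemma abs_muR_le (n : ℕ) : |muR n| ≤ 1 := by
  have := ArithmeticFunction.abs_moebius_le_one (n := n)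
  unfold muR
  rw [ArithmeticFunction.intCoe_apply]
  exact_mod_cast this

/-- Vaughan's identity -/
lemma vaughan (U : ℕ) : ArithmeticFunction.vonMangoldt =
    trunc ArithmeticFunction.vonMangoldt U + trunc muR U * ArithmeticFunction.log
      - (trunc muR U * trunc ArithmeticFunction.vonMangoldt U) * zetaR
      + ((muR - trunc muR U) * zetaR) * (ArithmeticFunction.vonMangoldt - trunc ArithmeticFunction.vonMangoldt U) := by
  have h1 : ArithmeticFunction.vonMangoldt * zetaR = ArithmeticFunction.log := ArithmeticFunction.vonMangoldt_mul_zeta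
  have h2 := muR_mul_zetaR
  rw [← h1]
  linear_combination (trunc ArithmeticFunction.vonMangoldt U - ArithmeticFunction.vonMangoldt) * h2

lemma vau_a_apply (U n : ℕ) : ((muR - trunc muR U) * zetaR) n = ∑ d ∈ n.divisors, (muR d - if d ≤ U then muR d else 0) := by
  unfold zetaR
  rw [ArithmeticFunction.coe_mul_zeta_apply]
  apply Finset.sum_congr rfl; intro d _
  rw [sub_eq_add_neg, ArithmeticFunction.add_apply, ArithmeticFunction.neg_apply, trunc_apply]; ring

lemma vau_a_bound (U n : ℕ) : |((muR - trunc muR U) * zetaR) n| ≤ dd n := by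
  rw [vau_a_apply]
  calc _ ≤ ∑ d ∈ n.divisors, (1:ℝ) := by
        refine (Finset.abs_sum_le_sum_abs _ _).trans (Finset.sum_le_sum fun d _ => ?_)
        split_ifs
        · simp
        · simpa using abs_muR_le d
    _ = dd n := by simp [dd]

lemma vau_a_zero (U n : ℕ) (h : n ≤ U) : ((muR - trunc muR U) * zetaR) n = 0 := by
  rw [vau_a_apply]
  apply Finset.sum_eq_zero
  intro d hd
  rw [if_pos ((Nat.divisor_le hd).trans h), sub_self]

lemma vau_b_bound (U n : ℕ) : |(trunc muR U * trunc ArithmeticFunction.vonMangoldt U) n| ≤ log n := by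
  rw [ArithmeticFunction.mul_apply]
  calc _ ≤ ∑ x ∈ n.divisorsAntidiagonal, ArithmeticFunction.vonMangoldt x.2 := by
        refine (Finset.abs_sum_le_sum_abs _ _).trans (Finset.sum_le_sum fun x _ => ?_)
        rw [abs_mul, trunc_apply, trunc_apply]
        have h1 := abs_muR_le x.1
        have h2 : 0 ≤ ArithmeticFunction.vonMangoldt x.2 := ArithmeticFunction.vonMangoldt_nonneg
        have h3 : |if x.1 ≤ U then muR x.1 else 0| ≤ 1 := by split_ifs <;> simp [h1]
        have h4 : |if x.2 ≤ U then ArithmeticFunction.vonMangoldt x.2 else 0| ≤ ArithmeticFunction.vonMangoldt x.2 := by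
          split_ifs
          · rw [abs_of_nonneg h2]
          · simpa using h2
        calc _ ≤ 1 * ArithmeticFunction.vonMangoldt x.2 := mul_le_mul h3 h4 (abs_nonneg _) (by norm_num)
          _ = _ := one_mul _
    _ = log n := by
        rw [← ArithmeticFunction.vonMangoldt_sum, Nat.sum_divisorsAntidiagonal' (f := fun _ j => ArithmeticFunction.vonMangoldt j)]

lemma vau_b_zero (U n : ℕ) (h : U * U < n) : (trunc muR U * trunc ArithmeticFunction.vonMangoldt U) n = 0 := by
  rw [ArithmeticFunction.mul_apply]
  apply Finset.sum_eq_zero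
  intro x hx
  rw [Nat.mem_divisorsAntidiagonal] at hx
  rw [trunc_apply, trunc_apply]
  split_ifs with h1 h2
  · have := Nat.mul_le_mul h1 h2
    omega
  all_goals simp

/-- Vaughan decomposition of the exponential sum -/
lemma vaughan_sum (U A N : ℕ) (hU : U ≤ A) (E : ℕ → ℂ) :
    ∑ n ∈ Finset.Ioc A N, ((ArithmeticFunction.vonMangoldt n : ℝ) : ℂ) * E n =
      bil (fun m => (trunc muR U m : ℝ)) (fun n => (log n : ℝ)) E A N
      - bil (fun m => ((trunc muR U * trunc ArithmeticFunction.vonMangoldt U) m : ℝ)) (fun n => (zetaR n : ℝ)) E A N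
      + bil (fun m => (((muR - trunc muR U) * zetaR) m : ℝ)) (fun n => ((ArithmeticFunction.vonMangoldt - trunc ArithmeticFunction.vonMangoldt U) n : ℝ)) E A N := by
  have h1 := conv_sum (trunc muR U) ArithmeticFunction.log E A N
  have h2 := conv_sum (trunc muR U * trunc ArithmeticFunction.vonMangoldt U) zetaR E A N
  have h3 := conv_sum ((muR - trunc muR U) * zetaR) (ArithmeticFunction.vonMangoldt - trunc ArithmeticFunction.vonMangoldt U) E A N
  simp only [ArithmeticFunction.log_apply] at h1
  rw [← h1, ← h2, ← h3, ← Finset.sum_sub_distrib, ← Finset.sum_add_distrib]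
  apply Finset.sum_congr rfl
  intro n hn
  rw [Finset.mem_Ioc] at hn
  have e := congrArg (fun f => (f n : ℝ)) (vaughan U)
  simp only [sub_eq_add_neg, ArithmeticFunction.add_apply, ArithmeticFunction.neg_apply] at e ⊢
  rw [trunc_apply, if_neg (by omega), zero_add] at e
  conv_lhs => rw [e]
  push_cast; ring
end

section
open Real MeasureTheory

/-- Abel summation with increasing nonnegative weights -/
lemma abel_tail (w : ℕ → ℝ) (f : ℕ → ℂ) (a b : ℕ) {B M : ℝ} (hM : 0 ≤ M)
    (hw0 : ∀ n, a ≤ n → n < b → 0 ≤ w n)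
    (hmono : ∀ n, a ≤ n → n + 1 < b → w n ≤ w (n+1)) (hB : ∀ n, a ≤ n → n < b → w n ≤ B) (hB0 : 0 ≤ B)
    (htail : ∀ k, a ≤ k → ‖∑ n ∈ Finset.Ico k b, f n‖ ≤ M) :
    ‖∑ n ∈ Finset.Ico a b, (w n : ℂ) * f n‖ ≤ B * M := by
  by_cases hab : b ≤ a
  · rw [Finset.Ico_eq_empty_of_le hab]; simp; positivity
  push Not at hab
  -- claim by downward induction: ‖Σ_{k}^{b} w f - w k F k‖ ≤ (w (b-1) - w k) M
  have key : ∀ j, ∀ k, a ≤ k → k + j + 1 = b →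
      ‖∑ n ∈ Finset.Ico k b, (w n : ℂ) * f n - w k * ∑ n ∈ Finset.Ico k b, f n‖ ≤ (w (b-1) - w k) * M := by
    intro j
    induction j with
    | zero =>
      intro k hk hkb
      have : b = k + 1 := by omega
      subst this
      simp
    | succ j ih =>
      intro k hk hkb
      have := ih (k+1) (by omega) (by omega)
      rw [Finset.sum_eq_sum_Ico_succ_bot (by omega) (fun n => (w n : ℂ) * f n), Finset.sum_eq_sum_Ico_succ_bot (by omega) f]
      have e : ((w k : ℂ) * f k + ∑ n ∈ Finset.Ico (k+1) b, (w n : ℂ) * f n) - w k * (f k + ∑ n ∈ Finset.Ico (k+1) b, f n)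
         = (∑ n ∈ Finset.Ico (k+1) b, (w n : ℂ) * f n - w (k+1) * ∑ n ∈ Finset.Ico (k+1) b, f n) + ((w (k+1) - w k : ℝ) : ℂ) * ∑ n ∈ Finset.Ico (k+1) b, f n := by
        push_cast; ring
      rw [e]
      refine (norm_add_le _ _).trans ?_
      rw [norm_mul, Complex.norm_real, Real.norm_eq_abs, abs_of_nonneg (by linarith [hmono k hk (by omega)])]
      have h2 := htail (k+1) (by omega)
      have h3 : 0 ≤ w (k+1) - w k := by linarith [hmono k hk (by omega)]
      nlinarith
  have h1 := key (b - a - 1) a le_rfl (by omega)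
  have h2 := htail a le_rfl
  have h3 := hw0 a le_rfl hab
  have h4 := hB (b-1) (by omega) (by omega)
  have e : ∑ n ∈ Finset.Ico a b, (w n : ℂ) * f n = (∑ n ∈ Finset.Ico a b, (w n : ℂ) * f n - w a * ∑ n ∈ Finset.Ico a b, f n) + w a * ∑ n ∈ Finset.Ico a b, f n := by ring
  rw [e]
  refine (norm_add_le _ _).trans ?_
  rw [norm_mul, Complex.norm_real, Real.norm_eq_abs, abs_of_nonneg h3]
  nlinarith

noncomputable def EE (x c : ℝ) (n : ℕ) : ℂ := ee (x * (n:ℝ) ^ c)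

lemma norm_EE (x c : ℝ) (n : ℕ) : ‖EE x c n‖ = 1 := norm_ee _

lemma EE_mul (x c : ℝ) (m n : ℕ) : EE x c (m * n) = ee ((x * (m:ℝ)^c) * (n:ℝ) ^ c) := by
  unfold EE
  push_cast
  rw [Real.mul_rpow (by positivity) (by positivity), mul_assoc]

/-- inner hyperbolic sum becomes an interval sum -/
lemma inner_hyp (F : ℕ → ℂ) (A N d : ℕ) (hd : 0 < d) :
    ∑ n ∈ Finset.Ioc 0 N, (if A < d * n ∧ d * n ≤ N then F n else 0) = ∑ n ∈ Finset.Ico (A / d + 1) (N / d + 1), F n := by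
  rw [← Finset.sum_filter]
  apply Finset.sum_congr _ (fun _ _ => rfl)
  ext n
  simp only [Finset.mem_filter, Finset.mem_Ioc, Finset.mem_Ico]
  rw [Nat.succ_le_iff, Nat.lt_succ_iff, Nat.div_lt_iff_lt_mul hd, Nat.le_div_iff_mul_le hd, mul_comm d n]
  constructor
  · rintro ⟨_, h⟩; exact h
  · rintro ⟨h1, h2⟩
    have : 0 < n := by
      rcases Nat.eq_zero_or_pos n with rfl | h
      · simp at h1
      · exact h
    exact ⟨⟨this, by nlinarith⟩, h1, h2⟩

lemma typeI {c x : ℝ} (hc : 1 < c) (hc2 : c < 2) (hx : x ≠ 0) (N D : ℕ) (hN : 1 ≤ N) (hD : D ≤ N)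
    (f : ℕ → ℂ) (w : ℕ → ℝ) {F B : ℝ} (hF : ∀ m, m ≤ N → ‖f m‖ ≤ F) (hF0 : 0 ≤ F) (hf : ∀ m, D < m → f m = 0)
    (hw0 : ∀ n, 1 ≤ n → 0 ≤ w n) (hmono : ∀ n, 1 ≤ n → w n ≤ w (n+1)) (hB0 : 0 ≤ B) (hB : ∀ n, 1 ≤ n → n ≤ N → w n ≤ B) :
    ‖bil f (fun n => w n) (EE x c) (N / 4) N‖ ≤ F * B * (ppC c * (1 + log N)) * (D * √(|x| * (N:ℝ) ^ c) + (1 + log N) * (N / (|x| * (N:ℝ) ^ c))) := by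
  set T := |x| * (N:ℝ) ^ c with hT
  have hNr : (1:ℝ) ≤ N := by exact_mod_cast hN
  have hT0 : 0 < T := by
    have := abs_pos.2 hx
    positivity
  have hl0 : 0 ≤ log (N:ℝ) := Real.log_natCast_nonneg N
  have hpc := ppC_pos hc
  have inner : ∀ d ∈ Finset.Ioc 0 N, ‖∑ n ∈ Finset.Ioc 0 N, (if N / 4 < d * n ∧ d * n ≤ N then f d * (w n : ℂ) * EE x c (d * n) else 0)‖
      ≤ if d ≤ D then F * B * (ppC c * (1 + log N)) * (√T + (N / T) * (1 / d)) else 0 := by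
    intro d hd
    rw [Finset.mem_Ioc] at hd
    split_ifs with hdD
    · rw [inner_hyp (fun n => f d * (w n : ℂ) * EE x c (d * n)) _ _ _ hd.1]
      simp_rw [mul_assoc (f d)]
      rw [← Finset.mul_sum, norm_mul]
      have hd1 : (1:ℝ) ≤ d := by exact_mod_cast hd.1
      have hdN : (d:ℝ) ≤ N := by exact_mod_cast hd.2
      have htail : ‖∑ n ∈ Finset.Ico (N / 4 / d + 1) (N / d + 1), (w n : ℂ) * EE x c (d * n)‖ ≤ B * (ppC c * (1 + log N) * (√T + (N / T) * (1/d))) := by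
        apply abel_tail w _ _ _ (by positivity)
        · intro n h1 _; exact hw0 n (le_trans (Nat.le_add_left _ _) h1)
        · intro n h1 _; exact hmono n (le_trans (Nat.le_add_left _ _) h1)
        · intro n h1 h2; exact hB n (le_trans (Nat.le_add_left _ _) h1) (by have := Nat.div_le_self N d; omega)
        · exact hB0
        · intro k hk
          simp_rw [EE_mul]
          have hp := powerphase (c := c) (N := (N:ℝ)/d) (z := x * (d:ℝ)^c) hc hc2 (by rw [le_div_iff₀ (by linarith)]; linarith)
            (by positivity) k (N / d + 1)
            (by
              have h1 : (N/4/d + 1) ≤ k := hk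
              have h2 : N / 4 < d * k := by
                have : N / 4 / d < k := by omega
                rw [Nat.div_lt_iff_lt_mul hd.1] at this
                linarith [mul_comm k d]
              have h3 : N < 4 * (d * k) := by omega
              have h4 : (N:ℝ) < 4 * (d * k) := by exact_mod_cast h3
              rw [div_div, div_le_iff₀ (by linarith)]
              nlinarith)
            (by push_cast; have := nat_div_le_real N d; linarith)
          have eT : |x * (d:ℝ)^c| * ((N:ℝ)/d)^c = T := by
            rw [abs_mul, abs_of_pos (by positivity : (0:ℝ) < (d:ℝ)^c), Real.div_rpow (by positivity) (by positivity), hT]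
            have : (0:ℝ) < (d:ℝ)^c := by positivity
            field_simp
          rw [eT] at hp
          refine hp.trans ?_
          have hlog : log ((N:ℝ)/d) ≤ log N := by
            apply Real.log_le_log (by positivity)
            rw [div_le_iff₀ (by linarith)]; nlinarith
          have e2 : (N:ℝ)/d/T = (N/T) * (1/d) := by field_simp
          rw [e2]
          gcongr
      calc _ ≤ F * (B * (ppC c * (1 + log N) * (√T + (N / T) * (1/d)))) := by
            apply mul_le_mul (hF d hd.2) htail (norm_nonneg _) hF0
        _ = _ := by ring
    · rw [hf d (by omega)]; simp
  unfold bil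
  refine (norm_sum_le _ _).trans ((Finset.sum_le_sum inner).trans ?_)
  rw [← Finset.sum_filter]
  have hfil : (Finset.Ioc 0 N).filter (fun d => d ≤ D) = Finset.Ioc 0 D := by
    ext d; simp only [Finset.mem_filter, Finset.mem_Ioc]; omega
  rw [hfil, ← Finset.mul_sum, Finset.sum_add_distrib, ← Finset.mul_sum, Finset.sum_const, Nat.card_Ioc, nsmul_eq_mul, Nat.sub_zero]
  have hh : ∑ i ∈ Finset.Ioc 0 D, (1:ℝ)/i ≤ 1 + log N := (harmonic_Ioc D).trans (by have := log_mono_nat hD; linarith)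
  have : 0 < (N:ℝ) / T := by positivity
  rw [mul_comm (N / T : ℝ)]
  gcongr
end

section
open Real MeasureTheory

/-- correlation sum in the type II estimate -/
noncomputable def corrI (x c : ℝ) (A N K m₁ m₂ : ℕ) : ℂ :=
  ∑ n ∈ Finset.Ioc 0 K, (if A < m₁ * n ∧ m₁ * n ≤ N then EE x c (m₁ * n) else 0) * (starRingEnd ℂ) (if A < m₂ * n ∧ m₂ * n ≤ N then EE x c (m₂ * n) else 0)

lemma corrI_symm (x c : ℝ) (A N K m₁ m₂ : ℕ) : ‖corrI x c A N K m₁ m₂‖ = ‖corrI x c A N K m₂ m₁‖ := by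
  unfold corrI
  rw [← Complex.norm_conj, map_sum]
  congr 1
  apply Finset.sum_congr rfl
  intro n _
  rw [map_mul, Complex.conj_conj, mul_comm]

lemma corrI_diag (x c : ℝ) (A N K m₁ m₂ : ℕ) : ‖corrI x c A N K m₁ m₂‖ ≤ K := by
  unfold corrI
  refine (norm_sum_le _ _).trans ?_
  calc _ ≤ ∑ n ∈ Finset.Ioc 0 K, (1:ℝ) := by
        apply Finset.sum_le_sum
        intro n _
        rw [norm_mul, Complex.norm_conj]
        have h : ∀ m : ℕ, ‖(if A < m * n ∧ m * n ≤ N then EE x c (m * n) else 0)‖ ≤ 1 := by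
          intro m; split_ifs
          · rw [norm_EE]
          · simp
        have := mul_le_mul (h m₁) (h m₂) (norm_nonneg _) (by norm_num)
        linarith
    _ = K := by simp

lemma rpow_diff_bounds {c M u v : ℝ} (hc : 1 < c) (hc2 : c < 2) (hM : 0 < M) (hu : M ≤ u) (huv : u < v) (hv : v ≤ 3 * M) :
    M ^ (c-1) * (v - u) ≤ v ^ c - u ^ c ∧ v ^ c - u ^ c ≤ 6 * M ^ (c-1) * (v - u) := by
  obtain ⟨ξ, h1, h2, h3⟩ := rpow_diff_mvt (e := c) (by linarith : 0 < u) huv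
  rw [h3]
  have hd : 0 < v - u := by linarith
  have l1 : M ^ (c-1) ≤ ξ ^ (c-1) := Real.rpow_le_rpow hM.le (by linarith) (by linarith)
  have l2 : ξ ^ (c-1) ≤ (3 * M) ^ (c-1) := Real.rpow_le_rpow (by linarith) (by linarith) (by linarith)
  rw [rpow_scale hM (by norm_num)] at l2
  have l4 : (3 : ℝ) ^ (c-1) ≤ 3 ^ (1:ℝ) := Real.rpow_le_rpow_of_exponent_le (by norm_num) (by linarith)
  rw [Real.rpow_one] at l4
  have hMp : 0 < M ^ (c-1) := by positivity
  have hξ : 0 < ξ ^ (c-1) := Real.rpow_pos_of_pos (by linarith) _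
  have l5 : ξ ^ (c-1) ≤ 3 * M ^ (c-1) := l2.trans (mul_le_mul_of_nonneg_right l4 hMp.le)
  constructor
  · apply mul_le_mul_of_nonneg_right _ hd.le
    nlinarith
  · apply mul_le_mul_of_nonneg_right _ hd.le
    calc c * ξ ^ (c-1) ≤ 2 * (3 * M ^ (c-1)) := mul_le_mul hc2.le l5 hξ.le (by norm_num)
      _ = _ := by ring

lemma corrI_off {c x : ℝ} (hc : 1 < c) (hc2 : c < 2) (hx : x ≠ 0) (N M q m₁ m₂ : ℕ) (hM : 1 ≤ M) (hMN : M ≤ N)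
    (h1 : M ≤ m₁) (h12 : m₁ < m₂) (h2 : m₂ ≤ 3 * M) (hq : m₂ - m₁ ≤ q) :
    ‖corrI x c (N/4) N (N/M) m₁ m₂‖ ≤ ppC c * (1 + log N) * (√(6 * (|x| * (N:ℝ)^c) * q / M) + N / (|x| * (N:ℝ)^c) * (1 / ((m₂ - m₁ : ℕ) : ℝ))) := by
  set T := |x| * (N:ℝ) ^ c with hT
  have hMr : (1:ℝ) ≤ M := by exact_mod_cast hM
  have hMNr : (M:ℝ) ≤ N := by exact_mod_cast hMN
  have hNr : (1:ℝ) ≤ N := by linarith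
  have hxp := abs_pos.2 hx
  have hT0 : 0 < T := by positivity
  have hl0 : 0 ≤ log (N:ℝ) := Real.log_natCast_nonneg N
  have hpc := ppC_pos hc
  have e : corrI x c (N/4) N (N/M) m₁ m₂ = ∑ n ∈ Finset.Ico ((N/4) / m₁ + 1) (N / m₂ + 1), ee ((x * ((m₁:ℝ)^c - (m₂:ℝ)^c)) * (n:ℝ)^c) := by
    unfold corrI
    have e1 : ∀ n ∈ Finset.Ioc 0 (N/M), (if N/4 < m₁ * n ∧ m₁ * n ≤ N then EE x c (m₁ * n) else 0) * (starRingEnd ℂ) (if N/4 < m₂ * n ∧ m₂ * n ≤ N then EE x c (m₂ * n) else 0)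
       = if N/4 < m₁ * n ∧ m₂ * n ≤ N then ee ((x * ((m₁:ℝ)^c - (m₂:ℝ)^c)) * (n:ℝ)^c) else 0 := by
      intro n hn
      have hle : m₁ * n ≤ m₂ * n := Nat.mul_le_mul_right _ h12.le
      by_cases hA : N/4 < m₁ * n ∧ m₂ * n ≤ N
      · rw [if_pos hA, if_pos ⟨hA.1, by omega⟩, if_pos ⟨by omega, hA.2⟩, EE_mul, EE_mul, conj_ee, ← ee_add]
        congr 1; ring
      · rw [if_neg hA]
        by_cases hB : N/4 < m₁ * n
        · rw [if_neg (c := N/4 < m₂ * n ∧ m₂ * n ≤ N) (by omega)]; simp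
        · rw [if_neg (by omega)]; simp
    rw [Finset.sum_congr rfl e1, ← Finset.sum_filter]
    apply Finset.sum_congr _ (fun _ _ => rfl)
    ext n
    have hm1 : 0 < m₁ := by omega
    have hm2 : 0 < m₂ := by omega
    simp only [Finset.mem_filter, Finset.mem_Ioc, Finset.mem_Ico]
    rw [Nat.succ_le_iff, Nat.lt_succ_iff, Nat.div_lt_iff_lt_mul hm1, Nat.le_div_iff_mul_le hm2, Nat.le_div_iff_mul_le (by omega : 0 < M), mul_comm m₁ n, mul_comm m₂ n]
    constructor
    · rintro ⟨_, h⟩; exact h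
    · rintro ⟨k1, k2⟩
      have : 0 < n := by
        rcases Nat.eq_zero_or_pos n with rfl | h
        · simp at k1
        · exact h
      exact ⟨⟨this, by nlinarith⟩, k1, k2⟩
  rw [e]
  have hm1r : (M:ℝ) ≤ m₁ := by exact_mod_cast h1
  have hm12r : (m₁:ℝ) < m₂ := by exact_mod_cast h12
  have hm2r : (m₂:ℝ) ≤ 3 * M := by exact_mod_cast h2
  obtain ⟨b1, b2⟩ := rpow_diff_bounds hc hc2 (by linarith : (0:ℝ) < M) hm1r hm12r hm2r
  set k : ℝ := ((m₂ - m₁ : ℕ) : ℝ) with hk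
  have hke : (m₂:ℝ) - m₁ = k := by rw [hk, Nat.cast_sub h12.le]
  rw [hke] at b1 b2
  have hk1 : 1 ≤ k := by rw [hk]; exact_mod_cast (by omega : 1 ≤ m₂ - m₁)
  have hkq : k ≤ q := by rw [hk]; exact_mod_cast hq
  have hMp : 0 < (M:ℝ) ^ (c-1) := by positivity
  have hMc : (M:ℝ)^c = (M:ℝ)^(c-1) * M := by rw [← Real.rpow_add_one (by linarith)]; ring_nf
  have hdpos : 0 < (m₂:ℝ)^c - (m₁:ℝ)^c := by
    have : 0 < (M:ℝ)^(c-1) * k := by positivity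
    linarith
  have hp := powerphase (c := c) (N := (N:ℝ)/M) (z := x * ((m₁:ℝ)^c - (m₂:ℝ)^c)) hc hc2 (by rw [le_div_iff₀ (by linarith)]; linarith)
    (mul_ne_zero hx (by linarith)) (N/4/m₁ + 1) (N / m₂ + 1)
    (by
      have k2 : N / 4 < m₁ * (N/4/m₁ + 1) := Nat.lt_mul_div_succ _ (by omega)
      have k3 : N < 4 * (m₁ * (N/4/m₁ + 1)) := by omega
      have k4 : (N:ℝ) < 4 * (m₁ * ((N/4/m₁ + 1 : ℕ) : ℝ)) := by exact_mod_cast k3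
      rw [div_div, div_le_iff₀ (by linarith)]
      have k5 : (0:ℝ) ≤ ((N/4/m₁ + 1 : ℕ) : ℝ) := by positivity
      have k6 : (m₁:ℝ) * ((N/4/m₁ + 1 : ℕ) : ℝ) ≤ 3 * M * ((N/4/m₁ + 1 : ℕ) : ℝ) := mul_le_mul_of_nonneg_right (by linarith) k5
      have k7 : 0 ≤ (M:ℝ) * ((N/4/m₁ + 1 : ℕ) : ℝ) := by positivity
      linarith)
    (by
      push_cast
      have k1 : N / m₂ ≤ N / M := Nat.div_le_div_left (by omega) (by omega)
      have k2 : ((N / m₂ : ℕ):ℝ) ≤ ((N / M : ℕ):ℝ) := by exact_mod_cast k1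
      have := nat_div_le_real N M
      linarith)
  have eT : |x * ((m₁:ℝ)^c - (m₂:ℝ)^c)| * ((N:ℝ)/M)^c = T * (((m₂:ℝ)^c - (m₁:ℝ)^c) / (M:ℝ)^c) := by
    rw [abs_mul, abs_sub_comm, abs_of_pos hdpos, Real.div_rpow (by positivity) (by positivity), hT]
    ring
  rw [eT] at hp
  set Tz := T * (((m₂:ℝ)^c - (m₁:ℝ)^c) / (M:ℝ)^c) with hTz
  have hTz1 : T * (k / M) ≤ Tz := by
    rw [hTz]; apply mul_le_mul_of_nonneg_left _ hT0.le
    rw [hMc, div_le_div_iff₀ (by linarith) (by positivity)]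
    nlinarith
  have hTz2 : Tz ≤ 6 * T * q / M := by
    have : Tz ≤ T * (6 * k / M) := by
      rw [hTz]; apply mul_le_mul_of_nonneg_left _ hT0.le
      rw [hMc, div_le_div_iff₀ (by positivity) (by linarith)]
      nlinarith
    refine this.trans ?_
    rw [show T * (6 * k / M) = 6 * T * k / M by ring]
    gcongr
  refine hp.trans ?_
  have hlog : log ((N:ℝ)/M) ≤ log N := by
    apply Real.log_le_log (by positivity)
    rw [div_le_iff₀ (by linarith)]; nlinarith
  have hTk : 0 < T * (k / M) := by positivity
  have hlast : (N:ℝ)/M/Tz ≤ N / T * (1/k) := by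
    calc (N:ℝ)/M/Tz ≤ (N:ℝ)/M/(T * (k / M)) := by gcongr
      _ = _ := by field_simp
  gcongr

lemma sum_inv_dist (J1 q m : ℕ) (hm : m ∈ Finset.Ico J1 (J1 + q)) (hq : 1 ≤ q) :
    ∑ m₂ ∈ (Finset.Ico J1 (J1+q)).filter (fun m₂ => m₂ ≠ m), (1:ℝ) / (max m m₂ - min m m₂ : ℕ) ≤ 2 * (1 + log q) := by
  rw [Finset.mem_Ico] at hm
  have hs : (Finset.Ico J1 (J1+q)).filter (fun m₂ => m₂ ≠ m) = Finset.Ico J1 m ∪ Finset.Ico (m+1) (J1+q) := by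
    ext k; simp only [Finset.mem_filter, Finset.mem_Ico, Finset.mem_union]; omega
  rw [hs, Finset.sum_union (by rw [Finset.disjoint_left]; intro k; simp only [Finset.mem_Ico]; omega)]
  have e1 : ∑ m₂ ∈ Finset.Ico J1 m, (1:ℝ) / (max m m₂ - min m m₂ : ℕ) ≤ 1 + log q := by
    refine le_trans ?_ (harmonic_Ioc q)
    calc _ = ∑ h ∈ Finset.Ioc 0 (m - J1), (1:ℝ)/h := by
          apply Finset.sum_nbij' (fun k => m - k) (fun h => m - h)
          · intro k hk; simp only [Finset.mem_Ico, Finset.mem_Ioc] at hk ⊢; omega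
          · intro k hk; simp only [Finset.mem_Ico, Finset.mem_Ioc] at hk ⊢; omega
          · intro k hk; simp only [Finset.mem_Ico] at hk ⊢; omega
          · intro k hk; simp only [Finset.mem_Ioc] at hk ⊢; omega
          · intro k hk; simp only [Finset.mem_Ico] at hk ⊢
            rw [max_eq_left (by omega), min_eq_right (by omega)]
      _ ≤ _ := Finset.sum_le_sum_of_subset_of_nonneg (by intro k; simp only [Finset.mem_Ioc]; omega) (fun _ _ _ => by positivity)
  have e2 : ∑ m₂ ∈ Finset.Ico (m+1) (J1+q), (1:ℝ) / (max m m₂ - min m m₂ : ℕ) ≤ 1 + log q := by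
    refine le_trans ?_ (harmonic_Ioc q)
    calc _ = ∑ h ∈ Finset.Ioc 0 (J1 + q - 1 - m), (1:ℝ)/h := by
          apply Finset.sum_nbij' (fun k => k - m) (fun h => h + m)
          · intro k hk; simp only [Finset.mem_Ico, Finset.mem_Ioc] at hk ⊢; omega
          · intro k hk; simp only [Finset.mem_Ico, Finset.mem_Ioc] at hk ⊢; omega
          · intro k hk; simp only [Finset.mem_Ico] at hk ⊢; omega
          · intro k hk; simp only [Finset.mem_Ioc] at hk ⊢; omega
          · intro k hk; simp only [Finset.mem_Ico] at hk ⊢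
            rw [max_eq_right (by omega), min_eq_left (by omega)]
      _ ≤ _ := Finset.sum_le_sum_of_subset_of_nonneg (by intro k; simp only [Finset.mem_Ioc]; omega) (fun _ _ _ => by positivity)
  linarith

/-- row bound in one block -/
noncomputable def rowB (c T : ℝ) (N M q : ℕ) : ℝ :=
  (N:ℝ) / M + ppC c * (1 + log N) * (q * √(6 * T * q / M) + N / T * (2 * (1 + log N)))

lemma corrI_row {c x : ℝ} (hc : 1 < c) (hc2 : c < 2) (hx : x ≠ 0) (N M q J1 m : ℕ) (hM : 1 ≤ M) (hMN : M ≤ N)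
    (hJ : M ≤ J1) (hJq : J1 + q ≤ 3 * M) (hq : 1 ≤ q) (hqM : q ≤ M) (hm : m ∈ Finset.Ico J1 (J1 + q)) :
    ∑ m₂ ∈ Finset.Ico J1 (J1+q), ‖corrI x c (N/4) N (N/M) m m₂‖ ≤ rowB c (|x| * (N:ℝ)^c) N M q := by
  set T := |x| * (N:ℝ) ^ c with hT
  have hMr : (1:ℝ) ≤ M := by exact_mod_cast hM
  have hMNr : (M:ℝ) ≤ N := by exact_mod_cast hMN
  have hNr : (1:ℝ) ≤ N := by linarith
  have hxp := abs_pos.2 hx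
  have hT0 : 0 < T := by positivity
  have hl0 : 0 ≤ log (N:ℝ) := Real.log_natCast_nonneg N
  have hpc := ppC_pos hc
  rw [← Finset.add_sum_erase _ _ hm, ← Finset.filter_ne']
  unfold rowB
  have hmm := hm
  rw [Finset.mem_Ico] at hmm
  apply add_le_add
  · exact (corrI_diag _ _ _ _ _ _ _).trans (nat_div_le_real N M)
  · calc _ ≤ ∑ m₂ ∈ (Finset.Ico J1 (J1+q)).filter (fun m₂ => m₂ ≠ m), ppC c * (1 + log N) * (√(6 * T * q / M) + N / T * (1 / ((max m m₂ - min m m₂ : ℕ) : ℝ))) := by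
          apply Finset.sum_le_sum
          intro m₂ hm₂
          rw [Finset.mem_filter, Finset.mem_Ico] at hm₂
          rcases lt_or_gt_of_ne hm₂.2 with h | h
          · rw [corrI_symm, max_eq_left h.le, min_eq_right h.le]
            exact corrI_off hc hc2 hx N M q m₂ m hM hMN (by omega) h (by omega) (by omega)
          · rw [max_eq_right h.le, min_eq_left h.le]
            exact corrI_off hc hc2 hx N M q m m₂ hM hMN (by omega) h (by omega) (by omega)
      _ = ppC c * (1 + log N) * (((Finset.Ico J1 (J1+q)).filter (fun m₂ => m₂ ≠ m)).card * √(6 * T * q / M) + N / T * ∑ m₂ ∈ (Finset.Ico J1 (J1+q)).filter (fun m₂ => m₂ ≠ m), (1:ℝ) / (max m m₂ - min m m₂ : ℕ)) := by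
          rw [← Finset.mul_sum, Finset.sum_add_distrib, Finset.sum_const, ← Finset.mul_sum, nsmul_eq_mul]
      _ ≤ _ := by
          have hcard : ((((Finset.Ico J1 (J1+q)).filter (fun m₂ => m₂ ≠ m)).card : ℕ) : ℝ) ≤ q := by
            have := Finset.card_filter_le (Finset.Ico J1 (J1+q)) (fun m₂ => m₂ ≠ m)
            rw [Nat.card_Ico, Nat.add_sub_cancel_left] at this
            exact_mod_cast this
          have h2 := sum_inv_dist J1 q m hm hq
          have h3 : log (q:ℝ) ≤ log N := log_mono_nat (hqM.trans hMN)
          gcongr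
          linarith
end

section
open Real MeasureTheory

lemma cauchy_prod {ι : Type*} (s : Finset ι) (f g : ι → ℂ) :
    ‖∑ i ∈ s, f i * g i‖ ^ 2 ≤ (∑ i ∈ s, ‖f i‖ ^ 2) * ∑ i ∈ s, ‖g i‖ ^ 2 := by
  calc _ ≤ (∑ i ∈ s, ‖f i‖ * ‖g i‖) ^ 2 := by
        gcongr
        refine (norm_sum_le _ _).trans (le_of_eq ?_)
        simp only [norm_mul]
    _ ≤ _ := Finset.sum_mul_sq_le_sq_mul_sq _ _ _

/-- the large-sieve like expansion with symmetric kernel -/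
lemma quad_expand {ι κ : Type*} (s : Finset ι) (t : Finset κ) (α : ι → ℂ) (G : ι → κ → ℂ) {B : ℝ}
    (hB : ∀ i ∈ s, ∑ j ∈ s, ‖∑ n ∈ t, G i n * (starRingEnd ℂ) (G j n)‖ ≤ B) :
    ∑ n ∈ t, ‖∑ i ∈ s, α i * G i n‖ ^ 2 ≤ B * ∑ i ∈ s, ‖α i‖ ^ 2 := by
  set I : ι → ι → ℂ := fun i j => ∑ n ∈ t, G i n * (starRingEnd ℂ) (G j n) with hI
  have hsym : ∀ i j, ‖I i j‖ = ‖I j i‖ := by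
    intro i j
    simp only [hI]
    rw [← Complex.norm_conj, map_sum]
    congr 1
    apply Finset.sum_congr rfl
    intro n _
    rw [map_mul, Complex.conj_conj, mul_comm]
  have e4 : ((∑ n ∈ t, ‖∑ i ∈ s, α i * G i n‖ ^ 2 : ℝ) : ℂ) = ∑ i ∈ s, ∑ j ∈ s, α i * (starRingEnd ℂ) (α j) * I i j := by
    push_cast
    have : ∀ n ∈ t, (‖∑ i ∈ s, α i * G i n‖ : ℂ) ^ 2 = ∑ i ∈ s, ∑ j ∈ s, α i * (starRingEnd ℂ) (α j) * (G i n * (starRingEnd ℂ) (G j n)) := by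
      intro n _
      rw [← Complex.mul_conj', map_sum, Finset.sum_mul_sum]
      apply Finset.sum_congr rfl; intro i _
      apply Finset.sum_congr rfl; intro j _
      rw [map_mul]; ring
    rw [Finset.sum_congr rfl this, Finset.sum_comm]
    apply Finset.sum_congr rfl; intro i _
    rw [Finset.sum_comm]
    apply Finset.sum_congr rfl; intro j _
    rw [Finset.mul_sum]
  have e5 : ∑ n ∈ t, ‖∑ i ∈ s, α i * G i n‖ ^ 2 = ‖((∑ n ∈ t, ‖∑ i ∈ s, α i * G i n‖ ^ 2 : ℝ) : ℂ)‖ := by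
    rw [Complex.norm_real, Real.norm_eq_abs, abs_of_nonneg]
    exact Finset.sum_nonneg (fun _ _ => by positivity)
  rw [e5, e4]
  calc _ ≤ ∑ i ∈ s, ∑ j ∈ s, ‖α i * (starRingEnd ℂ) (α j) * I i j‖ :=
        (norm_sum_le _ _).trans (Finset.sum_le_sum fun k _ => norm_sum_le _ _)
    _ ≤ ∑ i ∈ s, ∑ j ∈ s, (‖α i‖ ^ 2 * ‖I i j‖ / 2 + ‖α j‖ ^ 2 * ‖I j i‖ / 2) := by
        apply Finset.sum_le_sum; intro i _
        apply Finset.sum_le_sum; intro j _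
        rw [norm_mul, norm_mul, Complex.norm_conj, ← hsym i j]
        nlinarith [sq_nonneg (‖α i‖ - ‖α j‖), norm_nonneg (I i j)]
    _ = ∑ i ∈ s, ‖α i‖ ^ 2 * ∑ j ∈ s, ‖I i j‖ := by
        simp_rw [Finset.sum_add_distrib]
        have : ∑ i ∈ s, ∑ j ∈ s, ‖α j‖ ^ 2 * ‖I j i‖ / 2 = ∑ i ∈ s, ∑ j ∈ s, ‖α i‖ ^ 2 * ‖I i j‖ / 2 := Finset.sum_comm
        rw [this, ← Finset.sum_add_distrib]
        apply Finset.sum_congr rfl; intro i _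
        rw [← Finset.sum_add_distrib, Finset.mul_sum]
        apply Finset.sum_congr rfl; intro j _
        ring
    _ ≤ ∑ i ∈ s, ‖α i‖ ^ 2 * B := by
        apply Finset.sum_le_sum; intro i hi
        exact mul_le_mul_of_nonneg_left (hB i hi) (by positivity)
    _ = _ := by rw [← Finset.sum_mul, mul_comm]

/-- one row of a bilinear sum -/
noncomputable def brow (α β : ℕ → ℂ) (E : ℕ → ℂ) (A N m : ℕ) : ℂ :=
  ∑ n ∈ Finset.Ioc 0 N, if A < m * n ∧ m * n ≤ N then α m * β n * E (m * n) else 0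

lemma typeII_block {c x : ℝ} (hc : 1 < c) (hc2 : c < 2) (hx : x ≠ 0) (N M q J1 : ℕ) (hM : 1 ≤ M) (hMN : M ≤ N)
    (hJ : M ≤ J1) (hJq : J1 + q ≤ 3 * M) (hq : 1 ≤ q) (hqM : q ≤ M) (α β : ℕ → ℂ) :
    ‖∑ m ∈ Finset.Ico J1 (J1 + q), brow α β (EE x c) (N/4) N m‖ ^ 2 ≤
      (∑ n ∈ Finset.Ioc 0 (N/M), ‖β n‖ ^ 2) * (rowB c (|x| * (N:ℝ)^c) N M q * ∑ m ∈ Finset.Ico J1 (J1 + q), ‖α m‖ ^ 2) := by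
  have e : ∑ m ∈ Finset.Ico J1 (J1 + q), brow α β (EE x c) (N/4) N m
     = ∑ n ∈ Finset.Ioc 0 (N/M), β n * ∑ m ∈ Finset.Ico J1 (J1 + q), α m * (if N/4 < m * n ∧ m * n ≤ N then EE x c (m * n) else 0) := by
    simp_rw [Finset.mul_sum]
    rw [Finset.sum_comm]
    apply Finset.sum_congr rfl
    intro m hm
    rw [Finset.mem_Ico] at hm
    unfold brow
    symm
    rw [← Finset.sum_subset (s₁ := Finset.Ioc 0 (N/M)) (s₂ := Finset.Ioc 0 N)]
    · apply Finset.sum_congr rfl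
      intro n _
      split_ifs
      · ring
      · simp
    · intro n hn
      rw [Finset.mem_Ioc] at hn ⊢
      exact ⟨hn.1, hn.2.trans (Nat.div_le_self _ _)⟩
    · intro n hn hn2
      rw [if_neg]
      rintro ⟨_, h2⟩
      apply hn2
      rw [Finset.mem_Ioc] at hn ⊢
      refine ⟨hn.1, ?_⟩
      rw [Nat.le_div_iff_mul_le (by omega), mul_comm]
      exact (Nat.mul_le_mul_right n (by omega : M ≤ m)).trans h2
  rw [e]
  refine (cauchy_prod _ _ _).trans ?_
  apply mul_le_mul_of_nonneg_left _ (Finset.sum_nonneg fun _ _ => by positivity)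
  apply quad_expand
  intro m hm
  exact corrI_row hc hc2 hx N M q J1 m hM hMN hJ hJq hq hqM hm

lemma sum_Ico_blocks {R : Type*} [AddCommMonoid R] (f : ℕ → R) (M q k : ℕ) :
    ∑ m ∈ Finset.Ico M (M + k * q), f m = ∑ i ∈ Finset.range k, ∑ m ∈ Finset.Ico (M + i * q) (M + i * q + q), f m := by
  induction k with
  | zero => simp
  | succ k ih =>
    rw [Finset.sum_range_succ, ← ih, Finset.sum_Ico_consecutive _ (by omega) (by omega)]
    congr 2; ring

lemma rowB_nonneg {c T : ℝ} (hc : 1 < c) (hT : 0 < T) (N M q : ℕ) : 0 ≤ rowB c T N M q := by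
  have hl0 : 0 ≤ log (N:ℝ) := Real.log_natCast_nonneg N
  have hpc := ppC_pos hc
  unfold rowB
  positivity

lemma typeII_dyadic {c x : ℝ} (hc : 1 < c) (hc2 : c < 2) (hx : x ≠ 0) (N M q : ℕ) (hM : 1 ≤ M) (hMN : M ≤ N)
    (hq : 1 ≤ q) (hqM : q ≤ M) (α β : ℕ → ℂ) :
    ‖∑ m ∈ Finset.Ico M (2 * M), brow α β (EE x c) (N/4) N m‖ ^ 2 ≤
      (2 * M / q) * (∑ n ∈ Finset.Ioc 0 (N/M), ‖β n‖ ^ 2) * (rowB c (|x| * (N:ℝ)^c) N M q * ∑ m ∈ Finset.Ico M (2 * M), ‖α m‖ ^ 2) := by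
  have hxp := abs_pos.2 hx
  have hMr : (1:ℝ) ≤ M := by exact_mod_cast hM
  have hMNr : (M:ℝ) ≤ N := by exact_mod_cast hMN
  have hNr : (1:ℝ) ≤ N := by linarith
  have hT0 : 0 < |x| * (N:ℝ)^c := by positivity
  set α' : ℕ → ℂ := fun m => if m < 2 * M then α m else 0 with hα'
  set k := M / q + 1 with hk
  have hkq1 : M ≤ k * q := by
    have := Nat.lt_mul_div_succ M (by omega : 0 < q)
    rw [hk, mul_comm]; exact this.le
  have hkq2 : k * q ≤ M + q := by
    rw [hk, add_mul, one_mul]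
    have := Nat.div_mul_le_self M q
    omega
  have ext : ∀ {R : Type} [AddCommMonoid R] (f g : ℕ → R), (∀ m, m < 2 * M → f m = g m) → (∀ m, 2 * M ≤ m → g m = 0) →
      ∑ m ∈ Finset.Ico M (2 * M), f m = ∑ m ∈ Finset.Ico M (M + k * q), g m := by
    intro R _ f g h1 h2
    rw [← Finset.sum_Ico_consecutive g (by omega : M ≤ 2 * M) (by omega)]
    rw [Finset.sum_eq_zero (s := Finset.Ico (2 * M) (M + k * q)) (fun m hm => h2 m (Finset.mem_Ico.1 hm).1), add_zero]
    exact Finset.sum_congr rfl (fun m hm => h1 m (Finset.mem_Ico.1 hm).2)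
  have e1 : ∑ m ∈ Finset.Ico M (2 * M), brow α β (EE x c) (N/4) N m = ∑ m ∈ Finset.Ico M (M + k * q), brow α' β (EE x c) (N/4) N m := by
    apply ext
    · intro m hm; unfold brow; simp only [hα', if_pos hm]
    · intro m hm; unfold brow; simp [hα', if_neg (by omega : ¬ m < 2 * M)]
  have e2 : ∑ m ∈ Finset.Ico M (2 * M), ‖α m‖ ^ 2 = ∑ m ∈ Finset.Ico M (M + k * q), ‖α' m‖ ^ 2 := by
    apply ext
    · intro m hm; simp only [hα', if_pos hm]
    · intro m hm; simp [hα', if_neg (by omega : ¬ m < 2 * M)]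
  rw [e1, e2, sum_Ico_blocks, sum_Ico_blocks]
  have hR := rowB_nonneg (N := N) (M := M) (q := q) hc hT0
  have hkr : (k:ℝ) ≤ 2 * M / q := by
    have hq0 : (0:ℝ) < q := by exact_mod_cast hq
    rw [le_div_iff₀ hq0]
    have : k * q ≤ 2 * M := by omega
    exact_mod_cast this
  calc _ ≤ (k:ℝ) * ∑ i ∈ Finset.range k, ‖∑ m ∈ Finset.Ico (M + i * q) (M + i * q + q), brow α' β (EE x c) (N/4) N m‖ ^ 2 := by
        have := cauchy_norm_sq (Finset.range k) (fun i => ∑ m ∈ Finset.Ico (M + i * q) (M + i * q + q), brow α' β (EE x c) (N/4) N m)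
        rwa [Finset.card_range] at this
    _ ≤ (k:ℝ) * ∑ i ∈ Finset.range k, (∑ n ∈ Finset.Ioc 0 (N/M), ‖β n‖ ^ 2) * (rowB c (|x| * (N:ℝ)^c) N M q * ∑ m ∈ Finset.Ico (M + i * q) (M + i * q + q), ‖α' m‖ ^ 2) := by
        gcongr with i hi
        rw [Finset.mem_range] at hi
        apply typeII_block hc hc2 hx N M q _ hM hMN (by omega) _ hq hqM
        have : (i+1) * q ≤ k * q := Nat.mul_le_mul_right _ hi
        have e : (i+1)*q = i * q + q := by ring
        omega
    _ = (k:ℝ) * ((∑ n ∈ Finset.Ioc 0 (N/M), ‖β n‖ ^ 2) * (rowB c (|x| * (N:ℝ)^c) N M q * ∑ i ∈ Finset.range k, ∑ m ∈ Finset.Ico (M + i * q) (M + i * q + q), ‖α' m‖ ^ 2)) := by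
        rw [← Finset.mul_sum, ← Finset.mul_sum]
    _ ≤ _ := by
        rw [mul_assoc]
        apply mul_le_mul_of_nonneg_right hkr
        have : 0 ≤ ∑ i ∈ Finset.range k, ∑ m ∈ Finset.Ico (M + i * q) (M + i * q + q), ‖α' m‖ ^ 2 := Finset.sum_nonneg fun _ _ => Finset.sum_nonneg fun _ _ => by positivity
        have : 0 ≤ ∑ n ∈ Finset.Ioc 0 (N/M), ‖β n‖ ^ 2 := Finset.sum_nonneg fun _ _ => by positivity
        positivity
end

section
open Real MeasureTheory

set_option maxHeartbeats 1000000 in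
lemma typeII_bound {c x : ℝ} (hc : 1 < c) (hc2 : c < 2) (hx : x ≠ 0) (N M W : ℕ) (hW : 2 ≤ W) (hWM : W ≤ M)
    (hMN : M * M ≤ N) (hW3 : W ^ 4 ≤ N) (hT1 : (W:ℝ) ≤ |x| * (N:ℝ) ^ c) (hT2 : |x| * (N:ℝ)^c * W^3 ≤ N * √N)
    (α β : ℕ → ℂ) (hα : ∑ m ∈ Finset.Ico M (2 * M), ‖α m‖ ^ 2 ≤ 2 * M * (1 + log N)^3)
    (hβ : ∑ n ∈ Finset.Ioc 0 (N/M), ‖β n‖ ^ 2 ≤ N / M * (1 + log N)^3) :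
    ‖∑ m ∈ Finset.Ico M (2 * M), brow α β (EE x c) (N/4) N m‖ ≤ ppC c * (1 + log N)^4 * N / √W := by
  set T := |x| * (N:ℝ) ^ c with hT
  set l := 1 + log (N:ℝ) with hl
  have hl1 : 1 ≤ l := by have := Real.log_natCast_nonneg N; linarith
  have hpc := ppC_pos hc
  have hWr : (2:ℝ) ≤ W := by exact_mod_cast hW
  have hMr : (W:ℝ) ≤ M := by exact_mod_cast hWM
  have hT0 : 0 < T := by linarith
  have hMNr : (M:ℝ) * M ≤ N := by exact_mod_cast hMN
  have hN0 : (0:ℝ) < N := by nlinarith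
  have hMle : M ≤ N := by nlinarith
  have hMs : (M:ℝ) ≤ √N := Real.le_sqrt_of_sq_le (by nlinarith)
  have hW3r : (W:ℝ)^4 ≤ N := by exact_mod_cast hW3
  set q := max W ⌈(W:ℝ) * M / T⌉₊ with hq
  have hqW : W ≤ q := le_max_left _ _
  have hqM : q ≤ M := by
    apply max_le hWM
    apply Nat.ceil_le.2
    rw [div_le_iff₀ hT0]
    nlinarith
  have hqWr : (W:ℝ) ≤ q := by exact_mod_cast hqW
  have hq0 : (0:ℝ) < q := by linarith
  have hq2 : (W:ℝ) * M / T ≤ q := (Nat.le_ceil _).trans (Nat.cast_le.2 (le_max_right _ _))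
  have hq3 : (q:ℝ) ≤ 2 * W + W * M / T := by
    have h0 : 0 ≤ (W:ℝ) * M / T := by positivity
    have := (Nat.ceil_lt_add_one h0).le
    rw [hq, Nat.cast_max]
    apply max_le <;> linarith
  have key := typeII_dyadic hc hc2 hx N M q (by omega) hMle (by omega) hqM α β
  rw [← hT] at key
  have hR := rowB_nonneg hc hT0 N M q
  have hM0 : (0:ℝ) < M := by linarith
  have key2 : ‖∑ m ∈ Finset.Ico M (2 * M), brow α β (EE x c) (N/4) N m‖ ^ 2 ≤ 4 * l^6 * N * (M * rowB c T N M q / q) := by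
    refine key.trans ?_
    calc _ ≤ (2 * M / q) * (N / M * l^3) * (rowB c T N M q * (2 * M * l^3)) := by
          apply mul_le_mul _ (mul_le_mul_of_nonneg_left hα hR) (mul_nonneg hR (Finset.sum_nonneg fun _ _ => by positivity)) (by positivity)
          exact mul_le_mul_of_nonneg_left hβ (by positivity)
      _ = _ := by field_simp; ring
  have t1 : (M:ℝ) * (N / M) / q ≤ N / W := by
    rw [mul_div_cancel₀ _ hM0.ne']
    exact div_le_div_of_nonneg_left hN0.le (by linarith) hqWr
  have t2 : (M:ℝ) * (q * √(6 * T * q / M)) / q ≤ 5 * N / W := by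
    have e : (M:ℝ) * (q * √(6 * T * q / M)) / q = √(6 * T * q * M) := by
      rw [show 6 * T * q * M = M^2 * (6 * T * q / M) by field_simp, Real.sqrt_mul (by positivity), Real.sqrt_sq hM0.le]
      field_simp
    rw [e]
    apply Real.sqrt_le_iff.2
    refine ⟨by positivity, ?_⟩
    have h1 : T * q * M ≤ 2 * W * T * M + W * M * M := by
      calc T * q * M ≤ T * (2 * W + W * M / T) * M := by gcongr
        _ = _ := by field_simp
    have hss : √(N:ℝ) * √N = N := Real.mul_self_sqrt hN0.le
    have h2 : T * M * W^3 ≤ N * N := by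
      calc T * M * W^3 = T * W^3 * M := by ring
        _ ≤ (N * √N) * √N := by gcongr
        _ = _ := by rw [mul_assoc, hss]
    have h3 : (W:ℝ) * M * M * W^2 ≤ N * N := by
      calc (W:ℝ) * M * M * (W:ℝ)^2 = (W:ℝ)^3 * (M * M) := by ring
        _ ≤ (W:ℝ)^4 * (M*M) := mul_le_mul_of_nonneg_right (pow_le_pow_right₀ (by linarith) (by norm_num)) (by positivity)
        _ ≤ _ := by gcongr
    rw [div_pow, le_div_iff₀ (by positivity)]
    calc 6 * T * q * M * W^2 = 6 * (T * q * M) * W^2 := by ring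
      _ ≤ 6 * (2 * W * T * M + W * M * M) * W^2 := by gcongr
      _ = 12 * (T * M * W^3) + 6 * (W * M * M * W^2) := by ring
      _ ≤ (5 * N)^2 := by nlinarith
  have t3 : (M:ℝ) * (N / T * (2 * l)) / q ≤ 2 * l * (N / W) := by
    have : (M:ℝ) / (T * q) ≤ 1 / W := by
      rw [div_le_div_iff₀ (by positivity) (by positivity)]
      rw [div_le_iff₀ hT0] at hq2
      nlinarith
    calc (M:ℝ) * (N / T * (2 * l)) / q = 2 * l * N * (M / (T * q)) := by field_simp
      _ ≤ 2 * l * N * (1 / W) := by gcongr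
      _ = _ := by ring
  have t4 : (M:ℝ) * rowB c T N M q / q ≤ 8 * ppC c * l^2 * (N / W) := by
    have e : (M:ℝ) * rowB c T N M q / q = M * (N / M) / q + ppC c * l * ((M:ℝ) * (q * √(6 * T * q / M)) / q + (M:ℝ) * (N / T * (2 * l)) / q) := by
      unfold rowB; rw [← hl]; ring
    rw [e]
    calc _ ≤ N / W + ppC c * l * (5 * N / W + 2 * l * (N / W)) := by
          exact add_le_add t1 (mul_le_mul_of_nonneg_left (add_le_add t2 t3) (by positivity))
      _ = (1 + 5 * (ppC c * l) + 2 * (ppC c * l^2)) * (N / W) := by ring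
      _ ≤ _ := by
          apply mul_le_mul_of_nonneg_right _ (by positivity)
          have h5 : l ≤ l^2 := le_self_pow₀ hl1 (by norm_num)
          have h6 : ppC c * l ≤ ppC c * l^2 := by gcongr
          have h7 : 1 ≤ ppC c * l^2 := one_le_mul_of_one_le_of_one_le (by linarith) (one_le_pow₀ hl1)
          linarith
  apply le_of_sq_le_sq _ (by positivity)
  refine key2.trans ?_
  rw [div_pow, Real.sq_sqrt (by linarith)]
  calc _ ≤ 4 * l^6 * N * (8 * ppC c * l^2 * (N / W)) := by gcongr
    _ = 32 * ppC c * (l^8 * N^2 / W) := by ring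
    _ ≤ (ppC c)^2 * (l^8 * N^2 / W) := by gcongr; nlinarith
    _ = _ := by ring

lemma bil_eq_brow (f g : ℕ → ℂ) (E : ℕ → ℂ) (A N : ℕ) : bil f g E A N = ∑ m ∈ Finset.Ioc 0 N, brow f g E A N m := rfl

lemma bil_comm (f g : ℕ → ℂ) (E : ℕ → ℂ) (A N : ℕ) : bil f g E A N = bil g f E A N := by
  unfold bil
  rw [Finset.sum_comm]
  refine Finset.sum_congr rfl fun n _ => Finset.sum_congr rfl fun m _ => ?_
  rw [mul_comm m n, mul_comm (f m) (g n)]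

lemma sum_dyadic {R : Type*} [AddCommMonoid R] (f : ℕ → R) (W I : ℕ) :
    ∑ i ∈ Finset.range I, ∑ m ∈ Finset.Ico (W * 2^i) (2 * (W * 2^i)), f m = ∑ m ∈ Finset.Ico W (W * 2^I), f m := by
  induction I with
  | zero => simp
  | succ I ih =>
    rw [Finset.sum_range_succ, ih, show 2 * (W * 2^I) = W * 2^(I+1) by ring,
      Finset.sum_Ico_consecutive _ (Nat.le_mul_of_pos_right _ (by positivity)) (Nat.mul_le_mul_left _ (Nat.pow_le_pow_right (by norm_num) (by omega)))]

lemma typeII_half {c x : ℝ} (hc : 1 < c) (hc2 : c < 2) (hx : x ≠ 0) (N W : ℕ) (hW : 2 ≤ W)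
    (hW3 : W ^ 4 ≤ N) (hT1 : (W:ℝ) ≤ |x| * (N:ℝ) ^ c) (hT2 : |x| * (N:ℝ)^c * W^3 ≤ N * √N)
    (α β : ℕ → ℂ) (hα0 : ∀ m, m < W → α m = 0) (hα1 : ∀ m, N < m * m → α m = 0)
    (hα : ∀ M, 1 ≤ M → 2 * M ≤ N → ∑ m ∈ Finset.Ico M (2 * M), ‖α m‖ ^ 2 ≤ 2 * M * (1 + log N)^3)
    (hβ : ∀ M, 1 ≤ M → M ≤ N → ∑ n ∈ Finset.Ioc 0 (N/M), ‖β n‖ ^ 2 ≤ N / M * (1 + log N)^3) :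
    ‖bil α β (EE x c) (N/4) N‖ ≤ 3 * ppC c * (1 + log N)^5 * N / √W := by
  set l := 1 + log (N:ℝ) with hl
  have hl1 : 1 ≤ l := by have := Real.log_natCast_nonneg N; linarith
  have hpc := ppC_pos hc
  have hN1 : 1 ≤ N := by
    rcases Nat.eq_zero_or_pos N with h | h
    · subst h; simp at hW3; omega
    · exact h
  set I := Nat.log 2 N + 1 with hI
  have hI2 : N < 2 ^ I := Nat.lt_pow_succ_log_self (by norm_num) N
  have hIl : (I:ℝ) ≤ 3 * l := by
    have h1 : 2 ^ (Nat.log 2 N) ≤ N := Nat.pow_log_le_self 2 (by omega)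
    have h2 : ((2:ℝ) ^ (Nat.log 2 N)) ≤ N := by exact_mod_cast h1
    have h3 := Real.log_le_log (by positivity) h2
    rw [Real.log_pow] at h3
    have h4 := Real.log_two_gt_d9
    have h5 : (0:ℝ) ≤ Nat.log 2 N := by positivity
    have : (I:ℝ) = Nat.log 2 N + 1 := by rw [hI]; push_cast; ring
    rw [this]
    nlinarith
  have e : bil α β (EE x c) (N/4) N = ∑ i ∈ Finset.range I, ∑ m ∈ Finset.Ico (W * 2^i) (2 * (W * 2^i)), brow α β (EE x c) (N/4) N m := by
    rw [sum_dyadic, bil_eq_brow]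
    have hz : ∀ m, α m = 0 → brow α β (EE x c) (N/4) N m = 0 := by
      intro m hm; unfold brow; simp [hm]
    rw [← Finset.sum_subset (s₁ := Finset.Ico W (N+1)) (s₂ := Finset.Ioc 0 N), ← Finset.sum_subset (s₁ := Finset.Ico W (N+1)) (s₂ := Finset.Ico W (W * 2^I))]
    · intro m hm
      rw [Finset.mem_Ico] at hm ⊢
      refine ⟨hm.1, ?_⟩
      nlinarith
    · intro m hm hm2
      rw [Finset.mem_Ico] at hm hm2
      apply hz; apply hα1
      have : N + 1 ≤ m := by by_contra h; exact hm2 ⟨hm.1, by omega⟩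
      nlinarith
    · intro m hm
      rw [Finset.mem_Ico] at hm; rw [Finset.mem_Ioc]; omega
    · intro m hm hm2
      rw [Finset.mem_Ioc] at hm; rw [Finset.mem_Ico] at hm2
      apply hz; apply hα0; by_contra h; exact hm2 (by omega)
  rw [e]
  have hb : ∀ i ∈ Finset.range I, ‖∑ m ∈ Finset.Ico (W * 2^i) (2 * (W * 2^i)), brow α β (EE x c) (N/4) N m‖ ≤ ppC c * l^4 * N / √W := by
    intro i _
    set M := W * 2^i with hM
    have hWM : W ≤ M := Nat.le_mul_of_pos_right _ (by positivity)
    by_cases h : M * M ≤ N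
    · apply typeII_bound hc hc2 hx N M W hW hWM h hW3 hT1 hT2 α β (hα M (by omega) (by nlinarith)) (hβ M (by omega) (by nlinarith))
    · rw [Finset.sum_eq_zero]
      · rw [norm_zero]; positivity
      · intro m hm
        rw [Finset.mem_Ico] at hm
        have : α m = 0 := hα1 m (by nlinarith)
        unfold brow; simp [this]
  calc _ ≤ ∑ i ∈ Finset.range I, ppC c * l^4 * N / √W := (norm_sum_le _ _).trans (Finset.sum_le_sum hb)
    _ = I * (ppC c * l^4 * N / √W) := by rw [Finset.sum_const, Finset.card_range, nsmul_eq_mul]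
    _ ≤ (3 * l) * (ppC c * l^4 * N / √W) := by gcongr
    _ = _ := by ring

lemma sum_log_sq (N K : ℕ) (_hK : K ≤ N) (s : Finset ℕ) (hs : s.card ≤ K) (hs2 : ∀ n ∈ s, n ≤ N) (f : ℕ → ℂ) (hf : ∀ n, ‖f n‖ ≤ log n) :
    ∑ n ∈ s, ‖f n‖^2 ≤ K * (1 + log N)^3 := by
  have hl1 : 0 ≤ log (N:ℝ) := Real.log_natCast_nonneg N
  calc _ ≤ ∑ n ∈ s, (1 + log (N:ℝ))^3 := by
        apply Finset.sum_le_sum; intro n hn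
        have h1 : ‖f n‖ ≤ 1 + log N := by
          have := hf n
          have h2 := log_mono_nat (hs2 n hn)
          linarith
        calc ‖f n‖^2 ≤ (1 + log (N:ℝ))^2 := by gcongr
          _ ≤ _ := pow_le_pow_right₀ (by linarith) (by norm_num)
    _ = s.card * (1 + log (N:ℝ))^3 := by rw [Finset.sum_const, nsmul_eq_mul]
    _ ≤ _ := by gcongr

lemma sum_dd_sq_sub (N K : ℕ) (hK : K ≤ N) (s : Finset ℕ) (hs : s ⊆ Finset.Ioc 0 K) (f : ℕ → ℂ) (hf : ∀ n, ‖f n‖ ≤ dd n) :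
    ∑ n ∈ s, ‖f n‖^2 ≤ K * (1 + log N)^3 := by
  have hl1 : 0 ≤ log (K:ℝ) := Real.log_natCast_nonneg K
  have h2 := log_mono_nat hK
  calc _ ≤ ∑ n ∈ s, dd n^2 := Finset.sum_le_sum fun n _ => by gcongr; exact hf n
    _ ≤ ∑ n ∈ Finset.Ioc 0 K, dd n^2 := Finset.sum_le_sum_of_subset_of_nonneg hs fun _ _ _ => by positivity
    _ ≤ _ := sum_dd_sq_le K
    _ ≤ _ := by gcongr

lemma bil_split (f g : ℕ → ℂ) (E : ℕ → ℂ) (A N : ℕ) :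
    bil f g E A N = bil (fun m => if m * m ≤ N then f m else 0) g E A N
      + bil (fun m => if m * m ≤ N then g m else 0) (fun m => if m * m ≤ N then 0 else f m) E A N := by
  rw [bil_comm (fun m => if m * m ≤ N then g m else 0)]
  unfold bil
  rw [← Finset.sum_add_distrib]
  refine Finset.sum_congr rfl fun m _ => ?_
  rw [← Finset.sum_add_distrib]
  refine Finset.sum_congr rfl fun n _ => ?_
  by_cases h : A < m * n ∧ m * n ≤ N
  · simp only [if_pos h]
    by_cases h1 : m * m ≤ N
    · simp [h1]
    · have h2 : n * n ≤ N := by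
        by_contra h3
        push Not at h1 h3
        rcases le_total m n with h4 | h4 <;> nlinarith
      simp [h1, h2]
  · simp only [if_neg h, add_zero]

lemma lambda_sup {c x : ℝ} (hc : 1 < c) (hc2 : c < 2) (hx : x ≠ 0) (N W : ℕ) (hW : 2 ≤ W)
    (hW3 : W ^ 4 ≤ N) (hT1 : (W:ℝ) ≤ |x| * (N:ℝ) ^ c) (hT2 : |x| * (N:ℝ)^c * W^3 ≤ N * √N) :
    ‖∑ n ∈ Finset.Ioc (N/4) N, ((ArithmeticFunction.vonMangoldt n : ℝ) : ℂ) * EE x c n‖ ≤ 10 * ppC c * (1 + log N)^5 * N / √W := by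
  have hWN4 : W ≤ N / 4 := by
    apply (Nat.le_div_iff_mul_le (by norm_num)).2
    nlinarith [Nat.pow_le_pow_left hW 3, pow_succ W 3]
  have hWW : W * W ≤ N := by nlinarith [Nat.pow_le_pow_left hW 2]
  rw [vaughan_sum W (N/4) N hWN4]
  set T := |x| * (N:ℝ) ^ c with hT
  set l := 1 + log (N:ℝ) with hl
  have hl0 : 0 ≤ log (N:ℝ) := Real.log_natCast_nonneg N
  have hl1 : 1 ≤ l := by linarith
  have hpc := ppC_pos hc
  have hWr : (2:ℝ) ≤ W := by exact_mod_cast hW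
  have hT0 : 0 < T := by linarith
  have hW4r : (W:ℝ)^4 ≤ N := by exact_mod_cast hW3
  have hN0 : (0:ℝ) < N := lt_of_lt_of_le (by positivity) hW4r
  have hN1 : 1 ≤ N := by exact_mod_cast hN0
  have hsW : 0 < √(W:ℝ) := Real.sqrt_pos.2 (by linarith)
  have hWs : √(W:ℝ) * √W = W := Real.mul_self_sqrt (by linarith)
  have hs1 : 1 ≤ √(W:ℝ) := Real.one_le_sqrt.2 (by linarith)
  have a1 : (N:ℝ) / T ≤ N / √W := by
    apply div_le_div_of_nonneg_left hN0.le hsW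
    nlinarith
  have a2 : (W:ℝ)^2 * √T ≤ N / √W := by
    rw [le_div_iff₀ hsW]
    have : ((W:ℝ)^2 * √T * √W)^2 ≤ (N:ℝ)^2 := by
      calc ((W:ℝ)^2 * √T * √W)^2 = W^4 * (√T * √T) * (√W * √W) := by ring
        _ = T * W^3 * W^2 := by rw [hWs, Real.mul_self_sqrt hT0.le]; ring
        _ ≤ N * √N * √N := by
            gcongr
            apply Real.le_sqrt_of_sq_le
            rw [← pow_mul]; exact hW4r
        _ = N^2 := by rw [mul_assoc, Real.mul_self_sqrt hN0.le, sq]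
    exact le_of_sq_le_sq this hN0.le
  have b1 : ‖bil (fun m => (trunc muR W m : ℝ)) (fun n => (log n : ℝ)) (EE x c) (N/4) N‖ ≤ 2 * ppC c * l^3 * N / √W := by
    refine (typeI hc hc2 hx N W hN1 (by nlinarith) (fun m => ((trunc muR W m : ℝ):ℂ)) (fun n => log n) (F := 1) (B := l) ?_ (by norm_num) ?_ ?_ ?_ (by linarith) ?_).trans ?_
    · intro m _
      rw [Complex.norm_real, Real.norm_eq_abs, trunc_apply]
      split_ifs
      · exact abs_muR_le m
      · simp
    · intro m hm; rw [trunc_apply, if_neg (by omega)]; simp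
    · intro n hn; exact Real.log_natCast_nonneg n
    · intro n hn; exact log_mono_nat (by omega)
    · intro n hn hnN; have := log_mono_nat hnN; linarith
    · rw [← hT, ← hl]
      calc _ ≤ 1 * l * (ppC c * l) * (l * (N / √W) + l * (N / √W)) := by
            apply mul_le_mul_of_nonneg_left _ (by positivity)
            apply add_le_add _ (mul_le_mul_of_nonneg_left a1 (by linarith))
            calc (W:ℝ) * √T ≤ W^2 * √T := by apply mul_le_mul_of_nonneg_right _ (Real.sqrt_nonneg _); nlinarith
              _ ≤ 1 * (N / √W) := by rw [one_mul]; exact a2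
              _ ≤ _ := by apply mul_le_mul_of_nonneg_right hl1 (by positivity)
        _ = _ := by ring
  have b2 : ‖bil (fun m => ((trunc muR W * trunc ArithmeticFunction.vonMangoldt W) m : ℝ)) (fun n => (zetaR n : ℝ)) (EE x c) (N/4) N‖ ≤ 2 * ppC c * l^3 * N / √W := by
    have hz : ∀ n, 1 ≤ n → zetaR n = 1 := by
      intro n hn
      unfold zetaR
      simp [ArithmeticFunction.natCoe_apply, ArithmeticFunction.zeta_apply, show n ≠ 0 by omega]
    refine (typeI hc hc2 hx N (W*W) hN1 hWW (fun m => (((trunc muR W * trunc ArithmeticFunction.vonMangoldt W) m : ℝ):ℂ)) (fun n => zetaR n) (F := l) (B := 1) ?_ (by linarith) ?_ ?_ ?_ (by norm_num) ?_).trans ?_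
    · intro m hm
      rw [Complex.norm_real, Real.norm_eq_abs]
      have := vau_b_bound W m
      have h2 := log_mono_nat hm
      linarith
    · intro m hm; rw [vau_b_zero W m hm]; simp
    · intro n hn; rw [hz n hn]; norm_num
    · intro n hn; rw [hz n hn, hz (n+1) (by omega)]
    · intro n hn hnN; rw [hz n hn]
    · rw [← hT, ← hl]
      calc _ ≤ l * 1 * (ppC c * l) * (l * (N / √W) + l * (N / √W)) := by
            apply mul_le_mul_of_nonneg_left _ (by positivity)
            apply add_le_add _ (mul_le_mul_of_nonneg_left a1 (by linarith))
            calc ((W*W:ℕ):ℝ) * √T = W^2 * √T := by push_cast; ring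
              _ ≤ 1 * (N / √W) := by rw [one_mul]; exact a2
              _ ≤ _ := by apply mul_le_mul_of_nonneg_right hl1 (by positivity)
        _ = _ := by ring
  set fa : ℕ → ℂ := fun m => ((((muR - trunc muR W) * zetaR) m : ℝ) : ℂ) with hfa
  set fb : ℕ → ℂ := fun n => (((ArithmeticFunction.vonMangoldt - trunc ArithmeticFunction.vonMangoldt W) n : ℝ):ℂ) with hfb
  have hfa1 : ∀ n, ‖fa n‖ ≤ dd n := by
    intro n; simp only [hfa]; rw [Complex.norm_real, Real.norm_eq_abs]; exact vau_a_bound W n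
  have hfb' : ∀ n, fb n = if n ≤ W then 0 else ((ArithmeticFunction.vonMangoldt n : ℝ) : ℂ) := by
    intro n; simp only [hfb]
    rw [sub_eq_add_neg, ArithmeticFunction.add_apply, ArithmeticFunction.neg_apply, trunc_apply]
    split_ifs <;> simp
  have hfb1 : ∀ n, ‖fb n‖ ≤ log n := by
    intro n; rw [hfb']
    split_ifs
    · rw [norm_zero]; exact Real.log_natCast_nonneg n
    · rw [Complex.norm_real, Real.norm_eq_abs, abs_of_nonneg ArithmeticFunction.vonMangoldt_nonneg]
      exact ArithmeticFunction.vonMangoldt_le_log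
  have b3 : ‖bil fa fb (EE x c) (N/4) N‖ ≤ 6 * ppC c * l^5 * N / √W := by
    rw [bil_split]
    have h1 := typeII_half hc hc2 hx N W hW hW3 hT1 hT2 (fun m => if m * m ≤ N then fa m else 0) fb ?_ ?_ ?_ ?_
    have h2 := typeII_half hc hc2 hx N W hW hW3 hT1 hT2 (fun m => if m * m ≤ N then fb m else 0) (fun m => if m * m ≤ N then 0 else fa m) ?_ ?_ ?_ ?_
    · refine (norm_add_le _ _).trans ((add_le_add h1 h2).trans (le_of_eq ?_))
      rw [← hl]; ring
    · intro m hm; simp only [hfb']; rw [if_pos hm.le]; simp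
    · intro m hm; rw [if_neg (by omega)]
    · intro M hM1 hM2
      have := sum_log_sq N (2 * M) hM2 (Finset.Ico M (2*M)) (by rw [Nat.card_Ico]; omega) (fun n hn => by rw [Finset.mem_Ico] at hn; omega)
        (fun m => if m * m ≤ N then fb m else 0) (fun n => by
          split_ifs
          · exact hfb1 n
          · rw [norm_zero]; exact Real.log_natCast_nonneg n)
      push_cast at this
      exact this
    · intro M hM1 hM2
      have := sum_dd_sq_sub N (N/M) (Nat.div_le_self _ _) (Finset.Ioc 0 (N/M)) (le_refl _)
        (fun m => if m * m ≤ N then 0 else fa m) (fun n => by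
          split_ifs
          · rw [norm_zero]; exact dd_nonneg n
          · exact hfa1 n)
      exact this.trans (mul_le_mul_of_nonneg_right (nat_div_le_real N M) (by positivity))
    · intro m hm; simp only [hfa]; rw [vau_a_zero W m hm.le]; simp
    · intro m hm; rw [if_neg (by omega)]
    · intro M hM1 hM2
      have := sum_dd_sq_sub N (2*M) hM2 (Finset.Ico M (2*M)) (fun n hn => by rw [Finset.mem_Ico] at hn; rw [Finset.mem_Ioc]; omega)
        (fun m => if m * m ≤ N then fa m else 0) (fun n => by
          split_ifs
          · exact hfa1 n
          · rw [norm_zero]; exact dd_nonneg n)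
      push_cast at this
      exact this
    · intro M hM1 hM2
      have := sum_log_sq N (N/M) (Nat.div_le_self _ _) (Finset.Ioc 0 (N/M)) (by simp) (fun n hn => by rw [Finset.mem_Ioc] at hn; exact hn.2.trans (Nat.div_le_self _ _))
        fb hfb1
      exact this.trans (mul_le_mul_of_nonneg_right (nat_div_le_real N M) (by positivity))
  have hfin : 2 * ppC c * l^3 * N / √W ≤ 2 * ppC c * l^5 * N / √W := by
    gcongr
    norm_num
  calc _ ≤ 2 * ppC c * l^3 * N / √W + 2 * ppC c * l^3 * N / √W + 6 * ppC c * l^5 * N / √W := by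
        refine (norm_add_le _ _).trans (add_le_add ((norm_sub_le _ _).trans (add_le_add b1 b2)) b3)
    _ ≤ 2 * ppC c * l^5 * N / √W + 2 * ppC c * l^5 * N / √W + 6 * ppC c * l^5 * N / √W := by linarith
    _ = _ := by ring
end

section
open Real MeasureTheory

lemma swap_cont {a b : ℝ} (hab : a ≤ b) {f : ℝ → ℝ → ℝ} (hf : Continuous (Function.uncurry f)) :
    ∫ x in a..b, ∫ y in a..b, f x y = ∫ y in a..b, ∫ x in a..b, f x y := by
  simp only [intervalIntegral.integral_of_le hab]
  apply MeasureTheory.integral_integral_swap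
  rw [Measure.prod_restrict]
  have : IntegrableOn (Function.uncurry f) (Set.Icc a b ×ˢ Set.Icc a b) (volume.prod volume) := by
    apply ContinuousOn.integrableOn_compact
    · exact isCompact_Icc.prod isCompact_Icc
    · exact hf.continuousOn
  exact this.mono_set (Set.prod_mono Set.Ioc_subset_Icc_self Set.Ioc_subset_Icc_self)

lemma cs_int {a b : ℝ} (hab : a ≤ b) {f g : ℝ → ℝ} (hf : Continuous f) (hg : Continuous g) :
    (∫ x in a..b, f x * g x) ^ 2 ≤ (∫ x in a..b, f x ^ 2) * ∫ x in a..b, g x ^ 2 := by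
  have h : ∀ t : ℝ, 0 ≤ (∫ x in a..b, g x ^ 2) * (t * t) + (2 * ∫ x in a..b, f x * g x) * t + ∫ x in a..b, f x ^ 2 := by
    intro t
    have h1 : 0 ≤ ∫ x in a..b, (f x + t * g x) ^ 2 := intervalIntegral.integral_nonneg hab (fun x _ => sq_nonneg _)
    have h2 : ∫ x in a..b, (f x + t * g x) ^ 2 = ∫ x in a..b, ((t*t) * g x ^ 2 + (2 * t) * (f x * g x)) + f x ^ 2 := by
      congr 1; ext x; ring
    rw [h2, intervalIntegral.integral_add, intervalIntegral.integral_add, intervalIntegral.integral_const_mul, intervalIntegral.integral_const_mul] at h1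
    · linarith
    all_goals exact Continuous.intervalIntegrable (by fun_prop) _ _
  have := discrim_le_zero h
  unfold discrim at this
  linarith

/-- abstract duality bound for the fourth moment on an interval -/
lemma fourth_moment {a b : ℝ} (hab : a ≤ b) (s : Finset ℕ) (w : ℕ → ℝ) (e : ℕ → ℝ → ℂ) (he : ∀ n, Continuous (e n))
    (S : ℝ → ℂ) (hS : ∀ x, S x = ∑ n ∈ s, (w n : ℂ) * e n x)
    (k : ℝ → ℝ) (hk : Continuous k) (hk0 : ∀ z, 0 ≤ k z) (hkeven : ∀ z, k (-z) = k z) {B K G : ℝ} (hB : 0 ≤ B)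
    (hker : ∀ x ∈ Set.Icc a b, ∀ y ∈ Set.Icc a b, ‖∑ n ∈ s, e n x * (starRingEnd ℂ) (e n y)‖ ≤ k (x - y) + B)
    (hK : ∀ x ∈ Set.Icc a b, ∫ y in a..b, k (x - y) ≤ K)
    (hK0 : 0 ≤ K) (hG : ∀ x ∈ Set.Icc a b, ‖S x‖ ≤ G) :
    ∫ x in a..b, ‖S x‖ ^ 4 ≤ (∑ n ∈ s, w n ^ 2) * (K * G ^ 2 + B * ∫ x in a..b, ‖S x‖ ^ 2) := by
  have hSc : Continuous S := by
    have : S = fun x => ∑ n ∈ s, (w n : ℂ) * e n x := funext hS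
    rw [this]; fun_prop
  set I := ∫ x in a..b, ‖S x‖ ^ 4 with hI
  set A := ∑ n ∈ s, w n ^ 2 with hA
  have hA0 : 0 ≤ A := Finset.sum_nonneg fun _ _ => sq_nonneg _
  have hI0 : 0 ≤ I := intervalIntegral.integral_nonneg hab (fun x _ => by positivity)
  have hJ0 : 0 ≤ ∫ x in a..b, ‖S x‖ ^ 2 := intervalIntegral.integral_nonneg hab (fun x _ => by positivity)
  set φ : ℝ → ℂ := fun x => (‖S x‖ : ℂ) ^ 2 * (starRingEnd ℂ) (S x) with hφ
  have hφc : Continuous φ := by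
    simp only [hφ]
    have := Complex.continuous_conj.comp hSc
    have h2 : Continuous fun x => (‖S x‖ : ℂ) := Complex.continuous_ofReal.comp hSc.norm
    exact (h2.pow 2).mul this
  have hφn : ∀ x, ‖φ x‖ = ‖S x‖ ^ 3 := by
    intro x; simp only [hφ]; rw [norm_mul, norm_pow, Complex.norm_real, norm_norm, Complex.norm_conj]; ring
  have ii : ∀ {f : ℝ → ℂ}, Continuous f → IntervalIntegrable f volume a b := fun h => h.intervalIntegrable _ _
  set D : ℕ → ℂ := fun n => ∫ x in a..b, φ x * e n x with hD
  have e1 : (I : ℂ) = ∑ n ∈ s, (w n : ℂ) * D n := by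
    rw [hI, ← intervalIntegral.integral_ofReal]
    have : ∀ x, ((‖S x‖ ^ 4 : ℝ) : ℂ) = ∑ n ∈ s, (w n : ℂ) * (φ x * e n x) := by
      intro x
      have h1 : ((‖S x‖ ^ 4 : ℝ) : ℂ) = φ x * S x := by
        simp only [hφ]
        rw [mul_assoc, Complex.conj_mul']
        push_cast
        ring
      rw [h1]
      conv_lhs => rw [hS x]
      rw [Finset.mul_sum]
      exact Finset.sum_congr rfl fun n _ => by ring
    simp_rw [this]
    rw [intervalIntegral.integral_finsetSum (fun n _ => ii (by have := he n; fun_prop))]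
    exact Finset.sum_congr rfl fun n _ => intervalIntegral.integral_const_mul _ _
  have e2 : I ^ 2 ≤ A * ∑ n ∈ s, ‖D n‖ ^ 2 := by
    have h := cauchy_prod s (fun n => (w n : ℂ)) D
    rw [← e1, Complex.norm_real, Real.norm_eq_abs, sq_abs] at h
    refine h.trans (le_of_eq ?_)
    congr 1
    exact Finset.sum_congr rfl fun n _ => by rw [Complex.norm_real, Real.norm_eq_abs, sq_abs]
  have e3 : ((∑ n ∈ s, ‖D n‖ ^ 2 : ℝ) : ℂ) = ∫ x in a..b, ∫ y in a..b, φ x * (starRingEnd ℂ) (φ y) * ∑ n ∈ s, e n x * (starRingEnd ℂ) (e n y) := by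
    push_cast
    have h1 : ∀ x, ∫ y in a..b, φ x * (starRingEnd ℂ) (φ y) * ∑ n ∈ s, e n x * (starRingEnd ℂ) (e n y) = ∑ n ∈ s, (starRingEnd ℂ) (D n) * (φ x * e n x) := by
      intro x
      have h2 : ∀ y, φ x * (starRingEnd ℂ) (φ y) * ∑ n ∈ s, e n x * (starRingEnd ℂ) (e n y) = ∑ n ∈ s, (φ x * e n x) * (starRingEnd ℂ) (φ y * e n y) := by
        intro y
        rw [Finset.mul_sum]
        exact Finset.sum_congr rfl fun n _ => by rw [map_mul (starRingEnd ℂ) (φ y) (e n y)]; ring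
      simp_rw [h2]
      rw [intervalIntegral.integral_finsetSum (fun n _ => ii (by
        have := he n
        have h3 : Continuous fun y => (starRingEnd ℂ) (φ y * e n y) := Complex.continuous_conj.comp (by fun_prop)
        fun_prop))]
      refine Finset.sum_congr rfl fun n _ => ?_
      rw [intervalIntegral.integral_const_mul, mul_comm]
      congr 1
      simp only [hD, intervalIntegral.integral_of_le hab]
      exact integral_conj
    simp_rw [h1]
    rw [intervalIntegral.integral_finsetSum (fun n _ => ii (by have := he n; fun_prop))]
    refine Finset.sum_congr rfl fun n _ => ?_
    rw [intervalIntegral.integral_const_mul, ← Complex.conj_mul']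
  set u : ℝ → ℝ := fun x => ‖S x‖ ^ 3 with hu
  have huc : Continuous u := by simp only [hu]; fun_prop
  have e4 : ∑ n ∈ s, ‖D n‖ ^ 2 ≤ ∫ x in a..b, ∫ y in a..b, ((u x ^ 2 + u y ^ 2) / 2 * k (x - y) + B * (u x * u y)) := by
    have h0 : 0 ≤ ∑ n ∈ s, ‖D n‖ ^ 2 := Finset.sum_nonneg fun _ _ => sq_nonneg _
    have h1 : ∑ n ∈ s, ‖D n‖ ^ 2 = ‖((∑ n ∈ s, ‖D n‖ ^ 2 : ℝ) : ℂ)‖ := by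
      rw [Complex.norm_real, Real.norm_eq_abs, abs_of_nonneg h0]
    have hcc : ∀ x, Continuous fun y => ((u x ^ 2 + u y ^ 2) / 2 * k (x - y) + B * (u x * u y)) := by
      intro x; fun_prop
    rw [h1, e3]
    apply intervalIntegral.norm_integral_le_of_norm_le hab
    · refine Filter.Eventually.of_forall fun x hx => ?_
      apply intervalIntegral.norm_integral_le_of_norm_le hab
      · refine Filter.Eventually.of_forall fun y hy => ?_
        have h3 := hker x (Set.Ioc_subset_Icc_self hx) y (Set.Ioc_subset_Icc_self hy)
        rw [norm_mul, norm_mul, Complex.norm_conj, hφn, hφn]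
        change u x * u y * _ ≤ _
        have hux : 0 ≤ u x := by simp only [hu]; positivity
        have huy : 0 ≤ u y := by simp only [hu]; positivity
        calc _ ≤ u x * u y * (k (x - y) + B) := mul_le_mul_of_nonneg_left h3 (by positivity)
          _ = (u x * u y) * k (x - y) + B * (u x * u y) := by ring
          _ ≤ _ := by
            have := hk0 (x - y)
            have : (u x * u y) * k (x - y) ≤ (u x ^ 2 + u y ^ 2) / 2 * k (x - y) := by
              apply mul_le_mul_of_nonneg_right _ this
              nlinarith [sq_nonneg (u x - u y)]
            linarith
      · exact (hcc x).intervalIntegrable _ _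
    · apply Continuous.intervalIntegrable
      apply intervalIntegral.continuous_parametric_intervalIntegral_of_continuous' 
      fun_prop
  have hku : Continuous fun p : ℝ × ℝ => k (p.1 - p.2) := by fun_prop
  have e5 : ∫ x in a..b, ∫ y in a..b, ((u x ^ 2 + u y ^ 2) / 2 * k (x - y) + B * (u x * u y)) ≤ K * (∫ x in a..b, u x ^ 2) + B * (∫ x in a..b, u x) ^ 2 := by
    have c1 : Continuous fun x => ∫ y in a..b, k (x - y) := by
      apply intervalIntegral.continuous_parametric_intervalIntegral_of_continuous'
      fun_prop
    have c2 : Continuous fun x => ∫ y in a..b, u y ^ 2 * k (x - y) := by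
      apply intervalIntegral.continuous_parametric_intervalIntegral_of_continuous'
      fun_prop
    have h1 : ∀ x, ∫ y in a..b, ((u x ^ 2 + u y ^ 2) / 2 * k (x - y) + B * (u x * u y)) =
        (1/2) * (u x ^ 2 * ∫ y in a..b, k (x - y)) + (1/2) * (∫ y in a..b, u y ^ 2 * k (x - y)) + (B * ∫ y in a..b, u y) * u x := by
      intro x
      have : ∀ y, ((u x ^ 2 + u y ^ 2) / 2 * k (x - y) + B * (u x * u y)) = ((1/2 * u x ^ 2) * k (x - y) + (1/2) * (u y ^ 2 * k (x - y))) + (B * u x) * u y := by intro y; ring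
      simp_rw [this]
      rw [intervalIntegral.integral_add, intervalIntegral.integral_add, intervalIntegral.integral_const_mul, intervalIntegral.integral_const_mul, intervalIntegral.integral_const_mul]
      · ring
      all_goals exact Continuous.intervalIntegrable (by fun_prop) _ _
    simp_rw [h1]
    rw [intervalIntegral.integral_add, intervalIntegral.integral_add, intervalIntegral.integral_const_mul, intervalIntegral.integral_const_mul, intervalIntegral.integral_const_mul]
    rotate_left
    · exact Continuous.intervalIntegrable (by fun_prop) _ _
    · exact Continuous.intervalIntegrable (by fun_prop) _ _
    · exact Continuous.intervalIntegrable (by fun_prop) _ _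
    · exact Continuous.intervalIntegrable (by fun_prop) _ _
    rw [swap_cont hab (f := fun x y => u y ^ 2 * k (x - y)) (by simp only [Function.uncurry_def]; fun_prop)]
    have h2 : ∀ y, ∫ x in a..b, u y ^ 2 * k (x - y) = u y ^ 2 * ∫ x in a..b, k (y - x) := by
      intro y
      rw [intervalIntegral.integral_const_mul]
      congr 2; ext x; rw [← hkeven]; congr 1; ring
    simp_rw [h2]
    have h3 : ∫ x in a..b, u x ^ 2 * ∫ y in a..b, k (x - y) ≤ K * ∫ x in a..b, u x ^ 2 := by
      rw [← intervalIntegral.integral_const_mul]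
      apply intervalIntegral.integral_mono_on hab
      · exact Continuous.intervalIntegrable (by fun_prop) _ _
      · exact Continuous.intervalIntegrable (by fun_prop) _ _
      · intro x hx
        rw [mul_comm]
        exact mul_le_mul_of_nonneg_right (hK x hx) (sq_nonneg _)
    have : (B * ∫ y in a..b, u y) * (∫ x in a..b, u x) = B * (∫ x in a..b, u x) ^ 2 := by ring
    rw [this]
    linarith
  have e6 : ∫ x in a..b, u x ^ 2 ≤ G ^ 2 * I := by
    rw [hI, ← intervalIntegral.integral_const_mul]
    apply intervalIntegral.integral_mono_on hab
    · exact Continuous.intervalIntegrable (by fun_prop) _ _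
    · exact Continuous.intervalIntegrable (by fun_prop) _ _
    · intro x hx
      have := hG x hx
      simp only [hu]
      calc (‖S x‖^3)^2 = ‖S x‖^2 * ‖S x‖^4 := by ring
        _ ≤ _ := by gcongr
  have e7 : (∫ x in a..b, u x) ^ 2 ≤ I * ∫ x in a..b, ‖S x‖ ^ 2 := by
    have := cs_int hab (f := fun x => ‖S x‖^2) (g := fun x => ‖S x‖) (by fun_prop) (by fun_prop)
    simp only [← pow_mul] at this
    norm_num at this
    convert this using 3
    ext x; simp only [hu]; ring
  have e8 : I * I ≤ (A * (K * G ^ 2 + B * ∫ x in a..b, ‖S x‖ ^ 2)) * I := by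
    calc I * I = I ^ 2 := by ring
      _ ≤ A * ∑ n ∈ s, ‖D n‖ ^ 2 := e2
      _ ≤ A * (K * (G ^ 2 * I) + B * (I * ∫ x in a..b, ‖S x‖ ^ 2)) := by
          apply mul_le_mul_of_nonneg_left _ hA0
          refine e4.trans (e5.trans ?_)
          exact add_le_add (mul_le_mul_of_nonneg_left e6 hK0) (mul_le_mul_of_nonneg_left e7 hB)
      _ = _ := by ring
  rcases hI0.eq_or_lt with h | h
  · rw [← h]; positivity
  · exact le_of_mul_le_mul_right e8 h
end

section
open Real MeasureTheory

noncomputable def pw (n : ℕ) : ℝ := if n.Prime then log n else 0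
noncomputable def SS (c : ℝ) (N : ℕ) (x : ℝ) : ℂ := ∑ n ∈ Finset.Ioc (N/4) N, (pw n : ℂ) * EE x c n

lemma pw_nonneg (n : ℕ) : 0 ≤ pw n := by
  unfold pw; split_ifs
  · exact Real.log_natCast_nonneg n
  · exact le_refl _

lemma pw_le_log (n : ℕ) : pw n ≤ log n := by
  unfold pw; split_ifs
  · exact le_refl _
  · exact Real.log_natCast_nonneg n

lemma pw_le_vM (n : ℕ) : pw n ≤ ArithmeticFunction.vonMangoldt n := by
  unfold pw; split_ifs with h
  · rw [ArithmeticFunction.vonMangoldt_apply_prime h]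
  · exact ArithmeticFunction.vonMangoldt_nonneg

lemma cont_EE (c : ℝ) (n : ℕ) : Continuous (fun x => EE x c n) := by
  unfold EE ee; fun_prop

lemma cont_SS (c : ℝ) (N : ℕ) : Continuous (SS c N) := by
  unfold SS
  have := fun n => cont_EE c n
  fun_prop

lemma sum_vM_sub_pw (N : ℕ) (hN : 1 ≤ N) : ∑ n ∈ Finset.Ioc 0 N, (ArithmeticFunction.vonMangoldt n - pw n) ≤ 2 * √N * log N := by
  have h := Chebyshev.abs_psi_sub_theta_le_sqrt_mul_log (x := N) (by exact_mod_cast hN)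
  have h2 := (le_abs_self _).trans h
  unfold Chebyshev.psi Chebyshev.theta at h2
  rw [Nat.floor_natCast, Finset.sum_filter] at h2
  rw [Finset.sum_sub_distrib]
  exact h2

lemma SS_sup {c x : ℝ} (hc : 1 < c) (hc2 : c < 2) (hx : x ≠ 0) (N W : ℕ) (hW : 2 ≤ W)
    (hW3 : W ^ 4 ≤ N) (hT1 : (W:ℝ) ≤ |x| * (N:ℝ) ^ c) (hT2 : |x| * (N:ℝ)^c * W^3 ≤ N * √N) :
    ‖SS c N x‖ ≤ 11 * ppC c * (1 + log N)^5 * N / √W := by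
  have h1 := lambda_sup hc hc2 hx N W hW hW3 hT1 hT2
  have hpc := ppC_pos hc
  have hWr : (2:ℝ) ≤ W := by exact_mod_cast hW
  have hW4r : (W:ℝ)^4 ≤ N := by exact_mod_cast hW3
  have hN0 : (0:ℝ) < N := lt_of_lt_of_le (by positivity) hW4r
  have hN1 : 1 ≤ N := by exact_mod_cast hN0
  have hsW : 0 < √(W:ℝ) := Real.sqrt_pos.2 (by linarith)
  set l := 1 + log (N:ℝ) with hl
  have hl0 : 0 ≤ log (N:ℝ) := Real.log_natCast_nonneg N
  have h2 : ‖∑ n ∈ Finset.Ioc (N/4) N, ((ArithmeticFunction.vonMangoldt n : ℝ) : ℂ) * EE x c n - SS c N x‖ ≤ 2 * √N * log N := by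
    unfold SS
    rw [← Finset.sum_sub_distrib]
    calc _ ≤ ∑ n ∈ Finset.Ioc (N/4) N, (ArithmeticFunction.vonMangoldt n - pw n) := by
          refine (norm_sum_le _ _).trans (Finset.sum_le_sum fun n _ => ?_)
          rw [← sub_mul, norm_mul, norm_EE, mul_one, ← Complex.ofReal_sub, Complex.norm_real, Real.norm_eq_abs, abs_of_nonneg]
          linarith [pw_le_vM n]
      _ ≤ ∑ n ∈ Finset.Ioc 0 N, (ArithmeticFunction.vonMangoldt n - pw n) := by
          apply Finset.sum_le_sum_of_subset_of_nonneg
          · exact Finset.Ioc_subset_Ioc_left (by omega)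
          · intro n _ _; linarith [pw_le_vM n]
      _ ≤ _ := sum_vM_sub_pw N hN1
  have h3 : 2 * √(N:ℝ) * log N ≤ ppC c * l^5 * N / √W := by
    rw [le_div_iff₀ hsW]
    have h4 : √(W:ℝ) ≤ √N := by
      apply Real.sqrt_le_sqrt
      calc (W:ℝ) ≤ (W:ℝ)^4 := le_self_pow₀ (by linarith) (by norm_num)
        _ ≤ _ := hW4r
    have h5 : log (N:ℝ) ≤ l^5 := by
      calc log (N:ℝ) ≤ l := by linarith
        _ ≤ _ := le_self_pow₀ (by linarith) (by norm_num)
    calc 2 * √(N:ℝ) * log N * √W ≤ 2 * √(N:ℝ) * l^5 * √N := by gcongr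
      _ = 2 * l^5 * (√N * √N) := by ring
      _ = 2 * l^5 * N := by rw [Real.mul_self_sqrt hN0.le]
      _ ≤ _ := by gcongr; linarith
  have h6 : ‖SS c N x‖ ≤ ‖∑ n ∈ Finset.Ioc (N/4) N, ((ArithmeticFunction.vonMangoldt n : ℝ) : ℂ) * EE x c n‖ + 2 * √N * log N := by
    have := norm_sub_norm_le (SS c N x) (∑ n ∈ Finset.Ioc (N/4) N, ((ArithmeticFunction.vonMangoldt n : ℝ) : ℂ) * EE x c n)
    rw [norm_sub_rev] at this
    linarith
  calc _ ≤ 10 * ppC c * l^5 * N / √W + ppC c * l^5 * N / √W := by linarith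
    _ = _ := by ring

lemma sum_pw_sq (N : ℕ) : ∑ n ∈ Finset.Ioc (N/4) N, pw n ^ 2 ≤ N * (1 + log N)^2 := by
  have hl0 : 0 ≤ log (N:ℝ) := Real.log_natCast_nonneg N
  calc _ ≤ ∑ n ∈ Finset.Ioc (N/4) N, (1 + log (N:ℝ))^2 := by
        apply Finset.sum_le_sum; intro n hn
        rw [Finset.mem_Ioc] at hn
        have := pw_le_log n
        have h2 := log_mono_nat hn.2
        have h3 := pw_nonneg n
        gcongr; linarith
    _ = ((Finset.Ioc (N/4) N).card : ℝ) * (1 + log (N:ℝ))^2 := by rw [Finset.sum_const, nsmul_eq_mul]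
    _ ≤ _ := by
        gcongr; rw [Nat.card_Ioc]; omega

lemma rpow_sep {c : ℝ} (hc : 1 < c) {m n : ℕ} (hn : 1 ≤ n) (h : n < m) : (m:ℝ) - n ≤ (m:ℝ)^c - (n:ℝ)^c := by
  have hn' : (1:ℝ) ≤ n := by exact_mod_cast hn
  have h' : (n:ℝ) ≤ m := by exact_mod_cast h.le
  have e : ∀ t : ℝ, 1 ≤ t → t^c = t * t^(c-1) := by
    intro t ht
    rw [← Real.rpow_one_add' (by linarith) (by linarith)]; congr 1; ring
  rw [e m (by linarith), e n hn']
  have h1 : (1:ℝ) ≤ (n:ℝ)^(c-1) := Real.one_le_rpow hn' (by linarith)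
  have h2 : (n:ℝ)^(c-1) ≤ (m:ℝ)^(c-1) := Real.rpow_le_rpow (by linarith) h' (by linarith)
  nlinarith

lemma int_ee {Q u : ℝ} (hu : u ≠ 0) : ‖∫ x in (-Q)..Q, ee (x * u)‖ ≤ 1 / |u| := by
  unfold ee
  have hz : (2 * π * Complex.I * u : ℂ) ≠ 0 := by
    have : (π:ℂ) ≠ 0 := by exact_mod_cast Real.pi_ne_zero
    have : (u:ℂ) ≠ 0 := by exact_mod_cast hu
    simp [*]
  have e : ∀ x : ℝ, Complex.exp (2 * π * ((x * u : ℝ) : ℂ) * Complex.I) = Complex.exp ((2 * π * Complex.I * u : ℂ) * x) := by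
    intro x; congr 1; push_cast; ring
  simp_rw [e]
  rw [integral_exp_mul_complex hz, norm_div]
  have h1 : ‖Complex.exp ((2 * π * Complex.I * u : ℂ) * Q) - Complex.exp ((2 * π * Complex.I * u : ℂ) * ((-Q : ℝ) : ℂ))‖ ≤ 2 := by
    refine (norm_sub_le _ _).trans ?_
    rw [Complex.norm_exp, Complex.norm_exp]
    simp
    norm_num
  have h2 : ‖(2 * π * Complex.I * u : ℂ)‖ = 2 * π * |u| := by
    simp [abs_of_pos Real.pi_pos]
  rw [h2]
  have hu' := abs_pos.2 hu
  rw [div_le_div_iff₀ (by positivity) hu']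
  have := Real.pi_gt_three
  nlinarith

lemma SS_L2 {c Q : ℝ} (hc : 1 < c) (hQ : 0 ≤ Q) (N : ℕ) :
    ∫ x in (-Q)..Q, ‖SS c N x‖ ^ 2 ≤ 2 * N * (1 + log N)^3 * (Q + 1) := by
  have hl0 : 0 ≤ log (N:ℝ) := Real.log_natCast_nonneg N
  set s := Finset.Ioc (N/4) N with hs
  set I : ℂ := ∑ m ∈ s, ∑ n ∈ s, (pw m * pw n : ℂ) * ∫ x in (-Q)..Q, ee (x * ((m:ℝ)^c - (n:ℝ)^c)) with hI
  have e1 : ((∫ x in (-Q)..Q, ‖SS c N x‖ ^ 2 : ℝ) : ℂ) = I := by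
    rw [← intervalIntegral.integral_ofReal]
    have h : ∀ x, ((‖SS c N x‖ ^ 2 : ℝ) : ℂ) = ∑ m ∈ s, ∑ n ∈ s, (pw m * pw n : ℂ) * ee (x * ((m:ℝ)^c - (n:ℝ)^c)) := by
      intro x
      push_cast
      rw [← Complex.mul_conj']
      unfold SS
      rw [map_sum, Finset.sum_mul_sum]
      refine Finset.sum_congr rfl fun m _ => Finset.sum_congr rfl fun n _ => ?_
      rw [map_mul, Complex.conj_ofReal]
      unfold EE
      rw [conj_ee, mul_sub, sub_eq_add_neg, ee_add]
      ring
    simp_rw [h]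
    have hce : ∀ u : ℝ, Continuous fun x : ℝ => ee (x * u) := by intro u; unfold ee; fun_prop
    rw [intervalIntegral.integral_finsetSum]
    · refine Finset.sum_congr rfl fun m _ => ?_
      rw [intervalIntegral.integral_finsetSum]
      · refine Finset.sum_congr rfl fun n _ => ?_
        rw [intervalIntegral.integral_const_mul]
      · intro n _
        exact ((hce _).const_mul _ |>.intervalIntegrable _ _)
    · intro m _
      apply Continuous.intervalIntegrable
      apply continuous_finsetSum
      intro n _
      exact (hce _).const_mul _
  have hI0 : 0 ≤ ∫ x in (-Q)..Q, ‖SS c N x‖ ^ 2 := intervalIntegral.integral_nonneg (by linarith) (fun x _ => by positivity)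
  have e2 : ∫ x in (-Q)..Q, ‖SS c N x‖ ^ 2 = ‖I‖ := by
    rw [← e1, Complex.norm_real, Real.norm_eq_abs, abs_of_nonneg hI0]
  rw [e2]
  set l := 1 + log (N:ℝ) with hl
  have hpwl : ∀ m ∈ s, pw m ≤ l := by
    intro m hm
    rw [hs, Finset.mem_Ioc] at hm
    have := pw_le_log m
    have h2 := log_mono_nat hm.2
    linarith
  have row : ∀ m ∈ s, ∑ n ∈ s, ‖∫ x in (-Q)..Q, ee (x * ((m:ℝ)^c - (n:ℝ)^c))‖ ≤ 2 * Q + 2 * l := by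
    intro m hm
    have hm' := hm
    rw [hs, Finset.mem_Ioc] at hm'
    rw [← Finset.sum_filter_add_sum_filter_not s (fun n => n = m)]
    apply add_le_add
    · rw [Finset.filter_eq', if_pos hm, Finset.sum_singleton, sub_self]
      simp only [mul_zero, ee_zero]
      rw [intervalIntegral.integral_const]
      rw [norm_smul, norm_one, mul_one, Real.norm_eq_abs, abs_of_nonneg (by linarith)]; linarith
    · have h := sum_inv_dist (N/4+1) (N - N/4) m (by rw [Finset.mem_Ico]; omega) (by omega)
      have hss : Finset.Ico (N/4+1) (N/4+1 + (N - N/4)) = s := by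
        ext k; rw [hs, Finset.mem_Ico, Finset.mem_Ioc]; omega
      rw [hss] at h
      calc _ ≤ _ := Finset.sum_le_sum fun n hn => ?_
        _ ≤ _ := h
        _ ≤ 2 * l := by
          have := log_mono_nat (show N - N/4 ≤ N by omega)
          rw [hl]; linarith
      rw [Finset.mem_filter, hs, Finset.mem_Ioc] at hn
      have hne : n ≠ m := hn.2
      have hsep : ((max m n - min m n : ℕ) : ℝ) ≤ |(m:ℝ)^c - (n:ℝ)^c| := by
        rcases lt_or_gt_of_ne hne with h1 | h1
        · rw [max_eq_left h1.le, min_eq_right h1.le, Nat.cast_sub h1.le]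
          exact (rpow_sep hc (by omega) h1).trans (le_abs_self _)
        · rw [max_eq_right h1.le, min_eq_left h1.le, Nat.cast_sub h1.le]
          rw [abs_sub_comm]
          exact (rpow_sep hc (by omega) h1).trans (le_abs_self _)
      have hpos : (0:ℝ) < ((max m n - min m n : ℕ) : ℝ) := by
        have : 0 < max m n - min m n := by omega
        exact_mod_cast this
      refine (int_ee (abs_pos.1 (lt_of_lt_of_le hpos hsep))).trans ?_
      exact one_div_le_one_div_of_le hpos hsep
  calc ‖I‖ ≤ ∑ m ∈ s, ∑ n ∈ s, l^2 * ‖∫ x in (-Q)..Q, ee (x * ((m:ℝ)^c - (n:ℝ)^c))‖ := by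
        refine (norm_sum_le _ _).trans (Finset.sum_le_sum fun m hm => ?_)
        refine (norm_sum_le _ _).trans (Finset.sum_le_sum fun n hn => ?_)
        rw [norm_mul]
        apply mul_le_mul_of_nonneg_right _ (norm_nonneg _)
        rw [norm_mul, Complex.norm_real, Complex.norm_real, Real.norm_eq_abs, Real.norm_eq_abs, abs_of_nonneg (pw_nonneg m), abs_of_nonneg (pw_nonneg n), sq]
        exact mul_le_mul (hpwl m hm) (hpwl n hn) (pw_nonneg n) (by linarith)
    _ ≤ ∑ m ∈ s, l^2 * (2 * Q + 2 * l) := by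
        apply Finset.sum_le_sum; intro m hm
        rw [← Finset.mul_sum]
        exact mul_le_mul_of_nonneg_left (row m hm) (by positivity)
    _ = s.card * (l^2 * (2 * Q + 2 * l)) := by rw [Finset.sum_const, nsmul_eq_mul]
    _ ≤ N * (l^2 * (2 * Q * l + 2 * l)) := by
        have hc1 : (s.card : ℝ) ≤ N := by rw [hs, Nat.card_Ioc]; exact_mod_cast Nat.sub_le _ _
        have : 2 * Q ≤ 2 * Q * l := le_mul_of_one_le_right (by linarith) (by linarith)
        gcongr
    _ = _ := by ring
end

section
open Real MeasureTheory

lemma int_kernel {a b x d Δ : ℝ} (hd : 0 < d) (hx : x ∈ Set.Icc a b) (hΔ : b - a ≤ Δ) :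
    ∫ y in a..b, 1 / (|x - y| + d) ≤ 2 * log (1 + Δ / d) := by
  have hc : Continuous fun z : ℝ => 1 / (|z| + d) := by
    apply Continuous.div continuous_const (by fun_prop)
    intro z; positivity
  have hp : ∀ t, 0 ≤ t → t ≤ Δ → ∫ z in (0:ℝ)..t, 1 / (|z| + d) ≤ log (1 + Δ / d) := by
    intro t ht htΔ
    have e : ∫ z in (0:ℝ)..t, 1 / (|z| + d) = ∫ z in (0:ℝ)..t, 1 / (z + d) := by
      apply intervalIntegral.integral_congr
      intro z hz
      rw [Set.uIcc_of_le ht] at hz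
      simp only
      rw [abs_of_nonneg hz.1]
    rw [e, intervalIntegral.integral_comp_add_right (fun z => 1 / z), integral_one_div_of_pos (by linarith) (by linarith)]
    apply Real.log_le_log (by positivity)
    rw [zero_add, add_div, div_self hd.ne', add_comm]
    gcongr
  rw [intervalIntegral.integral_comp_sub_left (fun z => 1 / (|z| + d))]
  rw [← intervalIntegral.integral_add_adjacent_intervals (b := 0) (hc.intervalIntegrable _ _) (hc.intervalIntegrable _ _)]
  have e2 : ∫ z in (x - b)..0, 1 / (|z| + d) = ∫ z in (0:ℝ)..(b - x), 1 / (|z| + d) := by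
    have := intervalIntegral.integral_comp_neg (a := x - b) (b := 0) (fun z => 1 / (|z| + d))
    simp only [abs_neg, neg_zero, neg_sub] at this
    exact this
  rw [e2]
  have h1 := hp (b - x) (by linarith [hx.2]) (by linarith [hx.1])
  have h2 := hp (x - a) (by linarith [hx.1]) (by linarith [hx.2])
  linarith

lemma TT_bound {c z : ℝ} (hc : 1 < c) (hc2 : c < 2) (N : ℕ) (hN : 1 ≤ N) :
    ‖∑ n ∈ Finset.Ioc (N/4) N, ee (z * (n:ℝ)^c)‖ ≤ (2 * ppC c * (1 + log N) * (N:ℝ)^(1-c)) * (1 / (|z| + (N:ℝ)^(-c))) + ppC c * (1 + log N) * √(|z| * (N:ℝ)^c) := by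
  have hNr : (1:ℝ) ≤ N := by exact_mod_cast hN
  have hpc := ppC_pos hc
  have hl0 : 0 ≤ log (N:ℝ) := Real.log_natCast_nonneg N
  set l := 1 + log (N:ℝ) with hl
  have hNc : 0 < (N:ℝ)^c := by positivity
  have hNn : (N:ℝ)^(-c) = 1 / (N:ℝ)^c := by rw [Real.rpow_neg (by linarith), one_div]
  have hN1 : (N:ℝ)^(1-c) = N / (N:ℝ)^c := by rw [Real.rpow_sub (by linarith), Real.rpow_one]
  have hpl : 1000 ≤ ppC c * l := by nlinarith
  have h2 : 0 ≤ ppC c * l * √(|z| * (N:ℝ)^c) := by positivity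
  by_cases hz : |z| * (N:ℝ)^c ≤ 1
  · have h1 : ‖∑ n ∈ Finset.Ioc (N/4) N, ee (z * (n:ℝ)^c)‖ ≤ N := by
      refine (norm_sum_le _ _).trans ?_
      simp only [norm_ee, Finset.sum_const, nsmul_eq_mul, mul_one, Nat.card_Ioc]
      exact_mod_cast Nat.sub_le _ _
    have h3 : (N:ℝ) ≤ (2 * ppC c * l * (N:ℝ)^(1-c)) * (1 / (|z| + (N:ℝ)^(-c))) := by
      rw [mul_one_div, le_div_iff₀ (by positivity), hNn, hN1]
      have e : (N:ℝ) * (|z| + 1 / (N:ℝ)^c) = N / (N:ℝ)^c * (|z| * (N:ℝ)^c + 1) := by field_simp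
      rw [e, mul_comm]
      apply mul_le_mul_of_nonneg_right _ (by positivity)
      nlinarith
    linarith
  · push Not at hz
    have hz0 : z ≠ 0 := by rintro rfl; simp at hz; linarith
    have hzp := abs_pos.2 hz0
    have hpp := powerphase hc hc2 hNr hz0 (N/4+1) (N+1) (by
      have h4 : N < 4 * (N/4+1) := by omega
      have : (N:ℝ) < 4 * ((N/4+1 : ℕ):ℝ) := by exact_mod_cast h4
      linarith) (by push_cast; exact le_refl _)
    have hss : Finset.Ico (N/4+1) (N+1) = Finset.Ioc (N/4) N := by
      ext k; rw [Finset.mem_Ico, Finset.mem_Ioc]; omega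
    rw [hss] at hpp
    refine hpp.trans ?_
    rw [← hl, mul_add, add_comm]
    apply add_le_add_left
    have : (N:ℝ) / (|z| * (N:ℝ)^c) ≤ 2 * (N:ℝ)^(1-c) * (1 / (|z| + (N:ℝ)^(-c))) := by
      rw [mul_one_div, div_le_div_iff₀ (by positivity) (by positivity), hNn, hN1]
      have e : 2 * (N / (N:ℝ)^c) * (|z| * (N:ℝ)^c) = N * (2 * |z|) := by field_simp
      rw [e]
      apply mul_le_mul_of_nonneg_left _ (by linarith)
      have : 1 / (N:ℝ)^c ≤ |z| := by rw [div_le_iff₀ hNc]; exact hz.le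
      linarith
    calc _ ≤ ppC c * l * (2 * (N:ℝ)^(1-c) * (1 / (|z| + (N:ℝ)^(-c)))) := mul_le_mul_of_nonneg_left this (by positivity)
      _ = _ := by ring

/-- fourth moment on a short interval -/
lemma piece {c a b Δ G : ℝ} (hc : 1 < c) (hc2 : c < 2) (hab : a ≤ b) (hΔ : b - a ≤ Δ) (N : ℕ) (hN : 1 ≤ N)
    (hG : ∀ x ∈ Set.Icc a b, ‖SS c N x‖ ≤ G) :
    ∫ x in a..b, ‖SS c N x‖ ^ 4 ≤ (N * (1 + log N)^2) * ((4 * ppC c * (1 + log N) * (N:ℝ)^(1-c) * log (1 + Δ * (N:ℝ)^c)) * G ^ 2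
      + (ppC c * (1 + log N) * √(Δ * (N:ℝ)^c)) * ∫ x in a..b, ‖SS c N x‖ ^ 2) := by
  have hNr : (1:ℝ) ≤ N := by exact_mod_cast hN
  have hpc := ppC_pos hc
  have hl0 : 0 ≤ log (N:ℝ) := Real.log_natCast_nonneg N
  set l := 1 + log (N:ℝ) with hl
  have hNc : 0 < (N:ℝ)^c := by positivity
  have hd : 0 < (N:ℝ)^(-c) := by positivity
  have hΔ0 : 0 ≤ Δ := by linarith
  have hΔN : 0 ≤ Δ * (N:ℝ)^c := by positivity
  have hlog : 0 ≤ log (1 + Δ * (N:ℝ)^c) := Real.log_nonneg (by linarith)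
  have hΔd : Δ / (N:ℝ)^(-c) = Δ * (N:ℝ)^c := by rw [Real.rpow_neg (by linarith)]; field_simp
  have hJ0 : 0 ≤ ∫ x in a..b, ‖SS c N x‖ ^ 2 := intervalIntegral.integral_nonneg hab (fun x _ => by positivity)
  have main := fourth_moment hab (Finset.Ioc (N/4) N) pw (fun n x => EE x c n) (fun n => cont_EE c n) (SS c N) (fun x => rfl)
    (fun z => (2 * ppC c * l * (N:ℝ)^(1-c)) * (1 / (|z| + (N:ℝ)^(-c))))
    (by
      apply Continuous.mul continuous_const
      apply Continuous.div continuous_const (by fun_prop)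
      intro z; positivity)
    (fun z => by positivity) (fun z => by rw [abs_neg])
    (B := ppC c * l * √(Δ * (N:ℝ)^c)) (K := 4 * ppC c * l * (N:ℝ)^(1-c) * log (1 + Δ * (N:ℝ)^c)) (G := G) (by positivity)
    (by
      intro x hx y hy
      have e : ∑ n ∈ Finset.Ioc (N/4) N, EE x c n * (starRingEnd ℂ) (EE y c n) = ∑ n ∈ Finset.Ioc (N/4) N, ee ((x - y) * (n:ℝ)^c) := by
        refine Finset.sum_congr rfl fun n _ => ?_
        unfold EE
        rw [conj_ee, ← ee_add]; congr 1; ring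
      rw [e]
      refine (TT_bound hc hc2 N hN).trans ?_
      rw [← hl]
      apply add_le_add_right
      apply mul_le_mul_of_nonneg_left _ (by positivity)
      apply Real.sqrt_le_sqrt
      apply mul_le_mul_of_nonneg_right _ hNc.le
      rw [abs_le]; constructor <;> linarith [hx.1, hx.2, hy.1, hy.2])
    (by
      intro x hx
      rw [intervalIntegral.integral_const_mul]
      have := int_kernel hd hx hΔ
      rw [hΔd] at this
      calc _ ≤ _ := mul_le_mul_of_nonneg_left this (by positivity)
        _ = _ := by ring)
    (by positivity) hG
  refine main.trans ?_
  exact mul_le_mul_of_nonneg_right (sum_pw_sq N) (by positivity)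
end

section
open Real MeasureTheory

noncomputable def mC (c : ℝ) : ℝ := 6000 * ppC c ^ 3

set_option maxHeartbeats 1000000 in
lemma minor_pos {c : ℝ} (hc : 1 < c) (hc2 : c < 39/29) (N W : ℕ) (hN : 2^50 ≤ N) (hW : 2 ≤ W) (hWN : (W:ℝ) ≤ (N:ℝ)^((1:ℝ)/25)) :
    ∫ x in (W / (N:ℝ)^c)..((N:ℝ)^((1:ℝ)/1000)), ‖SS c N x‖ ^ 4 ≤ mC c * (1 + log N)^14 * ((N:ℝ)^(4-c) / W + (N:ℝ)^(4 - c - 1/5000)) := by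
  have hpc := ppC_pos hc
  have hl0 : 0 ≤ log (N:ℝ) := Real.log_natCast_nonneg N
  set l := 1 + log (N:ℝ) with hl
  have hl1 : 1 ≤ l := by linarith
  have hNr' : (2:ℝ)^50 ≤ N := by exact_mod_cast hN
  have hNr : (2:ℝ)^25 ≤ N := le_trans (by norm_num) hNr'
  have hN1 : (1:ℝ) ≤ N := le_trans (by norm_num) hNr
  have hN0 : (0:ℝ) < N := by linarith
  have hN1' : 1 ≤ N := by exact_mod_cast hN1
  have hmono : ∀ {u v : ℝ}, u ≤ v → (N:ℝ)^u ≤ (N:ℝ)^v := fun h => Real.rpow_le_rpow_of_exponent_le hN1 h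
  have hone : ∀ {u : ℝ}, 0 ≤ u → 1 ≤ (N:ℝ)^u := fun h => Real.one_le_rpow hN1 h
  have hadd : ∀ u v : ℝ, (N:ℝ)^u * (N:ℝ)^v = (N:ℝ)^(u+v) := fun u v => (Real.rpow_add hN0 u v).symm
  have hpos : ∀ u : ℝ, 0 < (N:ℝ)^u := fun u => Real.rpow_pos_of_pos hN0 u
  set Q := (N:ℝ)^((1:ℝ)/1000) with hQ
  set Δ := (N:ℝ)^(-(37:ℝ)/1000) with hΔ
  set Nθ := (N:ℝ)^((1:ℝ)/25) with hNθ
  have hNθ2 : 2 ≤ Nθ := by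
    have : ((2:ℝ)^25)^((1:ℝ)/25) ≤ Nθ := Real.rpow_le_rpow (by norm_num) hNr (by norm_num)
    rw [← Real.rpow_natCast, ← Real.rpow_mul (by norm_num)] at this
    norm_num at this
    exact this
  have hN50 : 2 ≤ (N:ℝ)^((1:ℝ)/50) := by
    have : ((2:ℝ)^50)^((1:ℝ)/50) ≤ (N:ℝ)^((1:ℝ)/50) := Real.rpow_le_rpow (by norm_num) hNr' (by norm_num)
    rw [← Real.rpow_natCast, ← Real.rpow_mul (by norm_num)] at this
    norm_num at this
    norm_num
    exact this
  set W2 := ⌊Nθ⌋₊ with hW2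
  have hW2le : (W2:ℝ) ≤ Nθ := Nat.floor_le (by linarith)
  have hW2ge : Nθ / 2 ≤ W2 := by
    have := Nat.lt_floor_add_one Nθ
    rw [← hW2] at this; linarith
  have hW22 : 2 ≤ W2 := Nat.le_floor (by exact_mod_cast hNθ2)
  have hQ1 : 1 ≤ Q := hone (by norm_num)
  have hΔ0 : 0 < Δ := hpos _
  have hΔ1 : Δ ≤ 1 := by
    rw [hΔ]; exact Real.rpow_le_one_of_one_le_of_nonpos hN1 (by norm_num)
  have hWr : (2:ℝ) ≤ W := by exact_mod_cast hW
  have hNθ4 : Nθ^4 ≤ N := by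
    rw [hNθ, ← Real.rpow_natCast, ← Real.rpow_mul hN0.le]
    calc _ ≤ (N:ℝ)^(1:ℝ) := hmono (by norm_num)
      _ = N := Real.rpow_one _
  have hNθ3 : Nθ^3 = (N:ℝ)^((3:ℝ)/25) := by
    rw [hNθ, ← Real.rpow_natCast, ← Real.rpow_mul hN0.le]; norm_num
  have hNs : (N:ℝ) * √N = (N:ℝ)^((3:ℝ)/2) := by
    rw [Real.sqrt_eq_rpow]
    nth_rewrite 1 [← Real.rpow_one (N:ℝ)]
    rw [hadd]; norm_num
  -- sup bounds
  have sup : ∀ (U : ℕ), 2 ≤ U → (U:ℝ) ≤ Nθ → ∀ x, (U:ℝ) / (N:ℝ)^c ≤ x → x ≤ 2 * Q → ‖SS c N x‖ ≤ 11 * ppC c * l^5 * N / √U := by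
    intro U hU hUθ x hx1 hx2
    have hUr : (2:ℝ) ≤ U := by exact_mod_cast hU
    have hx0 : 0 < x := lt_of_lt_of_le (by positivity) hx1
    apply SS_sup hc (by linarith) hx0.ne' N U hU
    · have : (U:ℝ)^4 ≤ N := le_trans (pow_le_pow_left₀ (by linarith) hUθ 4) hNθ4
      exact_mod_cast this
    · rw [abs_of_pos hx0]
      rwa [div_le_iff₀ (hpos c)] at hx1
    · rw [abs_of_pos hx0, hNs]
      calc x * (N:ℝ)^c * (U:ℝ)^3 ≤ (2 * Q) * (N:ℝ)^c * Nθ^3 := by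
            gcongr
        _ ≤ ((N:ℝ)^((1:ℝ)/50) * Q) * (N:ℝ)^c * Nθ^3 := by gcongr
        _ = (N:ℝ)^((1:ℝ)/50 + 1/1000 + c + 3/25) := by
            rw [hNθ3, hQ, hadd, hadd, hadd]
        _ ≤ _ := hmono (by linarith)
  set w := (W:ℝ) / (N:ℝ)^c with hw
  have hwΔ : w ≤ Δ := by
    rw [hw, div_le_iff₀ (hpos c), hΔ, hadd]
    exact hWN.trans (hmono (by linarith))
  have hw0 : 0 < w := by rw [hw]; positivity
  set K := ⌊Q / Δ⌋₊ with hK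
  have hKle : K * Δ ≤ Q := by
    have := Nat.floor_le (show 0 ≤ Q / Δ by positivity)
    rwa [← hK, le_div_iff₀ hΔ0] at this
  have hKge : Q ≤ (K + 1) * Δ := by
    have := (Nat.lt_floor_add_one (Q/Δ)).le
    rwa [← hK, div_le_iff₀ hΔ0] at this
  set t : ℕ → ℝ := fun k => if k = 0 then w else k * Δ with ht
  have ht0 : t 0 = w := by simp [ht]
  have hts : ∀ k, t (k+1) = (k+1) * Δ := by intro k; simp [ht]
  have htle : ∀ k, t k ≤ t (k+1) := by
    intro k
    rw [hts]
    by_cases h : k = 0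
    · subst h; rw [ht0]; simp; exact hwΔ
    · simp only [ht, if_neg h]; nlinarith
  have htd : ∀ k, t (k+1) - t k ≤ Δ := by
    intro k
    rw [hts]
    by_cases h : k = 0
    · subst h; rw [ht0]; simp; exact hw0.le
    · simp only [ht, if_neg h]; linarith
  have hc4 : Continuous fun x => ‖SS c N x‖ ^ 4 := by have := cont_SS c N; fun_prop
  have hc22 : Continuous fun x => ‖SS c N x‖ ^ 2 := by have := cont_SS c N; fun_prop
  have htK : t (K+1) = (K+1) * Δ := hts K
  have htK2 : t (K+1) ≤ 2 * Q := by rw [htK]; linarith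
  have s1 : ∫ x in w..Q, ‖SS c N x‖ ^ 4 ≤ ∑ k ∈ Finset.range (K+1), ∫ x in (t k)..(t (k+1)), ‖SS c N x‖ ^ 4 := by
    rw [intervalIntegral.sum_integral_adjacent_intervals (fun k _ => hc4.intervalIntegrable _ _), ht0, htK]
    apply intervalIntegral.integral_mono_interval (le_refl _) (by linarith) hKge
    · exact Filter.Eventually.of_forall fun x => by positivity
    · exact hc4.intervalIntegrable _ _
  have s2 : ∑ k ∈ Finset.range (K+1), ∫ x in (t k)..(t (k+1)), ‖SS c N x‖ ^ 2 ≤ 6 * N * l^3 * Q := by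
    rw [intervalIntegral.sum_integral_adjacent_intervals (fun k _ => hc22.intervalIntegrable _ _), ht0]
    have h1 := SS_L2 hc (show 0 ≤ 2 * Q by linarith) N
    calc _ ≤ ∫ x in (-(2*Q))..(2*Q), ‖SS c N x‖ ^ 2 := by
          apply intervalIntegral.integral_mono_interval (by linarith) _ htK2
          · exact Filter.Eventually.of_forall fun x => by positivity
          · exact hc22.intervalIntegrable _ _
          · rw [htK]; linarith
      _ ≤ _ := h1
      _ ≤ 2 * N * l^3 * (3 * Q) := by gcongr; linarith
      _ = _ := by ring
  set B := ppC c * l * √(Δ * (N:ℝ)^c) with hB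
  set K1 := 4 * ppC c * l * (N:ℝ)^(1-c) * (3 * l) with hK1
  set A := (11 * ppC c * l^5 * N)^2 with hA
  set U : ℕ → ℝ := fun k => if k = 0 then (W:ℝ) else W2 with hU
  have hlog3 : log (1 + Δ * (N:ℝ)^c) ≤ 3 * l := by
    have h1 : 1 + Δ * (N:ℝ)^c ≤ (N:ℝ)^3 := by
      have h2 : (N:ℝ)^c ≤ (N:ℝ)^2 := by
        rw [← Real.rpow_natCast]; exact hmono (by norm_num; linarith)
      have h3 : Δ * (N:ℝ)^c ≤ (N:ℝ)^2 := by
        calc _ ≤ 1 * (N:ℝ)^c := by gcongr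
          _ ≤ _ := by rw [one_mul]; exact h2
      have h4 : (2:ℝ) ≤ N := le_trans (by norm_num) hNr
      nlinarith [sq_nonneg (N:ℝ)]
    calc _ ≤ log ((N:ℝ)^3) := Real.log_le_log (by positivity) h1
      _ = 3 * log N := by rw [Real.log_pow]; norm_num
      _ ≤ _ := by linarith
  have pc : ∀ k ∈ Finset.range (K+1), ∫ x in (t k)..(t (k+1)), ‖SS c N x‖ ^ 4 ≤ (N * l^2) * (K1 * (A / U k) + B * ∫ x in (t k)..(t (k+1)), ‖SS c N x‖ ^ 2) := by
    intro k hk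
    rw [Finset.mem_range] at hk
    have hkK : t (k+1) ≤ 2 * Q := by
      rw [hts]
      have : ((k:ℝ) + 1) ≤ K + 1 := by exact_mod_cast hk
      nlinarith
    have hsup : ∀ x ∈ Set.Icc (t k) (t (k+1)), ‖SS c N x‖ ≤ 11 * ppC c * l^5 * N / √(U k) := by
      intro x hx
      by_cases h : k = 0
      · subst h
        simp only [hU, if_true]
        exact sup W hW hWN x (by rw [← hw, ← ht0]; exact hx.1) (hx.2.trans hkK)
      · simp only [hU, if_neg h]
        apply sup W2 hW22 hW2le x _ (hx.2.trans hkK)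
        refine le_trans ?_ hx.1
        simp only [ht, if_neg h]
        have hk1 : (1:ℝ) ≤ k := by exact_mod_cast Nat.one_le_iff_ne_zero.2 h
        rw [div_le_iff₀ (hpos c)]
        calc (W2:ℝ) ≤ Nθ := hW2le
          _ ≤ (N:ℝ)^(-(37:ℝ)/1000 + c) := hmono (by linarith)
          _ = 1 * Δ * (N:ℝ)^c := by rw [one_mul, hΔ, hadd]
          _ ≤ _ := by gcongr
    have hUp : 0 < U k := by
      simp only [hU]; split_ifs
      · linarith
      · have : (2:ℝ) ≤ W2 := by exact_mod_cast hW22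
        linarith
    have := piece hc (by linarith) (htle k) (htd k) N hN1' hsup
    refine this.trans ?_
    rw [← hl, ← hB]
    apply mul_le_mul_of_nonneg_left _ (by positivity)
    apply add_le_add_left
    rw [div_pow, Real.sq_sqrt hUp.le, ← hA]
    apply mul_le_mul_of_nonneg_right _ (by positivity)
    rw [hK1]
    exact mul_le_mul_of_nonneg_left hlog3 (by positivity)
  have hB0 : 0 ≤ B := by positivity
  have hK10 : 0 ≤ K1 := by positivity
  have s3 : ∑ k ∈ Finset.range (K+1), A / U k ≤ A / W + K * (A / W2) := by
    rw [Finset.sum_range_succ']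
    simp [hU]
    linarith
  have s4 : ∫ x in w..Q, ‖SS c N x‖ ^ 4 ≤ (N * l^2) * (K1 * (A / W + K * (A / W2)) + B * (6 * N * l^3 * Q)) := by
    refine s1.trans ((Finset.sum_le_sum pc).trans ?_)
    rw [← Finset.mul_sum, Finset.sum_add_distrib, ← Finset.mul_sum, ← Finset.mul_sum]
    apply mul_le_mul_of_nonneg_left _ (by positivity)
    exact add_le_add (mul_le_mul_of_nonneg_left s3 hK10) (mul_le_mul_of_nonneg_left s2 hB0)
  refine s4.trans ?_
  have p1 : (K:ℝ) / W2 ≤ 2 * (N:ℝ)^(-(1:ℝ)/5000) := by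
    have h1 : (K:ℝ) ≤ Q / Δ := by rw [le_div_iff₀ hΔ0]; exact hKle
    calc (K:ℝ) / W2 ≤ (Q / Δ) / (Nθ / 2) := by gcongr
      _ = 2 * ((N:ℝ)^((1:ℝ)/1000 - -(37:ℝ)/1000 - 1/25)) := by
          rw [Real.rpow_sub hN0, Real.rpow_sub hN0, ← hQ, ← hΔ, ← hNθ]; field_simp
      _ ≤ _ := mul_le_mul_of_nonneg_left (hmono (by norm_num)) (by norm_num)
  have p2 : √(Δ * (N:ℝ)^c) * Q ≤ (N:ℝ)^(2 - c - 1/5000) := by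
    rw [hΔ, hadd, Real.sqrt_eq_rpow, ← Real.rpow_mul hN0.le, hQ, hadd]
    apply hmono; linarith
  have q1 : (N:ℝ)^(1-c) * N * N^2 = (N:ℝ)^(4-c) := by
    rw [← Real.rpow_natCast, mul_assoc]
    nth_rewrite 2 [← Real.rpow_one (N:ℝ)]
    rw [hadd, hadd]; congr 1; norm_num; ring
  have q2 : (N:ℝ)^2 * (N:ℝ)^(2 - c - 1/5000) = (N:ℝ)^(4 - c - 1/5000) := by
    rw [← Real.rpow_natCast, hadd]; congr 1; norm_num; ring
  have q3 : (N:ℝ)^(4-c) * (N:ℝ)^(-(1:ℝ)/5000) = (N:ℝ)^(4 - c - 1/5000) := by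
    rw [hadd]; congr 1; ring
  have g1 : (N * l^2) * (K1 * (A / W + K * (A / W2)) + B * (6 * N * l^3 * Q)) =
      1452 * ppC c^3 * l^14 * ((N:ℝ)^(1-c) * N * N^2) * (1 / W + K / W2) + 6 * ppC c * l^6 * (N^2 * (√(Δ * (N:ℝ)^c) * Q)) := by
    rw [hK1, hA, hB]; ring
  rw [g1, q1]
  have pc3 : ppC c ≤ ppC c^3 := le_self_pow₀ (by linarith) (by norm_num)
  have l6 : l^6 ≤ l^14 := pow_le_pow_right₀ hl1 (by norm_num)
  calc _ ≤ 1452 * ppC c^3 * l^14 * (N:ℝ)^(4-c) * (1 / W + 2 * (N:ℝ)^(-(1:ℝ)/5000)) + 6 * ppC c^3 * l^14 * (N^2 * (N:ℝ)^(2 - c - 1/5000)) := by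
        apply add_le_add
        · apply mul_le_mul_of_nonneg_left _ (by positivity)
          linarith
        · apply mul_le_mul _ (mul_le_mul_of_nonneg_left p2 (by positivity)) (by positivity) (by positivity)
          apply mul_le_mul _ l6 (by positivity) (by positivity)
          linarith
    _ = 1452 * ppC c^3 * l^14 * ((N:ℝ)^(4-c) / W) + 2910 * ppC c^3 * l^14 * (N:ℝ)^(4 - c - 1/5000) := by
        rw [q2, ← q3]; ring
    _ ≤ 6000 * ppC c^3 * l^14 * ((N:ℝ)^(4-c) / W) + 6000 * ppC c^3 * l^14 * (N:ℝ)^(4 - c - 1/5000) := by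
        gcongr <;> norm_num
    _ = _ := by rw [mC]; ring
end

section
open Real MeasureTheory

/-! ### Growth of the completed zeta function -/

noncomputable def zT (n : ℕ) (s : ℂ) : ℂ :=
  (s - 1) * ((n+1 : ℕ) : ℂ) ^ (-s) + ((n+2 : ℕ) : ℂ) ^ (1 - s) - ((n+1 : ℕ) : ℂ) ^ (1 - s)

lemma zT_diff (n : ℕ) : Differentiable ℂ (zT n) := by
  intro s
  unfold zT
  have h1 : ((n+1 : ℕ) : ℂ) ≠ 0 := Nat.cast_ne_zero.2 (by omega)
  have h2 : ((n+2 : ℕ) : ℂ) ≠ 0 := Nat.cast_ne_zero.2 (by omega)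
  have a1 : DifferentiableAt ℂ (fun s : ℂ => ((n+1 : ℕ) : ℂ) ^ (-s)) s := (differentiableAt_id.neg).const_cpow (Or.inl h1)
  have a2 : DifferentiableAt ℂ (fun s : ℂ => ((n+1 : ℕ) : ℂ) ^ (1-s)) s := (differentiableAt_id.const_sub 1).const_cpow (Or.inl h1)
  have a3 : DifferentiableAt ℂ (fun s : ℂ => ((n+2 : ℕ) : ℂ) ^ (1-s)) s := (differentiableAt_id.const_sub 1).const_cpow (Or.inl h2)
  exact (((differentiableAt_id.sub_const 1).mul a1).add a3).sub a2

lemma hasDeriv_ofReal_cpow {x : ℝ} (hx : 0 < x) (r : ℂ) :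
    HasDerivAt (fun y : ℝ => (y:ℂ) ^ r) (r * (x:ℂ)^(r-1)) x := by
  have h := (hasDerivAt_id (x:ℂ)).cpow_const (c := r) (Or.inl (by simpa using hx))
  have := h.comp_ofReal
  simpa using this

lemma cpow_diff_bound {m x : ℝ} (hm : 0 < m) (hx : m ≤ x) (hx1 : x ≤ m + 1) (s : ℂ) (hs : 0 ≤ s.re) :
    ‖(m:ℂ)^(-s) - (x:ℂ)^(-s)‖ ≤ ‖s‖ * m^(-s.re-1) := by
  have h := (convex_Icc m x).norm_image_sub_le_of_norm_hasDerivWithin_le (f := fun y : ℝ => (y:ℂ)^(-s))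
    (f' := fun y : ℝ => (-s) * (y:ℂ)^(-s-1)) (C := ‖s‖ * m^(-s.re-1))
    (fun y hy => (hasDeriv_ofReal_cpow (lt_of_lt_of_le hm hy.1) (-s)).hasDerivWithinAt)
    (fun y hy => by
      rw [norm_mul, norm_neg, Complex.norm_cpow_eq_rpow_re_of_pos (lt_of_lt_of_le hm hy.1)]
      apply mul_le_mul_of_nonneg_left _ (norm_nonneg _)
      simp only [Complex.sub_re, Complex.neg_re, Complex.one_re]
      exact Real.rpow_le_rpow_of_nonpos hm hy.1 (by linarith))
    (x := x) (y := m) ⟨hx, le_refl _⟩ ⟨le_refl _, hx⟩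
  refine h.trans ?_
  rw [Real.norm_eq_abs, abs_sub_comm, abs_of_nonneg (by linarith)]
  have : 0 ≤ ‖s‖ * m^(-s.re-1) := by positivity
  nlinarith

lemma zT_bound (n : ℕ) (s : ℂ) (hs : 0 ≤ s.re) :
    ‖zT n s‖ ≤ ‖s-1‖ * ‖s‖ * ((n:ℝ)+1)^(-s.re-1) := by
  set m : ℝ := (n:ℝ)+1 with hm
  have hm0 : 0 < m := by positivity
  have h := (convex_Icc m (m+1)).norm_image_sub_le_of_norm_hasDerivWithin_le (f := fun y : ℝ => (s-1) * (m:ℂ)^(-s) * (y:ℂ) + (y:ℂ)^(1-s))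
    (f' := fun y : ℝ => (s-1) * ((m:ℂ)^(-s) - (y:ℂ)^(-s))) (C := ‖s-1‖ * (‖s‖ * m^(-s.re-1)))
    (fun y hy => by
      have h1 := hasDeriv_ofReal_cpow (lt_of_lt_of_le hm0 hy.1) (1-s)
      have h2 : HasDerivAt (fun y : ℝ => (s-1) * (m:ℂ)^(-s) * (y:ℂ)) ((s-1) * (m:ℂ)^(-s) * 1) y :=
        (Complex.ofRealCLM.hasDerivAt (x := y)).const_mul _
      have h3 := h1.const_mul 1
      refine (HasDerivAt.congr_deriv (h2.add h1) ?_).hasDerivWithinAt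
      have : (1 - s - 1 : ℂ) = -s := by ring
      rw [this]; ring)
    (fun y hy => by
      rw [norm_mul]
      exact mul_le_mul_of_nonneg_left (cpow_diff_bound hm0 hy.1 hy.2 s hs) (norm_nonneg _))
    (x := m) (y := m+1) ⟨le_refl _, by linarith⟩ ⟨by linarith, le_refl _⟩
  have e : ‖m + 1 - m‖ = 1 := by simp
  rw [e, mul_one] at h
  rw [mul_assoc]
  refine le_of_eq_of_le ?_ h
  congr 1
  rw [zT]
  have e1 : ((n+1 : ℕ) : ℂ) = (m:ℂ) := by rw [hm]; push_cast; ring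
  have e2 : ((n+2 : ℕ) : ℂ) = ((m+1 : ℝ):ℂ) := by rw [hm]; push_cast; ring
  rw [e1, e2]
  push_cast
  ring

lemma summable_shift {a : ℝ} (ha : 1 < a) : Summable fun n : ℕ => ((n:ℝ)+1)^(-a) := by
  have := (summable_nat_add_iff 1).2 (Real.summable_nat_rpow.2 (show -a < -1 by linarith))
  simpa using this

lemma zT_tsum_of_one_lt {s : ℂ} (hs : 1 < s.re) : HasSum (fun n => zT n s) (riemannZeta₁ s - 1) := by
  have hs1 : s ≠ 1 := by rintro rfl; simp at hs
  have hz : HasSum (fun n : ℕ => ((n+1 : ℕ) : ℂ) ^ (-s)) (riemannZeta s) := by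
    rw [zeta_eq_tsum_one_div_nat_add_one_cpow hs]
    have h1 : Summable (fun n : ℕ => 1 / ((n:ℂ)+1)^s) := by
      have := (Complex.summable_one_div_nat_cpow (p := s)).2 hs
      have := (summable_nat_add_iff 1).2 this
      simpa using this
    have := h1.hasSum
    convert this using 2 with n
    rw [Complex.cpow_neg]; push_cast; rw [one_div]
  have ht : HasSum (fun n : ℕ => ((n+2 : ℕ) : ℂ) ^ (1 - s) - ((n+1 : ℕ) : ℂ) ^ (1 - s)) (0 - 1) := by
    have hsm : Summable (fun n : ℕ => ((n+2 : ℕ) : ℂ) ^ (1 - s) - ((n+1 : ℕ) : ℂ) ^ (1 - s)) := by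
      have h1 : Summable (fun n => zT n s) := by
        apply Summable.of_norm_bounded (g := fun n : ℕ => ‖s-1‖ * ‖s‖ * ((n:ℝ)+1)^(-(s.re+1)))
        · exact (summable_shift (by linarith)).mul_left _
        · intro n
          have := zT_bound n s (by linarith)
          rwa [show -s.re-1 = -(s.re+1) by ring] at this
      have h2 := h1.sub (hz.summable.mul_left (s-1))
      refine h2.congr fun n => ?_
      rw [zT]; ring
    rw [hsm.hasSum_iff_tendsto_nat]
    have hl : Filter.Tendsto (fun n : ℕ => ((n+1 : ℕ) : ℂ)^(1-s)) Filter.atTop (nhds 0) := by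
      rw [tendsto_zero_iff_norm_tendsto_zero]
      have h3 : Filter.Tendsto (fun n : ℕ => ((n+1 : ℕ) : ℝ)^(-(s.re-1))) Filter.atTop (nhds 0) :=
        (tendsto_rpow_neg_atTop (by linarith)).comp (tendsto_natCast_atTop_atTop.comp (Filter.tendsto_add_atTop_nat 1))
      refine h3.congr fun n => ?_
      rw [Complex.norm_natCast_cpow_of_pos (by omega)]
      simp
    have := hl.sub_const 1
    refine this.congr fun n => ?_
    have := Finset.sum_range_sub (fun n : ℕ => ((n+1 : ℕ) : ℂ)^(1-s)) n
    simp only [zero_add, Nat.cast_one, Complex.one_cpow] at this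
    rw [← this]
  have h := (hz.mul_left (s-1)).add ht
  have e : (s-1) * riemannZeta s + (0 - 1) = riemannZeta₁ s - 1 := by
    rw [riemannZeta_eq_inv_sub_mul hs1]
    have : s - 1 ≠ 0 := sub_ne_zero.2 hs1
    field_simp; ring
  rw [e] at h
  refine h.congr_fun ?_ 
  intro n
  rw [zT]; ring

lemma zeta1_bound : ∃ C : ℝ, 1 ≤ C ∧ ∀ s : ℂ, 1/2 ≤ s.re → ‖riemannZeta₁ s‖ ≤ C * (1 + ‖s‖)^2 := by
  have hsm : Summable fun n : ℕ => ((n:ℝ)+1)^(-((5:ℝ)/4)) := summable_shift (by norm_num)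
  set S := ∑' n : ℕ, ((n:ℝ)+1)^(-((5:ℝ)/4)) with hS
  have hS0 : 0 ≤ S := tsum_nonneg fun n => by positivity
  have bd : ∀ s : ℂ, 1/4 ≤ s.re → ∀ n, ‖zT n s‖ ≤ ‖s-1‖ * ‖s‖ * ((n:ℝ)+1)^(-((5:ℝ)/4)) := by
    intro s hs n
    refine (zT_bound n s (by linarith)).trans ?_
    apply mul_le_mul_of_nonneg_left _ (by positivity)
    exact Real.rpow_le_rpow_of_exponent_le (by linarith [Nat.cast_nonneg (α := ℝ) n]) (by linarith)
  have key : ∀ s : ℂ, 1/2 ≤ s.re → riemannZeta₁ s = 1 + ∑' n, zT n s := by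
    intro s hs
    set U : Set ℂ := {z | 1/4 < z.re} ∩ Metric.ball 0 (‖s‖ + 3) with hU
    have hUo : IsOpen U := (isOpen_lt continuous_const Complex.continuous_re).inter Metric.isOpen_ball
    have hUc : Convex ℝ U := (convex_halfSpace_re_gt _).inter (convex_ball _ _)
    have hd : DifferentiableOn ℂ (fun z => ∑' n, zT n z) U := by
      apply Complex.differentiableOn_tsum_of_summable_norm (u := fun n : ℕ => (‖s‖+4) * (‖s‖+3) * ((n:ℝ)+1)^(-((5:ℝ)/4))) (hsm.mul_left _)
        (fun n => (zT_diff n).differentiableOn) hUo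
      intro n w hw
      have hw2 : ‖w‖ < ‖s‖ + 3 := by simpa using hw.2
      have hw3 : ‖w - 1‖ ≤ ‖s‖ + 4 := (norm_sub_le _ _).trans (by simp; linarith)
      refine (bd w hw.1.le n).trans ?_
      gcongr
    have h1 : AnalyticOnNhd ℂ (fun z => 1 + ∑' n, zT n z) U := (hd.const_add 1).analyticOnNhd hUo
    have h2 : AnalyticOnNhd ℂ riemannZeta₁ U := differentiable_riemannZeta₁.differentiableOn.analyticOnNhd hUo
    have hmem2 : (2:ℂ) ∈ U := ⟨by simp; norm_num, by simp; linarith [norm_nonneg s]⟩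
    have hev : riemannZeta₁ =ᶠ[nhds (2:ℂ)] (fun z => 1 + ∑' n, zT n z) := by
      have : {z : ℂ | 1 < z.re} ∈ nhds (2:ℂ) := (isOpen_lt continuous_const Complex.continuous_re).mem_nhds (by simp)
      filter_upwards [this] with z hz
      rw [(zT_tsum_of_one_lt hz).tsum_eq]; ring
    exact h2.eqOn_of_preconnected_of_eventuallyEq h1 hUc.isPreconnected hmem2 hev ⟨by simp; linarith, by simp⟩
  refine ⟨1 + S, by linarith, fun s hs => ?_⟩
  rw [key s hs]
  have h1 : ‖∑' n, zT n s‖ ≤ ‖s-1‖ * ‖s‖ * S := by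
    apply tsum_of_norm_bounded ((hsm.hasSum).mul_left _)
    exact bd s (by linarith)
  have h2 : ‖s - 1‖ ≤ 1 + ‖s‖ := (norm_sub_le _ _).trans (by simp; linarith)
  have h3 := norm_nonneg s
  calc _ ≤ ‖(1:ℂ)‖ + ‖∑' n, zT n s‖ := norm_add_le _ _
    _ ≤ 1 + ‖s-1‖ * ‖s‖ * S := by rw [norm_one]; linarith
    _ ≤ 1 + (1+‖s‖) * (1+‖s‖) * S := by
        have : ‖s-1‖ * ‖s‖ ≤ (1+‖s‖) * (1+‖s‖) := mul_le_mul h2 (by linarith) h3 (by linarith)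
        nlinarith
    _ ≤ _ := by nlinarith
end

section
open Real MeasureTheory

/-! ### Landau lemma -/

lemma nonvan_logDeriv {f : ℂ → ℂ} (hf : Differentiable ℂ f) {M : ℝ} (hM : 0 < M)
    (hb : ∀ w, ‖w‖ ≤ 1 → ‖f w‖ ≤ exp M * ‖f 0‖) (hne : ∀ w, ‖w‖ ≤ 1/2 → f w ≠ 0) {z : ℂ} (hz : ‖z‖ ≤ 1/4) :
    ‖logDeriv f z‖ ≤ 100 * M := by
  have hball : ∀ w ∈ Metric.ball (0:ℂ) (1/2), f w ≠ 0 := fun w hw => hne w (by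
    rw [mem_ball_zero_iff] at hw; exact hw.le)
  have hd : DifferentiableOn ℂ (logDeriv f) (Metric.ball 0 (1/2)) := by
    have : DifferentiableOn ℂ (fun w => deriv f w / f w) (Metric.ball 0 (1/2)) :=
      (hf.deriv.differentiableOn).div hf.differentiableOn hball
    exact this
  obtain ⟨φ, hφ0, hφ⟩ := hd.isExactOn_ball.with_val_at 0 0
  have hφd : DifferentiableOn ℂ φ (Metric.ball 0 (1/2)) := fun w hw => (hφ w hw).differentiableAt.differentiableWithinAt
  have h0 : (0:ℂ) ∈ Metric.ball (0:ℂ) (1/2) := by simp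
  have hf0 : f 0 ≠ 0 := hball 0 h0
  -- f = f 0 * exp φ
  have hconst : ∀ w ∈ Metric.ball (0:ℂ) (1/2), f w * Complex.exp (-φ w) = f 0 := by
    intro w hw
    have hder : ∀ x ∈ Metric.ball (0:ℂ) (1/2), HasDerivWithinAt (fun x => f x * Complex.exp (-φ x)) 0 (Metric.ball (0:ℂ) (1/2)) x := by
      intro x hx
      have h1 := (hf x).hasDerivAt
      have h2 := ((hφ x hx).neg).cexp
      refine ((h1.mul h2).congr_deriv ?_).hasDerivWithinAt
      rw [logDeriv_apply]
      have := hball x hx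
      field_simp
      ring
    have := (convex_ball (0:ℂ) (1/2)).norm_image_sub_le_of_norm_hasDerivWithin_le (C := 0) hder (by simp) h0 hw
    rw [zero_mul, norm_le_zero_iff, sub_eq_zero] at this
    rw [this, hφ0]; simp
  have hre : Set.MapsTo φ (Metric.ball 0 (1/2)) {w | w.re ≤ M} := by
    intro w hw
    have h1 := hconst w hw
    have h2 : f w = f 0 * Complex.exp (φ w) := by
      rw [← h1, mul_assoc, ← Complex.exp_add]; simp
    have h3 := hb w (by rw [mem_ball_zero_iff] at hw; linarith)
    rw [h2, norm_mul, Complex.norm_exp, mul_comm] at h3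
    have h4 := le_of_mul_le_mul_right h3 (norm_pos_iff.2 hf0)
    exact Real.exp_le_exp.1 h4
  have hbc : ∀ w, ‖w‖ ≤ 3/8 → ‖φ w‖ ≤ 6 * M := by
    intro w hw
    have := Complex.borelCaratheodory_zero hM hφd hre (by norm_num) (z := w) (by simp; linarith) hφ0
    refine this.trans ?_
    rw [div_le_iff₀ (by linarith)]
    nlinarith
  have hcauchy := Complex.norm_deriv_le_of_forall_mem_sphere_norm_le (f := φ) (c := z) (R := 1/8) (C := 6*M) (by norm_num)
    (by
      apply DifferentiableOn.diffContOnCl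
      rw [closure_ball _ (by norm_num)]
      apply hφd.mono
      intro w hw
      rw [mem_closedBall_iff_norm] at hw
      rw [mem_ball_zero_iff]
      calc ‖w‖ = ‖(w - z) + z‖ := by ring_nf
        _ ≤ ‖w-z‖ + ‖z‖ := norm_add_le _ _
        _ < 1/2 := by linarith)
    (by
      intro w hw
      rw [mem_sphere_iff_norm] at hw
      apply hbc
      calc ‖w‖ = ‖(w - z) + z‖ := by ring_nf
        _ ≤ ‖w-z‖ + ‖z‖ := norm_add_le _ _
        _ ≤ 3/8 := by linarith)
  rw [(hφ z (by simp; linarith)).deriv] at hcauchy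
  refine hcauchy.trans ?_
  rw [div_le_iff₀ (by norm_num)]
  nlinarith

lemma blaschke {f : ℂ → ℂ} (hf : Differentiable ℂ f) {B : ℝ}
    (hb : ∀ w, ‖w‖ ≤ 1 → ‖f w‖ ≤ B) (hf0 : f 0 ≠ 0) {ρ : ℂ} (hρ : ‖ρ‖ ≤ 1/2) (hfρ : f ρ = 0) :
    ∃ g : ℂ → ℂ, Differentiable ℂ g ∧ (∀ w, ‖w‖ ≤ 1 → ‖g w‖ ≤ B) ∧ 2 * ‖f 0‖ ≤ ‖g 0‖ ∧
      (∀ w, ‖w‖ ≤ 1/2 → g w = 0 → f w = 0) ∧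
      (∀ z, ‖z‖ ≤ 1/4 → f z ≠ 0 → (logDeriv g z).re + (1/(z-ρ)).re - 1 ≤ (logDeriv f z).re) := by
  have hρ0 : ρ ≠ 0 := by rintro rfl; exact hf0 hfρ
  have hds : Differentiable ℂ (dslope f ρ) := by
    have := (Complex.differentiableOn_dslope (f := f) (s := Set.univ) (c := ρ) Filter.univ_mem).2 hf.differentiableOn
    exact differentiableOn_univ.1 this
  have hfac : ∀ w, f w = (w - ρ) * dslope f ρ w := by
    intro w
    have := sub_smul_dslope f ρ w
    rw [hfρ, sub_zero] at this
    rw [← this, smul_eq_mul]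
  set g : ℂ → ℂ := fun w => dslope f ρ w * (1 - (starRingEnd ℂ) ρ * w) with hg
  have hgd : Differentiable ℂ g := by
    apply hds.mul
    fun_prop
  have hgf : ∀ w, f w * (1 - (starRingEnd ℂ) ρ * w) = (w - ρ) * g w := by
    intro w; rw [hfac, hg]; ring
  have hcn : ‖(starRingEnd ℂ) ρ‖ = ‖ρ‖ := Complex.norm_conj _
  have hden : ∀ w, ‖w‖ ≤ 1 → 1/2 ≤ ‖1 - (starRingEnd ℂ) ρ * w‖ := by
    intro w hw
    have h1 : ‖(starRingEnd ℂ) ρ * w‖ ≤ 1/2 := by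
      rw [norm_mul, hcn]; nlinarith [norm_nonneg w, norm_nonneg ρ]
    have := norm_sub_norm_le (1:ℂ) ((starRingEnd ℂ) ρ * w)
    rw [norm_one] at this; linarith
  refine ⟨g, hgd, ?_, ?_, ?_, ?_⟩
  · intro w hw
    have hcl : DiffContOnCl ℂ g (Metric.ball 0 1) := hgd.diffContOnCl
    apply Complex.norm_le_of_forall_mem_frontier_norm_le Metric.isBounded_ball hcl (z := w)
    · intro u hu
      rw [frontier_ball _ one_ne_zero, mem_sphere_zero_iff_norm] at hu
      have h1 : ‖1 - (starRingEnd ℂ) ρ * u‖ = ‖u - ρ‖ := by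
        have h2 : (starRingEnd ℂ) u * u = 1 := by
          rw [← Complex.normSq_eq_conj_mul_self, Complex.normSq_eq_norm_sq, hu]; simp
        have h3 : 1 - (starRingEnd ℂ) ρ * u = (starRingEnd ℂ) (u - ρ) * u := by
          rw [map_sub, sub_mul, h2]
        rw [h3, norm_mul, hu, mul_one, Complex.norm_conj]
      have h4 := hgf u
      have h5 : ‖f u‖ * ‖u - ρ‖ = ‖u - ρ‖ * ‖g u‖ := by rw [← h1, ← norm_mul, h4, norm_mul, h1]
      have h6 : 0 < ‖u - ρ‖ := by rw [← h1]; linarith [hden u hu.le]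
      have h7 : ‖g u‖ = ‖f u‖ := by
        have : ‖u - ρ‖ * ‖g u‖ = ‖u - ρ‖ * ‖f u‖ := by rw [← h5]; ring
        exact mul_left_cancel₀ h6.ne' this
      rw [h7]; exact hb u hu.le
    · rw [closure_ball _ one_ne_zero]; simpa using hw
  · have h1 := hgf 0
    have h2 : ‖f 0‖ = ‖ρ‖ * ‖g 0‖ := by
      have := congrArg norm h1
      simpa using this
    rw [h2]; nlinarith [norm_nonneg (g 0)]
  · intro w hw h
    have h1 := hgf w
    rw [h, mul_zero] at h1
    rcases mul_eq_zero.1 h1 with h2 | h2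
    · exact h2
    · have := hden w (by linarith); rw [h2] at this; norm_num at this
  · intro z hz hfz
    have hz1 : ‖z‖ ≤ 1 := by linarith
    have hd0 : 1 - (starRingEnd ℂ) ρ * z ≠ 0 := by
      intro h; have := hden z hz1; rw [h] at this; norm_num at this
    have hzρ : z - ρ ≠ 0 := by
      intro h; rw [sub_eq_zero] at h; rw [h] at hfz; exact hfz hfρ
    have hgz : g z ≠ 0 := by
      intro h; have := hgf z; rw [h, mul_zero] at this
      exact (mul_ne_zero hfz hd0) this
    have e : (fun w => f w * (1 - (starRingEnd ℂ) ρ * w)) = fun w => (w - ρ) * g w := funext hgf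
    have L1 : logDeriv (fun w => f w * (1 - (starRingEnd ℂ) ρ * w)) z = logDeriv f z + logDeriv (fun w => 1 - (starRingEnd ℂ) ρ * w) z :=
      logDeriv_mul z hfz hd0 (hf z) (by fun_prop)
    have L2 : logDeriv (fun w => (w - ρ) * g w) z = logDeriv (fun w => w - ρ) z + logDeriv g z :=
      logDeriv_mul z hzρ hgz (by fun_prop) (hgd z)
    have d1 : logDeriv (fun w => 1 - (starRingEnd ℂ) ρ * w) z = - (starRingEnd ℂ) ρ / (1 - (starRingEnd ℂ) ρ * z) := by
      rw [logDeriv_apply]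
      congr 1
      have : HasDerivAt (fun w => 1 - (starRingEnd ℂ) ρ * w) (-((starRingEnd ℂ) ρ * 1)) z :=
        ((hasDerivAt_id z).const_mul _).const_sub 1
      rw [this.deriv, mul_one]
    have d2 : logDeriv (fun w => w - ρ) z = 1 / (z - ρ) := by
      rw [logDeriv_apply]; simp
    rw [e, L2, d1, d2] at L1
    have L3 : logDeriv f z = logDeriv g z + 1 / (z-ρ) + (starRingEnd ℂ) ρ / (1 - (starRingEnd ℂ) ρ * z) := by
      linear_combination -L1
    have b1 : ‖(starRingEnd ℂ) ρ / (1 - (starRingEnd ℂ) ρ * z)‖ ≤ 1 := by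
      rw [norm_div, hcn, div_le_one (by linarith [hden z hz1])]
      linarith [hden z hz1]
    have b2 := (abs_le.1 ((Complex.abs_re_le_norm _).trans b1)).1
    rw [L3, Complex.add_re, Complex.add_re]
    linarith

lemma landau_aux {M : ℝ} (hM : 0 < M) {B : ℝ} {z : ℂ} (hz : ‖z‖ ≤ 1/4) : ∀ (n : ℕ) (f : ℂ → ℂ), Differentiable ℂ f → f 0 ≠ 0 →
    (∀ w, ‖w‖ ≤ 1 → ‖f w‖ ≤ B) → B ≤ exp M * ‖f 0‖ → B < 2^n * ‖f 0‖ →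
    (∀ ρ, ‖ρ‖ ≤ 1/2 → f ρ = 0 → ρ.re < z.re) → -(100 * M) - n ≤ (logDeriv f z).re := by
  intro n
  induction n with
  | zero =>
    intro f hf hf0 hb _ h2 _
    have := hb 0 (by simp)
    simp at h2; linarith
  | succ n ih =>
    intro f hf hf0 hb hB h2 hzero
    by_cases h : ∀ w, ‖w‖ ≤ 1/2 → f w ≠ 0
    · have := nonvan_logDeriv hf hM (fun w hw => (hb w hw).trans hB) h hz
      have := (abs_le.1 ((Complex.abs_re_le_norm _).trans this)).1
      push_cast
      have : (0:ℝ) ≤ n := Nat.cast_nonneg _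
      linarith
    · push Not at h
      obtain ⟨ρ, hρ, hfρ⟩ := h
      obtain ⟨g, hgd, hgb, hg0, hgz, hgl⟩ := blaschke hf hb hf0 hρ hfρ
      have hp := norm_pos_iff.2 hf0
      have hfz : f z ≠ 0 := by
        intro h; have := hzero z (by linarith) h; linarith
      have h1 := hgl z hz hfz
      have h3 := ih g hgd (norm_pos_iff.1 (by linarith)) hgb (hB.trans (by gcongr; linarith))
        (by rw [pow_succ] at h2; calc B < _ := h2
              _ = 2^n * (2 * ‖f 0‖) := by ring
              _ ≤ _ := by gcongr)
        (fun r hr hr0 => hzero r hr (hgz r hr hr0))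
      have h4 : 0 ≤ (1/(z-ρ)).re := by
        rw [one_div, Complex.inv_re]
        apply div_nonneg _ (Complex.normSq_nonneg _)
        have := hzero ρ hρ hfρ
        simp; linarith
      push_cast; linarith

lemma landau1 {M : ℝ} (hM : 1 ≤ M) {z : ℂ} (hz : ‖z‖ ≤ 1/4) {f : ℂ → ℂ} (hf : Differentiable ℂ f) (hf0 : f 0 ≠ 0)
    (hb : ∀ w, ‖w‖ ≤ 1 → ‖f w‖ ≤ exp M * ‖f 0‖)
    (hzero : ∀ ρ, ‖ρ‖ ≤ 1/2 → f ρ = 0 → ρ.re < z.re) : -(103 * M) ≤ (logDeriv f z).re := by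
  set n := ⌊2*M⌋₊ + 1 with hn
  have hn1 : 2 * M < n := by rw [hn]; push_cast; exact Nat.lt_floor_add_one _
  have hn2 : (n:ℝ) ≤ 2 * M + 1 := by rw [hn]; push_cast; linarith [Nat.floor_le (show 0 ≤ 2 * M by linarith)]
  have hp := norm_pos_iff.2 hf0
  have h2 : exp M < 2^n := by
    rw [← Real.exp_log (show (0:ℝ) < 2^n by positivity), Real.exp_lt_exp, Real.log_pow]
    have := Real.log_two_gt_d9
    nlinarith
  have := landau_aux (by linarith) hz n f hf hf0 hb (le_refl _) (by gcongr) hzero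
  linarith

lemma landau2 {M : ℝ} (hM : 1 ≤ M) {z : ℂ} (hz : ‖z‖ ≤ 1/4) {f : ℂ → ℂ} (hf : Differentiable ℂ f) (hf0 : f 0 ≠ 0)
    (hb : ∀ w, ‖w‖ ≤ 1 → ‖f w‖ ≤ exp M * ‖f 0‖)
    (hzero : ∀ ρ, ‖ρ‖ ≤ 1/2 → f ρ = 0 → ρ.re < z.re) {ρ : ℂ} (hρ : ‖ρ‖ ≤ 1/2) (hfρ : f ρ = 0) :
    (1/(z-ρ)).re -(104 * M) ≤ (logDeriv f z).re := by
  obtain ⟨g, hgd, hgb, hg0, hgz, hgl⟩ := blaschke hf hb hf0 hρ hfρ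
  have hp := norm_pos_iff.2 hf0
  have hfz : f z ≠ 0 := by
    intro h; have := hzero z (by linarith) h; linarith
  have h1 := hgl z hz hfz
  have h3 := landau1 hM hz hgd (norm_pos_iff.1 (by linarith)) (fun w hw => (hgb w hw).trans (by gcongr; linarith))
    (fun r hr hr0 => hzero r hr (hgz r hr hr0))
  linarith
end

section
open Real MeasureTheory

/-! ### Zero-free region -/

lemma zeta1_ne_zero {s : ℂ} (hs : 1 ≤ s.re) : riemannZeta₁ s ≠ 0 := by
  by_cases h : s = 1
  · rw [h, riemannZeta₁_one]; exact one_ne_zero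
  · have := riemannZeta_ne_zero_of_one_le_re hs
    rw [riemannZeta_eq_inv_sub_mul h] at this
    exact right_ne_zero_of_mul this

lemma zeta1_lower : ∃ C : ℝ, 1 ≤ C ∧ ∀ s : ℂ, 1 < s.re → s.re ≤ 2 → (s.re - 1)^2 / C ≤ ‖riemannZeta₁ s‖ := by
  obtain ⟨C, hC1, hC⟩ := zeta1_bound
  refine ⟨C * 9, by linarith, fun s hs hs2 => ?_⟩
  have hs1 : s ≠ 1 := by rintro rfl; simp at hs
  have hsub : s - 1 ≠ 0 := sub_ne_zero.2 hs1
  have hz : riemannZeta₁ s = (s-1) * riemannZeta s := by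
    rw [riemannZeta_eq_inv_sub_mul hs1]; field_simp
  -- the inverse
  have hmul := ArithmeticFunction.LSeries_zeta_mul_Lseries_moebius hs
  rw [ArithmeticFunction.LSeries_zeta_eq_riemannZeta hs] at hmul
  have hb : ‖LSeries (fun n => ((ArithmeticFunction.moebius n : ℤ) : ℂ)) s‖ ≤ ‖riemannZeta (s.re : ℂ)‖ := by
    have hσ : 1 < ((s.re : ℂ)).re := by simpa using hs
    have h1 := LSeriesHasSum_one hσ
    unfold LSeriesHasSum at h1
    have h2 : HasSum (fun n => ‖LSeries.term 1 (s.re:ℂ) n‖) (riemannZeta (s.re:ℂ)).re := by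
      have h3 := (Complex.hasSum_re h1)
      refine h3.congr_fun fun n => ?_
      rcases eq_or_ne n 0 with rfl | hn
      · simp
      · rw [LSeries.term_of_ne_zero hn, norm_div, Complex.norm_natCast_cpow_of_pos (Nat.pos_of_ne_zero hn)]
        have : ((n:ℂ)^(s.re:ℂ)) = (((n:ℝ)^s.re : ℝ) : ℂ) := by
          rw [Complex.ofReal_cpow (Nat.cast_nonneg _)]; simp
        rw [this]
        simp only [Pi.one_apply, norm_one, Complex.ofReal_re]
        rw [show (1:ℂ) / (((n:ℝ)^s.re : ℝ) : ℂ) = ((1 / (n:ℝ)^s.re : ℝ) : ℂ) by push_cast; ring, Complex.ofReal_re]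
    have h4 : ‖LSeries (fun n => ((ArithmeticFunction.moebius n : ℤ) : ℂ)) s‖ ≤ (riemannZeta (s.re:ℂ)).re := by
      apply tsum_of_norm_bounded h2
      intro n
      rw [LSeries.norm_term_eq, LSeries.norm_term_eq]
      split_ifs
      · exact le_refl _
      · simp only [Complex.ofReal_re, Pi.one_apply, norm_one]
        gcongr
        have := ArithmeticFunction.abs_moebius_le_one (n := n)
        rw [Complex.norm_intCast]
        exact_mod_cast this
    exact h4.trans (Complex.re_le_norm _)
  have hσ1 : (s.re : ℂ) ≠ 1 := by
    intro h; have := congrArg Complex.re h; simp at this; linarith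
  have hzσ : ‖riemannZeta (s.re : ℂ)‖ ≤ C * 9 / (s.re - 1) := by
    rw [riemannZeta_eq_inv_sub_mul hσ1, norm_mul, norm_inv]
    have h1 : ‖(s.re:ℂ) - 1‖ = s.re - 1 := by
      rw [← Complex.ofReal_one, ← Complex.ofReal_sub, Complex.norm_real, Real.norm_eq_abs, abs_of_pos (by linarith)]
    have h2 := hC (s.re:ℂ) (by simp; linarith)
    have h3 : ‖(s.re:ℂ)‖ ≤ 2 := by
      rw [Complex.norm_real, Real.norm_eq_abs, abs_of_pos (by linarith)]; exact hs2
    rw [h1, inv_mul_eq_div]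
    apply div_le_div_of_nonneg_right _ (by linarith)
    refine h2.trans ?_
    have h4 := norm_nonneg (s.re:ℂ)
    apply mul_le_mul_of_nonneg_left _ (by linarith)
    nlinarith
  have h5 : 1 ≤ ‖riemannZeta s‖ * (C * 9 / (s.re - 1)) := by
    calc (1:ℝ) = ‖riemannZeta s * LSeries (fun n => ((ArithmeticFunction.moebius n : ℤ) : ℂ)) s‖ := by rw [hmul, norm_one]
      _ = ‖riemannZeta s‖ * ‖LSeries (fun n => ((ArithmeticFunction.moebius n : ℤ) : ℂ)) s‖ := norm_mul _ _
      _ ≤ _ := mul_le_mul_of_nonneg_left (hb.trans hzσ) (norm_nonneg _)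
  have hp : 0 < s.re - 1 := by linarith
  have h6 : (s.re - 1) / (C*9) ≤ ‖riemannZeta s‖ := by
    rw [div_le_iff₀ (by linarith)]
    rw [mul_div_assoc', le_div_iff₀ hp] at h5
    linarith
  have h7 : s.re - 1 ≤ ‖s - 1‖ := by
    have := Complex.re_le_norm (s-1); simpa using this
  rw [hz, norm_mul]
  calc (s.re-1)^2 / (C*9) = (s.re - 1) * ((s.re - 1) / (C*9)) := by ring
    _ ≤ _ := mul_le_mul h7 h6 (by positivity) (norm_nonneg _)

noncomputable def LL (t : ℝ) : ℝ := log (|t| + 3)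

lemma LL_ge_one (t : ℝ) : 1 ≤ LL t := by
  have h : exp 1 ≤ |t| + 3 := by have := Real.exp_one_lt_d9; linarith [abs_nonneg t]
  have := Real.log_le_log (Real.exp_pos 1) h
  rwa [Real.log_exp] at this

lemma logDeriv_scale (s0 : ℂ) (r : ℂ) (w : ℂ) :
    logDeriv (fun w => riemannZeta₁ (s0 + r * w)) w = r * logDeriv riemannZeta₁ (s0 + r * w) := by
  have h1 : HasDerivAt (fun w : ℂ => s0 + r * w) (r * 1) w := ((hasDerivAt_id w).const_mul r).const_add s0
  have h2 := (differentiable_riemannZeta₁ (s0 + r * w)).hasDerivAt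
  have h3 := HasDerivAt.comp w h2 h1
  rw [logDeriv_apply, logDeriv_apply]
  have : deriv (fun w => riemannZeta₁ (s0 + r * w)) w = deriv riemannZeta₁ (s0 + r * w) * (r * 1) := h3.deriv
  rw [this]; ring

lemma zeta1_landau : ∃ A : ℝ, 1 ≤ A ∧ ∀ t σ : ℝ, 1 < σ → σ ≤ 6/5 →
    -(A * LL t) ≤ (logDeriv riemannZeta₁ (σ + t * Complex.I)).re ∧
    ∀ β : ℝ, 9/10 ≤ β → riemannZeta₁ (β + t * Complex.I) = 0 → 1/(σ - β) - A * LL t ≤ (logDeriv riemannZeta₁ (σ + t * Complex.I)).re := by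
  obtain ⟨C, hC1, hC⟩ := zeta1_bound
  obtain ⟨C1, hC11, hC1l⟩ := zeta1_lower
  set D := log (100 * C * C1) with hD
  have hD0 : 0 ≤ D := Real.log_nonneg (by nlinarith)
  refine ⟨200 * (D + 2), by linarith, fun t σ hσ hσ2 => ?_⟩
  set L := LL t with hL
  have hL1 : 1 ≤ L := LL_ge_one t
  set s0 : ℂ := (11/10 : ℝ) + t * Complex.I with hs0
  set f : ℂ → ℂ := fun w => riemannZeta₁ (s0 + (3/5 : ℝ) * w) with hf
  set M := D + 2 * L with hM
  have hfd : Differentiable ℂ f := by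
    apply differentiable_riemannZeta₁.comp; fun_prop
  have hs0re : s0.re = 11/10 := by simp [hs0]
  have hf0n : 1 / (100 * C1) ≤ ‖f 0‖ := by
    have := hC1l s0 (by rw [hs0re]; norm_num) (by rw [hs0re]; norm_num)
    simp only [hf, mul_zero, add_zero]
    refine le_trans (le_of_eq ?_) this
    rw [hs0re]; field_simp; norm_num
  have hf0 : f 0 ≠ 0 := by
    rw [← norm_pos_iff]; refine lt_of_lt_of_le (by positivity) hf0n
  have hs0n : ‖s0‖ ≤ 11/10 + |t| := by
    refine (norm_add_le _ _).trans ?_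
    rw [norm_mul, Complex.norm_I, mul_one, Complex.norm_real, Complex.norm_real, Real.norm_eq_abs, Real.norm_eq_abs]
    rw [abs_of_pos (by norm_num : (0:ℝ) < 11/10)]
  have hwn : ∀ w : ℂ, ‖((3/5:ℝ):ℂ) * w‖ = 3/5 * ‖w‖ := by
    intro w; rw [norm_mul, Complex.norm_real, Real.norm_eq_abs, abs_of_pos (by norm_num)]
  have hb : ∀ w, ‖w‖ ≤ 1 → ‖f w‖ ≤ exp M * ‖f 0‖ := by
    intro w hw
    have h1 : (s0 + (3/5:ℝ) * w).re ≥ 1/2 := by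
      rw [Complex.add_re, hs0re]
      have := (abs_le.1 ((Complex.abs_re_le_norm _).trans (hwn w).le)).1
      linarith
    have h2 : ‖s0 + (3/5:ℝ) * w‖ ≤ 17/10 + |t| := by
      refine (norm_add_le _ _).trans ?_
      rw [hwn]; linarith
    have h3 := hC _ h1
    have h4 : exp M = 100 * C * C1 * (|t|+3)^2 := by
      rw [hM, Real.exp_add, hD, Real.exp_log (by positivity), hL, LL]
      rw [mul_comm 2, Real.exp_mul, Real.exp_log (by positivity)]
      norm_num
    have h5 := norm_nonneg (s0 + (3/5:ℝ) * w)
    calc ‖f w‖ ≤ C * (1 + ‖s0 + (3/5:ℝ) * w‖)^2 := h3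
      _ ≤ C * (|t| + 3)^2 := mul_le_mul_of_nonneg_left (pow_le_pow_left₀ (by linarith) (by linarith) 2) (by linarith)
      _ = exp M * (1/(100*C1)) := by rw [h4]; field_simp
      _ ≤ _ := by gcongr
  set z : ℂ := (((σ - 11/10) / (3/5) : ℝ) : ℂ) with hz
  have hzn : ‖z‖ ≤ 1/4 := by
    rw [hz, Complex.norm_real, Real.norm_eq_abs, abs_le]
    constructor
    · rw [le_div_iff₀ (by norm_num)]; linarith
    · rw [div_le_iff₀ (by norm_num)]; linarith
  have hzs : s0 + (3/5:ℝ) * z = σ + t * Complex.I := by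
    rw [hs0, hz]; push_cast; ring
  have hzre : z.re = (σ - 11/10)/(3/5) := by rw [hz, Complex.ofReal_re]
  have hzero : ∀ ρ, ‖ρ‖ ≤ 1/2 → f ρ = 0 → ρ.re < z.re := by
    intro ρ _ h
    by_contra hcon
    push Not at hcon
    apply zeta1_ne_zero _ h
    rw [Complex.add_re, hs0re, Complex.re_ofReal_mul]
    rw [hzre, div_le_iff₀ (by norm_num)] at hcon
    linarith
  have hM1 : 1 ≤ M := by linarith
  have hMA : 104 * M * (5/3) ≤ 200 * (D+2) * L := by
    rw [hM]; nlinarith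
  have hld : (logDeriv f z).re = 3/5 * (logDeriv riemannZeta₁ (σ + t * Complex.I)).re := by
    rw [hf, logDeriv_scale, hzs, Complex.re_ofReal_mul]
  constructor
  · have := landau1 hM1 hzn hfd hf0 hb hzero
    rw [hld] at this
    linarith
  · intro β hβ hβ0
    have hβ1 : β < 1 := by
      by_contra h; push Not at h
      exact zeta1_ne_zero (s := β + t * Complex.I) (by simpa using h) hβ0
    set ρ : ℂ := (((β - 11/10) / (3/5) : ℝ) : ℂ) with hρ
    have hρn : ‖ρ‖ ≤ 1/2 := by
      rw [hρ, Complex.norm_real, Real.norm_eq_abs, abs_le]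
      constructor
      · rw [le_div_iff₀ (by norm_num)]; linarith
      · rw [div_le_iff₀ (by norm_num)]; linarith
    have hρs : s0 + (3/5:ℝ) * ρ = β + t * Complex.I := by
      rw [hs0, hρ]; push_cast; ring
    have := landau2 hM1 hzn hfd hf0 hb hzero hρn (by rw [hf]; simp only; rw [hρs]; exact hβ0)
    rw [hld] at this
    have e : (1 / (z - ρ)).re = 3/5 * (1/(σ-β)) := by
      have : 1 / (z - ρ) = ((3/5 * (1/(σ-β)) : ℝ) : ℂ) := by
        rw [hz, hρ]
        have : (σ:ℂ) - β ≠ 0 := by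
          rw [← Complex.ofReal_sub]; exact Complex.ofReal_ne_zero.2 (by linarith)
        rw [← Complex.ofReal_sub, ← Complex.ofReal_one, ← Complex.ofReal_div]
        congr 1
        have : σ - β ≠ 0 := by linarith
        have e2 : (σ - 11/10) / (3/5) - (β - 11/10)/(3/5) = (σ - β) / (3/5) := by ring
        rw [e2]; field_simp
      rw [this, Complex.ofReal_re]
    rw [e] at this
    linarith
end

section
open Real MeasureTheory

noncomputable def LV (s : ℂ) : ℂ := LSeries (fun n => ((ArithmeticFunction.vonMangoldt n : ℝ) : ℂ)) s

lemma LV_eq {s : ℂ} (hs : 1 < s.re) : LV s = 1/(s-1) - logDeriv riemannZeta₁ s := by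
  have hs1 : s ≠ 1 := by rintro rfl; simp at hs
  have hsub : s - 1 ≠ 0 := sub_ne_zero.2 hs1
  have hz := zeta1_ne_zero hs.le
  rw [LV, ArithmeticFunction.LSeries_vonMangoldt_eq_deriv_riemannZeta_div hs, deriv_riemannZeta_eq_neg_inv_sub_sq_mul_add hs1,
    riemannZeta_eq_inv_sub_mul hs1, logDeriv_apply]
  field_simp
  ring

lemma LV_hasSum {s : ℂ} (hs : 1 < s.re) : HasSum (LSeries.term (fun n => ((ArithmeticFunction.vonMangoldt n : ℝ) : ℂ)) s) (LV s) :=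
  (ArithmeticFunction.LSeriesSummable_vonMangoldt hs).hasSum

lemma term_vM (σ t : ℝ) (n : ℕ) (hn : n ≠ 0) : LSeries.term (fun n => ((ArithmeticFunction.vonMangoldt n : ℝ) : ℂ)) (σ + t * Complex.I) n
    = ((ArithmeticFunction.vonMangoldt n * (n:ℝ)^(-σ) : ℝ) : ℂ) * Complex.exp (-((t * log n : ℝ) * Complex.I)) := by
  rw [LSeries.term_of_ne_zero hn]
  have hn0 : (n:ℂ) ≠ 0 := Nat.cast_ne_zero.2 hn
  rw [Complex.cpow_add _ _ hn0, div_eq_mul_inv, mul_inv, ← Complex.cpow_neg, ← Complex.cpow_neg]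
  have h1 : (n:ℂ)^(-(σ:ℂ)) = (((n:ℝ)^(-σ) : ℝ) : ℂ) := by
    rw [Complex.ofReal_cpow (Nat.cast_nonneg _)]; simp
  have h2 : (n:ℂ)^(-((t:ℂ) * Complex.I)) = Complex.exp (-((t * log n : ℝ) * Complex.I)) := by
    rw [Complex.cpow_def_of_ne_zero hn0, ← Complex.natCast_log]
    congr 1; push_cast; ring
  rw [h1, h2]; push_cast; ring

lemma three_four_one {σ : ℝ} (hσ : 1 < σ) (t : ℝ) :
    0 ≤ 3 * (LV σ).re + 4 * (LV (σ + t * Complex.I)).re + (LV (σ + (2*t : ℝ) * Complex.I)).re := by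
  have h0 := Complex.hasSum_re (LV_hasSum (s := σ + (0:ℝ) * Complex.I) (by simpa using hσ))
  have h1 := Complex.hasSum_re (LV_hasSum (s := σ + t * Complex.I) (by simpa using hσ))
  have h2 := Complex.hasSum_re (LV_hasSum (s := σ + (2*t : ℝ) * Complex.I) (by simpa using hσ))
  have h := ((h0.mul_left 3).add (h1.mul_left 4)).add h2
  have e : (σ:ℂ) + (0:ℝ) * Complex.I = σ := by simp
  rw [e] at h
  refine h.nonneg fun n => ?_
  rcases eq_or_ne n 0 with rfl | hn
  · simp
  have t0 := term_vM σ 0 n hn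
  rw [e] at t0
  rw [t0, term_vM σ t n hn, term_vM σ (2*t) n hn]
  simp only [Complex.re_ofReal_mul]
  have hr : ∀ x : ℝ, (Complex.exp (-((x:ℝ) * Complex.I))).re = Real.cos x := by
    intro x
    rw [← neg_mul, ← Complex.ofReal_neg, Complex.exp_ofReal_mul_I_re, Real.cos_neg]
  rw [hr, hr, hr, show 2 * t * log n = 2 * (t * log n) by ring, Real.cos_two_mul]
  have ha : 0 ≤ ArithmeticFunction.vonMangoldt n * (n:ℝ)^(-σ) := mul_nonneg ArithmeticFunction.vonMangoldt_nonneg (by positivity)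
  simp
  nlinarith [mul_nonneg ha (sq_nonneg (1 + Real.cos (t * log n)))]

lemma zero_free_large : ∃ κ : ℝ, 0 < κ ∧ κ ≤ 1/10 ∧ ∀ t β : ℝ, 1 ≤ |t| → 1 - κ / LL t ≤ β → riemannZeta₁ (β + t * Complex.I) ≠ 0 := by
  obtain ⟨A, hA1, hA⟩ := zeta1_landau
  refine ⟨1/(15 * (14 * A)), by positivity, ?_, ?_⟩
  · rw [div_le_iff₀ (by positivity)]; linarith
  intro t β ht hβ h0
  set L := LL t with hL
  have hL1 : 1 ≤ L := LL_ge_one t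
  set A' := 14 * A with hA'
  have hAL : 14 ≤ A' * L := by nlinarith
  have hβ1 : β < 1 := by
    by_contra h; push Not at h
    exact zeta1_ne_zero (s := β + t * Complex.I) (by simpa using h) h0
  have hκ : 1 / (15 * A') / L = 1 / (15 * (A' * L)) := by rw [div_div, mul_assoc]
  rw [hκ] at hβ
  have hβ9 : 9/10 ≤ β := by
    have : 1 / (15 * (A' * L)) ≤ 1/10 := one_div_le_one_div_of_le (by norm_num) (by linarith)
    linarith
  set σ := 1 + 1 / (2 * (A' * L)) with hσ
  have hσ1 : 1 < σ := by
    have : 0 < 1 / (2 * (A' * L)) := by positivity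
    linarith
  have hσ2 : σ ≤ 6/5 := by
    have : 1 / (2 * (A' * L)) ≤ 1/5 := one_div_le_one_div_of_le (by norm_num) (by linarith)
    linarith
  have h341 := three_four_one hσ1 t
  rw [LV_eq (s := σ) (by simpa using hσ1), LV_eq (s := σ + t * Complex.I) (by simpa using hσ1), LV_eq (s := σ + (2*t : ℝ) * Complex.I) (by simpa using hσ1)] at h341
  simp only [Complex.sub_re] at h341
  have g0 := (hA 0 σ hσ1 hσ2).1
  have g1 := (hA t σ hσ1 hσ2).2 β hβ9 h0
  have g2 := (hA (2*t) σ hσ1 hσ2).1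
  have e0 : (σ:ℂ) + (0:ℝ) * Complex.I = σ := by simp
  rw [e0] at g0
  have hL0 : LL 0 ≤ L := by
    rw [hL, LL, LL]; apply Real.log_le_log (by simp) (by simp)
  have hL2 : LL (2*t) ≤ 2 * L := by
    have : LL (2*t) ≤ log ((|t|+3)^2) := by
      rw [LL]; apply Real.log_le_log (by positivity)
      rw [abs_mul, abs_two]; nlinarith
    rw [Real.log_pow] at this
    push_cast at this
    rw [hL]; exact this
  have k0 : (1/((σ:ℂ) - 1)).re = 2 * (A' * L) := by
    have : (1/((σ:ℂ) - 1)) = ((1 / (σ - 1) : ℝ) : ℂ) := by push_cast; ring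
    rw [this, Complex.ofReal_re, hσ, add_sub_cancel_left, one_div_one_div]
  have kk : ∀ u : ℝ, 1 ≤ |u| → (1/((σ:ℂ) + u * Complex.I - 1)).re ≤ 1 := by
    intro u hu
    refine (Complex.re_le_norm _).trans ?_
    rw [norm_div, norm_one]
    have h1 : 1 ≤ ‖(σ:ℂ) + u * Complex.I - 1‖ := by
      have := Complex.abs_im_le_norm ((σ:ℂ) + u * Complex.I - 1)
      simp at this; linarith
    exact (div_le_one (by linarith)).2 h1
  have k1 := kk t ht
  have k2 := kk (2*t) (by rw [abs_mul, abs_two]; linarith)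
  rw [k0] at h341
  have m0 : A * LL 0 ≤ A * L := by gcongr
  have m2 : A * LL (2*t) ≤ A * (2 * L) := by gcongr
  have f1 : 4 * (1/(σ-β)) ≤ 7 * (A' * L) := by
    have : 1 ≤ A * L := by nlinarith
    have : A' * L = 14 * (A * L) := by rw [hA']; ring
    linarith
  have hσβ : 0 < σ - β := by linarith
  rw [mul_one_div, div_le_iff₀ hσβ] at f1
  have f2 : σ - β ≤ 1 / (2 * (A' * L)) + 1 / (15 * (A' * L)) := by rw [hσ]; linarith
  have f3 : 7 * (A' * L) * (σ - β) ≤ 7 * (A' * L) * (1 / (2 * (A' * L)) + 1 / (15 * (A' * L))) :=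
    mul_le_mul_of_nonneg_left f2 (by positivity)
  have f4 : 7 * (A' * L) * (1 / (2 * (A' * L)) + 1 / (15 * (A' * L))) = 7/2 + 7/15 := by
    have hq : A' * L ≠ 0 := by positivity
    generalize A' * L = q at hq
    field_simp
    try norm_num
  rw [f4] at f3
  linarith

lemma zero_free : ∃ κ : ℝ, 0 < κ ∧ κ ≤ 1/10 ∧ ∀ s : ℂ, 1 - κ / LL s.im ≤ s.re → riemannZeta₁ s ≠ 0 := by
  obtain ⟨κ, hκ0, hκ1, hκ⟩ := zero_free_large
  have hK : IsCompact ((fun t : ℝ => (1:ℂ) + t * Complex.I) '' Set.Icc (-1) 1) :=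
    isCompact_Icc.image (by fun_prop)
  have hO : IsOpen {s : ℂ | riemannZeta₁ s ≠ 0} := isOpen_ne_fun differentiable_riemannZeta₁.continuous continuous_const
  have hKO : ((fun t : ℝ => (1:ℂ) + t * Complex.I) '' Set.Icc (-1) 1) ⊆ {s : ℂ | riemannZeta₁ s ≠ 0} := by
    rintro _ ⟨t, _, rfl⟩
    exact zeta1_ne_zero (by simp)
  obtain ⟨ε, hε, hsub⟩ := hK.exists_thickening_subset_open hO hKO
  refine ⟨min κ (ε/2), lt_min hκ0 (by linarith), (min_le_left _ _).trans hκ1, fun s hs => ?_⟩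
  have hL1 := LL_ge_one s.im
  by_cases h1 : 1 ≤ s.re
  · exact zeta1_ne_zero h1
  push Not at h1
  by_cases ht : 1 ≤ |s.im|
  · have := hκ s.im s.re ht (by
      refine le_trans ?_ hs
      have : min κ (ε/2) / LL s.im ≤ κ / LL s.im := by gcongr; exact min_le_left _ _
      linarith)
    rwa [Complex.re_add_im] at this
  · push Not at ht
    apply hsub
    rw [Metric.mem_thickening_iff]
    refine ⟨1 + s.im * Complex.I, ⟨s.im, abs_le.1 ht.le, rfl⟩, ?_⟩
    rw [dist_eq_norm]
    have e : s - (1 + s.im * Complex.I) = ((s.re - 1 : ℝ) : ℂ) := by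
      apply Complex.ext <;> simp
    rw [e, Complex.norm_real, Real.norm_eq_abs, abs_of_neg (by linarith)]
    have : min κ (ε/2) / LL s.im ≤ ε/2 := by
      calc _ ≤ min κ (ε/2) / 1 := by gcongr
        _ ≤ _ := by rw [div_one]; exact min_le_right _ _
    linarith

lemma logDeriv_bound : ∃ κ C : ℝ, 0 < κ ∧ κ ≤ 1/10 ∧ 0 < C ∧ ∀ T : ℝ, 1 ≤ T → ∀ s : ℂ, |s.im| ≤ T → 1 - κ / LL T ≤ s.re →
    riemannZeta₁ s ≠ 0 ∧ (s.re ≤ 1 + κ / LL T → ‖logDeriv riemannZeta₁ s‖ ≤ C * LL T ^ 2) := by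
  obtain ⟨κ0, hκ0, hκ1, hκ⟩ := zero_free
  obtain ⟨C, hC1, hC⟩ := zeta1_bound
  obtain ⟨C1, hC11, hC1l⟩ := zeta1_lower
  set κ := κ0 / 12 with hκdef
  have hκp : 0 < κ := by positivity
  set D := log (4 * C * C1 / κ^2) with hD
  have hκ2 : κ^2 ≤ 1 := by nlinarith
  have hD0 : 0 ≤ D := Real.log_nonneg (by
    rw [le_div_iff₀ (by positivity)]; nlinarith)
  refine ⟨κ, 100 * (D + 4) / (8 * κ), hκp, by linarith, by positivity, fun T hT s him hre => ?_⟩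
  set L := LL T with hL
  have hL1 : 1 ≤ L := LL_ge_one T
  have hTabs : |T| = T := abs_of_pos (by linarith)
  have hLL : ∀ u : ℝ, |u| ≤ T + 1 → LL u ≤ 2 * L := by
    intro u hu
    have : LL u ≤ log ((T+3)^2) := by
      rw [LL]; apply Real.log_le_log (by positivity); nlinarith
    rw [Real.log_pow] at this
    have e : L = log (T+3) := by rw [hL, LL, hTabs]
    rw [e]; exact_mod_cast this
  have zf : ∀ w : ℂ, |w.im| ≤ T + 1 → 1 - 6 * κ / L ≤ w.re → riemannZeta₁ w ≠ 0 := by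
    intro w hw1 hw2
    apply hκ
    refine le_trans ?_ hw2
    have h1 := hLL _ hw1
    have h2 : κ0 / (2 * L) ≤ κ0 / LL w.im := by
      apply div_le_div_of_nonneg_left hκ0.le (by linarith [LL_ge_one w.im]) h1
    have h3 : κ0 / (2 * L) = 6 * κ / L := by rw [hκdef]; field_simp; norm_num
    linarith
  have hκL : 0 < κ / L := by positivity
  have hκL1 : κ / L ≤ 1/100 := by
    rw [div_le_iff₀ (by linarith)]; nlinarith
  have h6 : 6 * κ / L = 6 * (κ / L) := by ring
  refine ⟨zf s (by linarith) (by rw [h6]; linarith), fun hre2 => ?_⟩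
  set s0 : ℂ := ((1 + κ / L : ℝ) : ℂ) + s.im * Complex.I with hs0
  set r : ℝ := 8 * (κ / L) with hr
  have hr0 : 0 < r := by positivity
  set f : ℂ → ℂ := fun w => riemannZeta₁ (s0 + (r:ℂ) * w) with hf
  set M := D + 4 * L with hM
  have hfd : Differentiable ℂ f := by
    apply differentiable_riemannZeta₁.comp; fun_prop
  have hs0re : s0.re = 1 + κ / L := by simp [hs0]
  have hs0im : s0.im = s.im := by simp [hs0]
  have hwn : ∀ w : ℂ, ‖(r:ℂ) * w‖ = r * ‖w‖ := by
    intro w; rw [norm_mul, Complex.norm_real, Real.norm_eq_abs, abs_of_pos hr0]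
  have hf0n : (κ / L)^2 / C1 ≤ ‖f 0‖ := by
    have := hC1l s0 (by rw [hs0re]; linarith) (by rw [hs0re]; linarith)
    simp only [hf, mul_zero, add_zero]
    refine le_trans (le_of_eq ?_) this
    rw [hs0re]; ring
  have hs0n : ‖s0‖ ≤ 101/100 + T := by
    refine (norm_add_le _ _).trans ?_
    rw [norm_mul, Complex.norm_I, mul_one, Complex.norm_real, Complex.norm_real, Real.norm_eq_abs, Real.norm_eq_abs]
    rw [abs_of_pos (by linarith)]; linarith
  have hb : ∀ w, ‖w‖ ≤ 1 → ‖f w‖ ≤ exp M * ‖f 0‖ := by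
    intro w hw
    have hrw : r * ‖w‖ ≤ 8/100 := by nlinarith [norm_nonneg w]
    have h1 : (s0 + (r:ℂ) * w).re ≥ 1/2 := by
      rw [Complex.add_re, hs0re]
      have := (abs_le.1 ((Complex.abs_re_le_norm _).trans (hwn w).le)).1
      linarith
    have h2 : ‖s0 + (r:ℂ) * w‖ ≤ 2 + T := by
      refine (norm_add_le _ _).trans ?_
      rw [hwn]; linarith
    have h3 := hC _ h1
    have h4 : 4 * C * C1 / κ^2 * (T+3)^2 * L^2 ≤ exp M := by
      have e1 : exp L = T + 3 := by rw [hL, LL, hTabs, Real.exp_log (by linarith)]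
      have e2 : exp M = 4 * C * C1 / κ^2 * (exp L ^2 * exp L^2) := by
        rw [hM, Real.exp_add, hD, Real.exp_log (by positivity), ← pow_add, ← Real.exp_nat_mul]; norm_num
      have e3 : L ≤ exp L := by linarith [Real.add_one_le_exp L]
      rw [e2, ← e1, mul_assoc]
      apply mul_le_mul_of_nonneg_left _ (by positivity)
      apply mul_le_mul_of_nonneg_left _ (by positivity)
      exact pow_le_pow_left₀ (by linarith) e3 2
    have h5 := norm_nonneg (s0 + (r:ℂ) * w)
    calc ‖f w‖ ≤ C * (1 + ‖s0 + (r:ℂ) * w‖)^2 := h3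
      _ ≤ C * (T + 3)^2 := mul_le_mul_of_nonneg_left (pow_le_pow_left₀ (by linarith) (by linarith) 2) (by linarith)
      _ ≤ 4 * (C * (T+3)^2) := by nlinarith [show 0 ≤ C * (T+3)^2 by positivity]
      _ = (4 * C * C1 / κ^2 * (T+3)^2 * L^2) * ((κ / L)^2 / C1) := by field_simp
      _ ≤ exp M * ‖f 0‖ := mul_le_mul h4 hf0n (by positivity) (by positivity)
  set z : ℂ := (((s.re - (1 + κ/L)) / r : ℝ) : ℂ) with hz
  have hzn : ‖z‖ ≤ 1/4 := by
    rw [hz, Complex.norm_real, Real.norm_eq_abs, abs_le]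
    constructor
    · rw [le_div_iff₀ hr0]; linarith
    · rw [div_le_iff₀ hr0]; linarith
  have hzs : s0 + (r:ℂ) * z = s := by
    rw [hs0, hz]
    have : (r:ℂ) ≠ 0 := Complex.ofReal_ne_zero.2 hr0.ne'
    conv_rhs => rw [← Complex.re_add_im s]
    rw [← Complex.ofReal_mul, mul_div_cancel₀ _ hr0.ne']
    push_cast; ring
  have hne : ∀ w, ‖w‖ ≤ 1/2 → f w ≠ 0 := by
    intro w hw
    have hrw : r * ‖w‖ ≤ 4 * (κ/L) := by nlinarith [norm_nonneg w]
    apply zf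
    · rw [Complex.add_im, hs0im]
      have := (Complex.abs_im_le_norm _).trans (hwn w).le
      refine (abs_add_le _ _).trans ?_
      linarith
    · rw [Complex.add_re, hs0re, h6]
      have := (abs_le.1 ((Complex.abs_re_le_norm _).trans (hwn w).le)).1
      linarith
  have := nonvan_logDeriv hfd (by linarith) hb hne hzn
  rw [hf, logDeriv_scale, hzs, norm_mul, Complex.norm_real, Real.norm_eq_abs, abs_of_pos hr0] at this
  have hM2 : M ≤ (D + 4) * L := by rw [hM]; nlinarith
  calc ‖logDeriv riemannZeta₁ s‖ = (r * ‖logDeriv riemannZeta₁ s‖) / r := by field_simp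
    _ ≤ (100 * ((D+4) * L)) / r := div_le_div_of_nonneg_right (by linarith) hr0.le
    _ = _ := by rw [hr]; field_simp
end

section
open Real MeasureTheory

/-- Gaussian weight. -/
noncomputable def gw (r x : ℝ) : ℝ := exp (-(π * r^2) * x^2)

/-- Normalized Gaussian. -/
noncomputable def gg (r u : ℝ) : ℝ := r⁻¹ * exp (-(π / r^2) * u^2)

lemma gw_pos (r x : ℝ) : 0 < gw r x := exp_pos _
lemma gw_le_one (r x : ℝ) : gw r x ≤ 1 := by
  unfold gw; rw [Real.exp_le_one_iff]
  have := pi_pos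
  have : 0 ≤ π * r^2 * x^2 := by positivity
  linarith
lemma gg_pos {r : ℝ} (hr : 0 < r) (u : ℝ) : 0 < gg r u := by unfold gg; positivity
lemma gw_int {r : ℝ} (hr : 0 < r) : Integrable (gw r) := integrable_exp_neg_mul_sq (by positivity)
lemma gw_cont (r : ℝ) : Continuous (gw r) := by unfold gw; fun_prop
lemma gg_cont (r : ℝ) : Continuous (gg r) := by unfold gg; fun_prop
lemma gg_int {r : ℝ} (hr : 0 < r) : Integrable (gg r) := (integrable_exp_neg_mul_sq (by positivity)).const_mul _

lemma gw_integral {r : ℝ} (hr : 0 < r) : ∫ x, gw r x = r⁻¹ := by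
  unfold gw
  rw [integral_gaussian]
  have : π / (π * r^2) = (r⁻¹)^2 := by field_simp
  rw [this, Real.sqrt_sq (by positivity)]

lemma gg_integral {r : ℝ} (hr : 0 < r) : ∫ x, gg r x = 1 := by
  unfold gg
  rw [integral_const_mul, integral_gaussian]
  have : π / (π / r^2) = r^2 := by field_simp
  rw [this, Real.sqrt_sq (by positivity)]; field_simp

lemma gg_fourier {r : ℝ} (hr : 0 < r) (u : ℝ) : ∫ x : ℝ, (gw r x : ℂ) * ee (u * x) = (gg r u : ℂ) := by
  have h := fourierIntegral_gaussian (b := ((π * r^2 : ℝ) : ℂ)) (by rw [Complex.ofReal_re]; positivity) ((2 * π * u : ℝ) : ℂ)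
  have e1 : ∀ x : ℝ, (gw r x : ℂ) * ee (u * x) = Complex.exp (Complex.I * ((2 * π * u : ℝ) : ℂ) * x) * Complex.exp (-((π * r^2 : ℝ) : ℂ) * x ^ 2) := by
    intro x
    unfold gw ee
    rw [mul_comm]; push_cast; congr 2; ring
  simp_rw [e1]
  rw [h]
  have e2 : ((π:ℂ) / ((π * r^2 : ℝ) : ℂ)) = (((r⁻¹)^2 : ℝ) : ℂ) := by
    rw [← Complex.ofReal_div]; congr 1; field_simp
  have e3 : (((r⁻¹)^2 : ℝ) : ℂ)^(1/2 : ℂ) = (r⁻¹ : ℝ) := by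
    have : (1/2 : ℂ) = ((1/2 : ℝ) : ℂ) := by push_cast; rfl
    rw [this, ← Complex.ofReal_cpow (by positivity), ← Real.sqrt_eq_rpow, Real.sqrt_sq (by positivity)]
  rw [e2, e3]
  unfold gg
  push_cast
  congr 2
  have hp : (π:ℂ) ≠ 0 := by exact_mod_cast pi_ne_zero
  have hr' : (r:ℂ) ≠ 0 := by exact_mod_cast hr.ne'
  field_simp
  ring

lemma gg_minorant {r : ℝ} (hr : 0 < r) {u : ℝ} (hu : r ≤ |u|) : 2 * gg r u - gg (2*r) u ≤ 0 := by
  unfold gg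
  have h1 : r^2 ≤ u^2 := by rw [← sq_abs u]; exact pow_le_pow_left₀ hr.le hu 2
  set q := u^2 / r^2 with hq
  have hq1 : 1 ≤ q := by rw [hq, le_div_iff₀ (by positivity)]; linarith
  have e1 : -(π / r^2) * u^2 = -(π * q) := by rw [hq]; ring
  have e2 : -(π / (2*r)^2) * u^2 = -(π * q / 4) := by rw [hq]; field_simp; ring
  rw [e1, e2]
  have h3 : exp (-(π * q / 4)) = exp (-(π * q)) * exp (3 * (π * q) / 4) := by rw [← Real.exp_add]; ring_nf
  have h4 : 4 ≤ exp (3 * (π * q) / 4) := by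
    have h5 : (9:ℝ)/4 ≤ 3 * (π * q) / 4 := by nlinarith [pi_gt_three]
    have h6 := Real.quadratic_le_exp_of_nonneg (x := 3 * (π * q) / 4) (by linarith)
    nlinarith
  rw [h3]
  have h7 := exp_pos (-(π * q))
  have h8 : (2*r)⁻¹ = r⁻¹ / 2 := by field_simp
  rw [h8]
  have h9 : 0 < r⁻¹ * exp (-(π * q)) := by positivity
  nlinarith

lemma gg_le {r : ℝ} (hr : 0 < r) (u : ℝ) : gg r u ≤ r⁻¹ := by
  unfold gg
  have : exp (-(π / r^2) * u^2) ≤ 1 := by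
    rw [Real.exp_le_one_iff]
    have := pi_pos
    have : 0 ≤ π / r^2 * u^2 := by positivity
    linarith
  have h : 0 < r⁻¹ := by positivity
  nlinarith

lemma gg_minorant' {r : ℝ} (hr : 0 < r) (u : ℝ) : 2 * gg r u - gg (2*r) u ≤ if |u| < r then 2 / r else 0 := by
  split_ifs with h
  · have h1 := gg_le hr u
    have h2 := gg_pos (r := 2*r) (by linarith) u
    have : 2 / r = 2 * r⁻¹ := by ring
    linarith
  · exact gg_minorant hr (not_lt.1 h)

lemma gg_conv {h k : ℝ} (hh : 0 < h) (hk : 0 < k) (u v : ℝ) : ∫ R, gg h (u - R) * gg k (v - R) = gg (√(h^2+k^2)) (u - v) := by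
  have hs : 0 < h^2 + k^2 := by positivity
  have e : ∀ R : ℝ, gg h (u - R) * gg k (v - R) = (h⁻¹ * k⁻¹ * exp (-(π/(h^2+k^2)) * (u-v)^2)) * exp (-(π * (h^2+k^2)/(h^2*k^2)) * (R - (u*k^2+v*h^2)/(h^2+k^2))^2) := by
    intro R
    unfold gg
    have : exp (-(π / h^2) * (u-R)^2) * exp (-(π / k^2) * (v-R)^2) = exp (-(π/(h^2+k^2)) * (u-v)^2) * exp (-(π * (h^2+k^2)/(h^2*k^2)) * (R - (u*k^2+v*h^2)/(h^2+k^2))^2) := by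
      rw [← Real.exp_add, ← Real.exp_add]
      congr 1
      field_simp
      ring
    linear_combination (h⁻¹ * k⁻¹) * this
  simp_rw [e]
  rw [integral_const_mul, integral_sub_right_eq_self (fun x => exp (-(π * (h^2+k^2)/(h^2*k^2)) * x^2)), integral_gaussian]
  have e2 : π / (π * (h^2+k^2)/(h^2*k^2)) = (h * k)^2 / (h^2+k^2) := by field_simp
  rw [e2, Real.sqrt_div (by positivity), Real.sqrt_sq (by positivity)]
  unfold gg
  rw [Real.sq_sqrt hs.le]
  field_simp

lemma gg_mul_int {h k : ℝ} (hh : 0 < h) (hk : 0 < k) (u v : ℝ) : Integrable (fun R => gg h (u - R) * gg k (v - R)) := by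
  refine Integrable.mono' ((gg_int hk).comp_sub_left v |>.const_mul h⁻¹) ?_ ?_
  · exact (((gg_cont h).comp (by fun_prop)).mul ((gg_cont k).comp (by fun_prop))).aestronglyMeasurable
  · filter_upwards with R
    rw [Real.norm_eq_abs, abs_of_pos (mul_pos (gg_pos hh _) (gg_pos hk _))]
    exact mul_le_mul_of_nonneg_right (gg_le hh _) (gg_pos hk _).le

lemma gg_exp {r : ℝ} (hr : 0 < r) (a v : ℝ) : Integrable (fun u => exp (-a * u) * gg r (v - u)) ∧
    ∫ u, exp (-a * u) * gg r (v - u) = exp (-a * v + a^2 * r^2 / (4 * π)) := by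
  have e : ∀ u : ℝ, exp (-a * u) * gg r (v - u) = exp (-a * v + a^2 * r^2 / (4 * π)) * gg r (u - (v - a * r^2 / (2 * π))) := by
    intro u
    unfold gg
    have : exp (-a*u) * exp (-(π / r^2) * (v-u)^2) = exp (-a * v + a^2 * r^2 / (4 * π)) * exp (-(π / r^2) * (u - (v - a * r^2 / (2 * π)))^2) := by
      rw [← Real.exp_add, ← Real.exp_add]
      congr 1
      have := pi_pos
      field_simp
      ring
    linear_combination r⁻¹ * this
  simp_rw [e]
  constructor
  · exact ((gg_int hr).comp_sub_right _).const_mul _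
  · rw [integral_const_mul, integral_sub_right_eq_self (gg r), gg_integral hr, mul_one]
end

section
open Real MeasureTheory

lemma ee_cont : Continuous ee := by unfold ee; fun_prop

/-- pole integral -/
lemma inv_eq_int {a : ℝ} (ha : 0 < a) (ξ : ℝ) : (1 / ((a:ℂ) + 2 * π * ξ * Complex.I)) = ∫ u in Set.Ioi (0:ℝ), (exp (-a * u) : ℂ) * ee (-u * ξ) := by
  have h := integral_exp_mul_complex_Ioi (a := -((a:ℂ) + 2 * π * ξ * Complex.I)) (by simp [ha]) 0
  have e : ∀ u : ℝ, (exp (-a * u) : ℂ) * ee (-u * ξ) = Complex.exp (-((a:ℂ) + 2 * π * ξ * Complex.I) * u) := by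
    intro u
    unfold ee
    push_cast
    rw [← Complex.exp_add]; congr 1; ring
  simp_rw [e]
  rw [h, Complex.ofReal_zero, mul_zero, Complex.exp_zero, neg_div_neg_eq]

lemma main_term {a δ : ℝ} (ha : 0 < a) (hδ : 0 < δ) (v : ℝ) :
    ∫ ξ : ℝ, (1 / ((a:ℂ) + 2 * π * ξ * Complex.I)) * ((gw δ ξ : ℂ) * ee (v * ξ)) =
      ((∫ u in Set.Ioi (0:ℝ), exp (-a * u) * gg δ (v - u) : ℝ) : ℂ) := by
  have e1 : ∀ ξ : ℝ, (1 / ((a:ℂ) + 2 * π * ξ * Complex.I)) * ((gw δ ξ : ℂ) * ee (v * ξ)) =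
      ∫ u in Set.Ioi (0:ℝ), ((gw δ ξ : ℂ) * (exp (-a * u) : ℂ)) * ee ((v - u) * ξ) := by
    intro ξ
    rw [inv_eq_int ha, ← integral_mul_const]
    congr 1; ext u
    have : ee ((v-u) * ξ) = ee (-u * ξ) * ee (v * ξ) := by rw [← ee_add]; congr 1; ring
    rw [this]; ring
  simp_rw [e1]
  rw [integral_integral_swap]
  · rw [← integral_complex_ofReal]
    congr 1; ext u
    have : ∀ x : ℝ, (gw δ x : ℂ) * (exp (-a * u) : ℂ) * ee ((v-u) * x) = (exp (-a * u) : ℂ) * ((gw δ x : ℂ) * ee ((v-u) * x)) := by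
      intro x; ring
    simp_rw [this]
    rw [integral_const_mul, gg_fourier hδ]
    push_cast; rfl
  · have hI : Integrable (fun p : ℝ × ℝ => gw δ p.1 * exp (-a * p.2)) (volume.prod (volume.restrict (Set.Ioi 0))) :=
      (gw_int hδ).mul_prod (integrableOn_exp_mul_Ioi (by linarith) 0)
    refine Integrable.mono' hI ?_ ?_
    · apply Continuous.aestronglyMeasurable
      have := gw_cont δ
      have := ee_cont
      simp only [Function.uncurry_def]
      fun_prop
    · filter_upwards with p
      simp only [Function.uncurry_def]
      rw [norm_mul, norm_mul, norm_ee, mul_one, Complex.norm_real, Complex.norm_real, Real.norm_eq_abs, Real.norm_eq_abs, abs_of_pos (gw_pos _ _), abs_of_pos (exp_pos _)]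

lemma main_lower {v δ : ℝ} (hv : 1 ≤ v) (hδ : 0 < δ) (hδ1 : δ ≤ 1) :
    exp (-1) / 2 ≤ 2 * (∫ u in Set.Ioi (0:ℝ), exp (-(1/v) * u) * gg δ (v - u)) - ∫ u in Set.Ioi (0:ℝ), exp (-(1/v) * u) * gg (2*δ) (v - u) := by
  obtain ⟨i1, f1⟩ := gg_exp hδ (1/v) v
  obtain ⟨i2, f2⟩ := gg_exp (r := 2*δ) (by linarith) (1/v) v
  have j : Integrable (fun u => 2 * (exp (-(1/v) * u) * gg δ (v - u)) - exp (-(1/v) * u) * gg (2*δ) (v - u)) := (i1.const_mul 2).sub i2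
  have s1 : 2 * (∫ u in Set.Ioi (0:ℝ), exp (-(1/v) * u) * gg δ (v - u)) - ∫ u in Set.Ioi (0:ℝ), exp (-(1/v) * u) * gg (2*δ) (v - u)
      = ∫ u in Set.Ioi (0:ℝ), (2 * (exp (-(1/v) * u) * gg δ (v - u)) - exp (-(1/v) * u) * gg (2*δ) (v - u)) := by
    rw [integral_sub (i1.const_mul 2).integrableOn i2.integrableOn, integral_const_mul]
  have s2 : (∫ u, (2 * (exp (-(1/v) * u) * gg δ (v - u)) - exp (-(1/v) * u) * gg (2*δ) (v - u))) ≤ ∫ u in Set.Ioi (0:ℝ), (2 * (exp (-(1/v) * u) * gg δ (v - u)) - exp (-(1/v) * u) * gg (2*δ) (v - u)) := by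
    rw [← integral_add_compl (measurableSet_Ioi (a := (0:ℝ))) j]
    have : ∫ u in (Set.Ioi (0:ℝ))ᶜ, (2 * (exp (-(1/v) * u) * gg δ (v - u)) - exp (-(1/v) * u) * gg (2*δ) (v - u)) ≤ 0 := by
      apply setIntegral_nonpos measurableSet_Ioi.compl
      intro u hu
      simp at hu
      have := gg_minorant hδ (u := v - u) (by rw [abs_of_pos (by linarith)]; linarith)
      have h2 := exp_pos (-(1/v) * u)
      nlinarith
    linarith
  have s3 : (∫ u, (2 * (exp (-(1/v) * u) * gg δ (v - u)) - exp (-(1/v) * u) * gg (2*δ) (v - u))) = 2 * exp (-(1/v) * v + (1/v)^2 * δ^2/(4*π)) - exp (-(1/v) * v + (1/v)^2 * (2*δ)^2/(4*π)) := by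
    rw [integral_sub (i1.const_mul 2) i2, integral_const_mul, f1, f2]
  rw [s1]
  refine le_trans ?_ s2
  rw [s3]
  have e : -(1/v) * v = -1 := by field_simp
  rw [e, Real.exp_add, Real.exp_add]
  have hp := pi_gt_three
  have h1v : 1/v ≤ 1 := by rw [div_le_one (by linarith)]; exact hv
  have h0v : 0 < 1/v := by positivity
  have k1 : 1 ≤ exp ((1/v)^2 * δ^2/(4*π)) := Real.one_le_exp (by positivity)
  have k2 : exp ((1/v)^2 * (2*δ)^2/(4*π)) ≤ 3/2 := by
    have : (1/v)^2 * (2*δ)^2/(4*π) ≤ 1/3 := by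
      have a1 : (1/v)^2 ≤ 1 := by nlinarith
      have a2 : (2*δ)^2 ≤ 4 := by nlinarith
      rw [div_le_iff₀ (by positivity)]
      have : (1/v)^2 * (2*δ)^2 ≤ 1 * 4 := mul_le_mul a1 a2 (by positivity) (by norm_num)
      linarith
    have h3 : exp (1/3) ≤ 3/2 := by
      have := Real.exp_bound_div_one_sub_of_interval (x := 1/3) (by norm_num) (by norm_num)
      norm_num at this ⊢; exact this
    exact (Real.exp_le_exp.2 this).trans h3
  have k3 := exp_pos (-1)
  nlinarith

/-- the von Mangoldt side -/
lemma sum_side {σ δ : ℝ} (hσ : 1 < σ) (hδ : 0 < δ) (v : ℝ) :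
    HasSum (fun n : ℕ => ArithmeticFunction.vonMangoldt n * (n:ℝ)^(-σ) * gg δ (v - log n))
      (∫ ξ : ℝ, LV ((σ:ℂ) + (2 * π * ξ : ℝ) * Complex.I) * ((gw δ ξ : ℂ) * ee (v * ξ))).re := by
  have hb : Summable (fun n : ℕ => ArithmeticFunction.vonMangoldt n * (n:ℝ)^(-σ)) := by
    have := (ArithmeticFunction.LSeriesSummable_vonMangoldt (s := σ) (by simpa using hσ)).norm
    refine this.congr fun n => ?_
    rcases eq_or_ne n 0 with rfl | hn
    · simp
    have t := term_vM σ 0 n hn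
    simp only [Complex.ofReal_zero, zero_mul, add_zero, neg_zero, Complex.exp_zero, mul_one] at t
    rw [t, Complex.norm_real, Real.norm_eq_abs, abs_of_nonneg (mul_nonneg ArithmeticFunction.vonMangoldt_nonneg (by positivity))]
  set b : ℕ → ℝ := fun n => ArithmeticFunction.vonMangoldt n * (n:ℝ)^(-σ) with hbdef
  have hb0 : ∀ n, 0 ≤ b n := fun n => mul_nonneg ArithmeticFunction.vonMangoldt_nonneg (by positivity)
  set F : ℕ → ℝ → ℂ := fun n ξ => (b n : ℂ) * ((gw δ ξ : ℂ) * ee ((v - log n) * ξ)) with hF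
  have hFn : ∀ n ξ, ‖F n ξ‖ = b n * gw δ ξ := by
    intro n ξ
    simp only [hF]
    rw [norm_mul, norm_mul, norm_ee, mul_one, Complex.norm_real, Complex.norm_real, Real.norm_eq_abs, Real.norm_eq_abs, abs_of_pos (gw_pos _ _), abs_of_nonneg (hb0 n)]
  have hFi : ∀ n, Integrable (F n) := by
    intro n
    refine Integrable.mono' ((gw_int hδ).const_mul (b n)) ?_ ?_
    · apply Continuous.aestronglyMeasurable
      have := gw_cont δ
      have := ee_cont
      simp only [hF]; fun_prop
    · filter_upwards with ξ; rw [hFn]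
  have hs : Summable (fun n => ∫ ξ, ‖F n ξ‖) := by
    simp_rw [hFn, integral_const_mul]
    exact hb.mul_right _
  have h := hasSum_integral_of_summable_integral_norm hFi hs
  have e1 : ∀ n, ∫ ξ, F n ξ = ((b n * gg δ (v - log n) : ℝ) : ℂ) := by
    intro n
    simp only [hF]
    rw [integral_const_mul, gg_fourier hδ]; push_cast; rfl
  have e2 : ∀ ξ : ℝ, ∑' n, F n ξ = LV ((σ:ℂ) + (2 * π * ξ : ℝ) * Complex.I) * ((gw δ ξ : ℂ) * ee (v * ξ)) := by
    intro ξ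
    have := (LV_hasSum (s := (σ:ℂ) + (2 * π * ξ : ℝ) * Complex.I) (by simpa using hσ)).mul_right ((gw δ ξ : ℂ) * ee (v * ξ))
    rw [← this.tsum_eq]
    congr 1; ext n
    rcases eq_or_ne n 0 with rfl | hn
    · simp [hF, hbdef]
    rw [term_vM σ _ n hn]
    simp only [hF]
    have : ee ((v - log n) * ξ) = Complex.exp (-((2 * π * ξ * log n : ℝ) * Complex.I)) * ee (v * ξ) := by
      unfold ee; rw [← Complex.exp_add]; congr 1; push_cast; ring
    rw [this]; ring
  simp_rw [e1, e2] at h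
  have := Complex.hasSum_re h
  simpa using this

/-- pointwise bound of LV -/
lemma LV_norm_le {σ : ℝ} (hσ : 1 < σ) (t : ℝ) : ‖LV ((σ:ℂ) + t * Complex.I)‖ ≤ ‖LV σ‖ := by
  have h1 := (LV_hasSum (s := (σ:ℂ) + t * Complex.I) (by simpa using hσ))
  have h2 := (LV_hasSum (s := (σ:ℂ)) (by simpa using hσ))
  have hn1 : ∀ n, ‖LSeries.term (fun n => ((ArithmeticFunction.vonMangoldt n : ℝ) : ℂ)) ((σ:ℂ) + t * Complex.I) n‖ ≤ (LSeries.term (fun n => ((ArithmeticFunction.vonMangoldt n : ℝ) : ℂ)) (σ:ℂ) n).re := by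
    intro n
    rcases eq_or_ne n 0 with rfl | hn
    · simp
    rw [term_vM σ t n hn]
    have t0 := term_vM σ 0 n hn
    simp only [Complex.ofReal_zero, zero_mul, add_zero, neg_zero, Complex.exp_zero, mul_one] at t0
    rw [t0, Complex.ofReal_re, norm_mul, ← neg_mul, ← Complex.ofReal_neg, Complex.norm_exp_ofReal_mul_I, mul_one, Complex.norm_real, Real.norm_eq_abs, abs_of_nonneg (mul_nonneg ArithmeticFunction.vonMangoldt_nonneg (by positivity))]
  calc _ ≤ (LV σ).re := by
        rw [← h1.tsum_eq]
        exact tsum_of_norm_bounded (Complex.hasSum_re h2) hn1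
    _ ≤ _ := Complex.re_le_norm _
end

section
open Real MeasureTheory

lemma ld_diff {s : ℂ} (h : riemannZeta₁ s ≠ 0) : DifferentiableAt ℂ (logDeriv riemannZeta₁) s := by
  have h1 : AnalyticAt ℂ riemannZeta₁ s := differentiable_riemannZeta₁.analyticAt s
  exact h1.deriv.differentiableAt.div differentiable_riemannZeta₁.differentiableAt h

lemma contour {κ C : ℝ} (hκ0 : 0 < κ) (hκ1 : κ ≤ 1/10) (hC0 : 0 < C)
    (hb : ∀ T : ℝ, 1 ≤ T → ∀ s : ℂ, |s.im| ≤ T → 1 - κ / LL T ≤ s.re →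
    riemannZeta₁ s ≠ 0 ∧ (s.re ≤ 1 + κ / LL T → ‖logDeriv riemannZeta₁ s‖ ≤ C * LL T ^ 2))
    {T v δ : ℝ} (hT : 1 ≤ T) (hv : 1 ≤ v) (hδ : 0 < δ) (hδ1 : δ ≤ 1) (hvT : 1/v ≤ κ / LL T) :
    ‖∫ ξ in (-(T/(2*π)))..(T/(2*π)), logDeriv riemannZeta₁ (((1 + 1/v : ℝ):ℂ) + (2 * π * ξ : ℝ) * Complex.I) * ((gw δ ξ : ℂ) * ee (v * ξ))‖
      ≤ C * LL T^2 * (T * exp (1 - v * κ / LL T)) + 2 * (C * LL T^2 * exp (1 - π * δ^2 * (T/(2*π))^2)) := by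
  have hp := pi_gt_three
  set L := LL T with hL
  have hL1 : 1 ≤ L := LL_ge_one T
  set A := T/(2*π) with hA
  have hA0 : 0 < A := by positivity
  have hAT : 2 * π * A = T := by rw [hA]; field_simp
  set b := (1/v + κ/L)/(2*π) with hbdef
  have hκL : 0 < κ/L := by positivity
  have hκL1 : κ/L ≤ 1/10 := by rw [div_le_iff₀ (by linarith)]; nlinarith
  have hv0 : 0 < 1/v := by positivity
  have hb0 : 0 < b := by positivity
  have hb1 : b ≤ 1/10 := by rw [hbdef, div_le_iff₀ (by positivity)]; nlinarith
  have hbT : 2 * π * b = 1/v + κ/L := by rw [hbdef]; field_simp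
  set F : ℂ → ℂ := fun w => logDeriv riemannZeta₁ (((1 + 1/v : ℝ):ℂ) + 2 * π * w) * (Complex.exp (π * δ^2 * w^2) * Complex.exp (2 * π * v * w)) with hF
  have hre : ∀ w : ℂ, (((1 + 1/v : ℝ):ℂ) + 2 * π * w).re = 1 + 1/v + 2 * π * w.re := by
    intro w
    have : (2 * (π:ℂ) * w) = ((2 * π : ℝ) : ℂ) * w := by push_cast; ring
    rw [this, Complex.add_re, Complex.ofReal_re, Complex.re_ofReal_mul]
  have him : ∀ w : ℂ, (((1 + 1/v : ℝ):ℂ) + 2 * π * w).im = 2 * π * w.im := by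
    intro w
    have : (2 * (π:ℂ) * w) = ((2 * π : ℝ) : ℂ) * w := by push_cast; ring
    rw [this, Complex.add_im, Complex.ofReal_im, Complex.im_ofReal_mul, zero_add]
  have hin : ∀ w : ℂ, -b ≤ w.re → w.re ≤ 0 → |w.im| ≤ A → riemannZeta₁ (((1 + 1/v : ℝ):ℂ) + 2 * π * w) ≠ 0 ∧ ‖logDeriv riemannZeta₁ (((1 + 1/v : ℝ):ℂ) + 2 * π * w)‖ ≤ C * L^2 := by
    intro w h1 h2 h3
    obtain ⟨g1, g2⟩ := hb T hT (((1 + 1/v : ℝ):ℂ) + 2 * π * w) (by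
      rw [him, abs_mul, abs_of_pos (by positivity), ← hAT]
      exact mul_le_mul_of_nonneg_left h3 (by positivity)) (by rw [hre]; nlinarith)
    exact ⟨g1, g2 (by rw [hre]; nlinarith)⟩
  have hnorm : ∀ x y : ℝ, -b ≤ x → x ≤ 0 → |y| ≤ A → ‖F ((x:ℂ) + y * Complex.I)‖ ≤ C * L^2 * exp (1 - π * δ^2 * y^2 + 2 * π * v * x) := by
    intro x y h1 h2 h3
    simp only [hF]
    rw [norm_mul]
    apply mul_le_mul (hin _ (by simpa using h1) (by simpa using h2) (by simpa using h3)).2 _ (norm_nonneg _) (by positivity)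
    rw [← Complex.exp_add, Complex.norm_exp]
    apply Real.exp_le_exp.2
    have e1 : ((π:ℂ) * δ^2 * ((x:ℂ) + y * Complex.I)^2 + 2 * π * v * ((x:ℂ) + y * Complex.I)) = ((π * δ^2 * (x^2 - y^2) + 2 * π * v * x : ℝ) : ℂ) + ((π * δ^2 * (2 * x * y) + 2 * π * v * y : ℝ) : ℂ) * Complex.I := by
      push_cast
      linear_combination ((π:ℂ) * δ^2 * y^2) * Complex.I_sq
    rw [e1, Complex.add_re, Complex.ofReal_re, Complex.re_ofReal_mul, Complex.I_re, mul_zero, add_zero]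
    have h4 : π * δ^2 * x^2 ≤ 1 := by
      have a1 : δ^2 ≤ 1 := by nlinarith
      have a2 : x^2 ≤ 1/100 := by nlinarith
      have a3 : δ^2 * x^2 ≤ 1 * (1/100) := mul_le_mul a1 a2 (by positivity) (by norm_num)
      nlinarith [pi_lt_four]
    linarith
  have hrect := Complex.integral_boundary_rect_eq_zero_of_differentiableOn F ((-b : ℝ) + (-A : ℝ) * Complex.I) ((0:ℝ) + (A:ℝ) * Complex.I) (by
    intro w hw
    rw [Complex.mem_reProdIm] at hw
    simp at hw
    rw [Set.uIcc_of_le (by linarith), Set.uIcc_of_le (by linarith)] at hw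
    apply DifferentiableAt.differentiableWithinAt
    have h := (hin w hw.1.1 hw.1.2 (abs_le.2 hw.2)).1
    have : DifferentiableAt ℂ (fun w : ℂ => logDeriv riemannZeta₁ (((1 + 1/v : ℝ):ℂ) + 2 * π * w)) w := by
      exact DifferentiableAt.comp (f := fun w : ℂ => (((1 + 1/v : ℝ):ℂ) + 2 * π * w)) w (ld_diff h) (by fun_prop)
    apply this.mul
    fun_prop)
  have c1 : ((-b : ℝ) + (-A : ℝ) * Complex.I : ℂ).re = -b := by simp
  have c2 : ((-b : ℝ) + (-A : ℝ) * Complex.I : ℂ).im = -A := by simp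
  have c3 : ((0 : ℝ) + (A : ℝ) * Complex.I : ℂ).re = 0 := by simp
  have c4 : ((0 : ℝ) + (A : ℝ) * Complex.I : ℂ).im = A := by simp
  rw [c1, c2, c3, c4] at hrect
  have hhor : ∀ y : ℝ, |y| = A → ‖∫ x in (-b)..0, F ((x:ℂ) + (y:ℝ) * Complex.I)‖ ≤ C * L^2 * exp (1 - π * δ^2 * A^2) := by
    intro y hy
    have : ∀ x ∈ Set.uIoc (-b) 0, ‖F ((x:ℂ) + (y:ℝ) * Complex.I)‖ ≤ C * L^2 * exp (1 - π * δ^2 * A^2) := by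
      intro x hx
      rw [Set.uIoc_of_le (by linarith)] at hx
      refine (hnorm x y hx.1.le hx.2 hy.le).trans ?_
      apply mul_le_mul_of_nonneg_left _ (by positivity)
      apply Real.exp_le_exp.2
      rw [← sq_abs y, hy]
      have : 2 * π * v * x ≤ 0 := mul_nonpos_of_nonneg_of_nonpos (by positivity) hx.2
      linarith
    refine (intervalIntegral.norm_integral_le_of_norm_le_const this).trans ?_
    rw [zero_sub, neg_neg, abs_of_pos hb0]
    have : 0 ≤ C * L^2 * exp (1 - π * δ^2 * A^2) := by positivity
    nlinarith
  have hleft : ‖∫ y in (-A)..A, F (((-b:ℝ):ℂ) + (y:ℝ) * Complex.I)‖ ≤ C * L^2 * (T * exp (1 - v * κ / L)) := by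
    have : ∀ y ∈ Set.uIoc (-A) A, ‖F (((-b:ℝ):ℂ) + (y:ℝ) * Complex.I)‖ ≤ C * L^2 * exp (1 - v * κ / L) := by
      intro y hy
      rw [Set.uIoc_of_le (by linarith)] at hy
      refine (hnorm (-b) y le_rfl (by linarith) (abs_le.2 ⟨hy.1.le, hy.2⟩)).trans ?_
      apply mul_le_mul_of_nonneg_left _ (by positivity)
      apply Real.exp_le_exp.2
      have h1 : 2 * π * v * (-b) = -(1 + v * κ / L) := by
        have : 2 * π * v * (-b) = -(v * (2 * π * b)) := by ring
        rw [this, hbT]; field_simp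
      have h2 : 0 ≤ π * δ^2 * y^2 := by positivity
      linarith
    refine (intervalIntegral.norm_integral_le_of_norm_le_const this).trans ?_
    rw [sub_neg_eq_add, abs_of_pos (by linarith), mul_assoc]
    apply mul_le_mul_of_nonneg_left _ (by positivity)
    rw [mul_comm]
    apply mul_le_mul_of_nonneg_right _ (exp_pos _).le
    nlinarith
  have hright : (∫ ξ in (-A)..A, logDeriv riemannZeta₁ (((1 + 1/v : ℝ):ℂ) + (2 * π * ξ : ℝ) * Complex.I) * ((gw δ ξ : ℂ) * ee (v * ξ))) = ∫ y in (-A)..A, F (((0:ℝ):ℂ) + (y:ℝ) * Complex.I) := by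
    congr 1; ext y
    simp only [hF, gw, ee]
    congr 1
    · congr 1; push_cast; ring
    · push_cast
      congr 2
      · linear_combination (-(π:ℂ) * δ^2 * y^2) * Complex.I_sq
      · ring
  rw [hright]
  have h1 := hhor (-A) (by rw [abs_neg, abs_of_pos hA0])
  have h2 := hhor A (abs_of_pos hA0)
  have key : ∀ P Q Rr S : ℂ, P - Q + Complex.I • Rr - Complex.I • S = 0 → ‖Rr‖ ≤ ‖S‖ + ‖P‖ + ‖Q‖ := by
    intro P Q Rr S h
    have e : Complex.I * Rr = Complex.I * S - P + Q := by simp only [smul_eq_mul] at h; linear_combination h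
    calc ‖Rr‖ = ‖Complex.I * Rr‖ := by rw [norm_mul, Complex.norm_I, one_mul]
      _ = ‖Complex.I * S - P + Q‖ := by rw [e]
      _ ≤ ‖Complex.I * S - P‖ + ‖Q‖ := norm_add_le _ _
      _ ≤ ‖Complex.I * S‖ + ‖P‖ + ‖Q‖ := by linarith [norm_sub_le (Complex.I * S) P]
      _ = _ := by rw [norm_mul, Complex.norm_I, one_mul]
  have := key _ _ _ _ hrect
  linarith
end

section
open Real MeasureTheory

lemma gw_tail {δ A ξ : ℝ} (hA : 0 ≤ A) (h : A ≤ |ξ|) : gw δ ξ ≤ exp (-(3/4 * (π * δ^2 * A^2))) * gw (δ/2) ξ := by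
  unfold gw
  rw [← Real.exp_add]
  apply Real.exp_le_exp.2
  have h1 : A^2 ≤ ξ^2 := by rw [← sq_abs ξ]; exact pow_le_pow_left₀ hA h 2
  have h2 : π * δ^2 * A^2 ≤ π * δ^2 * ξ^2 := mul_le_mul_of_nonneg_left h1 (by have := pi_pos; positivity)
  nlinarith

lemma err_explicit : ∃ κ C : ℝ, 0 < κ ∧ κ ≤ 1/10 ∧ 0 < C ∧ ∀ T v δ : ℝ, 1 ≤ T → 1 ≤ v → 0 < δ → δ ≤ 1 → 1/v ≤ κ / LL T →
    |(∫ ξ : ℝ, LV (((1+1/v : ℝ):ℂ) + (2 * π * ξ : ℝ) * Complex.I) * ((gw δ ξ : ℂ) * ee (v * ξ))).re - ∫ u in Set.Ioi (0:ℝ), exp (-(1/v) * u) * gg δ (v - u)|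
     ≤ C * LL T^2 * (T * exp (1 - v * κ / LL T)) + 2 * (C * LL T^2 * exp (1 - π * δ^2 * (T/(2*π))^2)) + (2 * v + C) * (exp (-(3/4 * (π * δ^2 * (T/(2*π))^2))) * (2 / δ)) := by
  obtain ⟨κ, C, hκ0, hκ1, hC0, hb⟩ := logDeriv_bound
  refine ⟨κ, C * (1 + LL 1^2), hκ0, hκ1, by positivity, ?_⟩
  intro T v δ hT hv hδ hδ1 hvT
  have hp := pi_pos
  have hcon := contour hκ0 hκ1 hC0 hb hT hv hδ hδ1 hvT
  set σ := 1 + 1/v with hσ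
  have hv0 : 0 < 1/v := by positivity
  have hσ1 : 1 < σ := by linarith
  set A := T/(2*π) with hA
  have hA0 : 0 < A := by positivity
  set ld : ℝ → ℂ := fun ξ => logDeriv riemannZeta₁ ((σ:ℂ) + (2 * π * ξ : ℝ) * Complex.I) with hld
  set w : ℝ → ℂ := fun ξ => (gw δ ξ : ℂ) * ee (v * ξ) with hw
  have hwc : Continuous w := by
    have := gw_cont δ
    have := ee_cont
    simp only [hw]; fun_prop
  have hwn : ∀ ξ, ‖w ξ‖ = gw δ ξ := by
    intro ξ; simp only [hw]; rw [norm_mul, norm_ee, mul_one, Complex.norm_real, Real.norm_eq_abs, abs_of_pos (gw_pos _ _)]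
  have hldc : Continuous ld := by
    rw [continuous_iff_continuousAt]
    intro ξ
    have h : riemannZeta₁ ((σ:ℂ) + (2 * π * ξ : ℝ) * Complex.I) ≠ 0 := zeta1_ne_zero (by simpa using hσ1.le)
    exact ContinuousAt.comp (f := fun ξ : ℝ => (σ:ℂ) + (2 * π * ξ : ℝ) * Complex.I) (ld_diff h).continuousAt (by fun_prop)
  set P : ℝ → ℂ := fun ξ => 1 / (((1/v : ℝ):ℂ) + 2 * π * ξ * Complex.I) with hP
  have hden : ∀ ξ : ℝ, ‖(((1/v : ℝ):ℂ) + 2 * π * ξ * Complex.I)‖ ≥ 1/v := by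
    intro ξ
    have := Complex.abs_re_le_norm (((1/v : ℝ):ℂ) + 2 * π * ξ * Complex.I)
    have e : (((1/v : ℝ):ℂ) + 2 * π * ξ * Complex.I).re = 1/v := by simp
    rw [e, abs_of_pos hv0] at this
    exact this
  have hPc : Continuous P := by
    apply Continuous.div continuous_const (by fun_prop)
    intro ξ h
    have := hden ξ
    rw [h, norm_zero] at this; linarith
  have hPn : ∀ ξ, ‖P ξ‖ ≤ v := by
    intro ξ
    simp only [hP]
    rw [norm_div, norm_one]
    calc 1 / ‖(((1/v : ℝ):ℂ) + 2 * π * ξ * Complex.I)‖ ≤ 1 / (1/v) := one_div_le_one_div_of_le hv0 (hden ξ)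
      _ = v := one_div_one_div v
  have hLV : ∀ ξ : ℝ, LV ((σ:ℂ) + (2 * π * ξ : ℝ) * Complex.I) = P ξ - ld ξ := by
    intro ξ
    rw [LV_eq (by simpa using hσ1)]
    simp only [hP, hld]
    congr 2
    rw [hσ]; push_cast; ring
  have hLL1 : κ / LL T ≤ κ / LL 1 := by
    apply div_le_div_of_nonneg_left hκ0.le (by linarith [LL_ge_one 1])
    rw [LL, LL]
    apply Real.log_le_log (by positivity)
    rw [abs_one, abs_of_pos (by linarith)]; linarith
  have hld0 : ‖ld 0‖ ≤ C * LL 1^2 := by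
    simp only [hld]
    refine (hb 1 le_rfl _ ?_ ?_).2 ?_
    · simp
    · simp; have : 0 < κ / LL 1 := by have := LL_ge_one 1; positivity
      rw [hσ]; linarith
    · simp; rw [hσ]; linarith
  have hLVσ : ‖LV σ‖ ≤ v + C * LL 1^2 := by
    have := hLV 0
    simp only [mul_zero, Complex.ofReal_zero, zero_mul, add_zero] at this
    rw [this]
    refine (norm_sub_le _ _).trans (add_le_add (hPn 0) hld0)
  have hldn : ∀ ξ, ‖ld ξ‖ ≤ 2 * v + C * LL 1^2 := by
    intro ξ
    have e : ld ξ = P ξ - LV ((σ:ℂ) + (2 * π * ξ : ℝ) * Complex.I) := by rw [hLV]; ring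
    rw [e]
    refine (norm_sub_le _ _).trans ?_
    have := LV_norm_le hσ1 (2 * π * ξ)
    linarith [hPn ξ]
  have iP : Integrable (fun ξ => P ξ * w ξ) := by
    refine Integrable.mono' ((gw_int hδ).const_mul v) (hPc.mul hwc).aestronglyMeasurable ?_
    filter_upwards with ξ
    rw [norm_mul, hwn]; exact mul_le_mul_of_nonneg_right (hPn ξ) (gw_pos _ _).le
  have ild : Integrable (fun ξ => ld ξ * w ξ) := by
    refine Integrable.mono' ((gw_int hδ).const_mul (2 * v + C * LL 1^2)) (hldc.mul hwc).aestronglyMeasurable ?_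
    filter_upwards with ξ
    rw [norm_mul, hwn]; exact mul_le_mul_of_nonneg_right (hldn ξ) (gw_pos _ _).le
  have hI : (∫ ξ : ℝ, LV ((σ:ℂ) + (2 * π * ξ : ℝ) * Complex.I) * ((gw δ ξ : ℂ) * ee (v * ξ))) = ((∫ u in Set.Ioi (0:ℝ), exp (-(1/v) * u) * gg δ (v - u) : ℝ) : ℂ) - ∫ ξ, ld ξ * w ξ := by
    rw [← main_term hv0 hδ v, ← integral_sub iP ild]
    congr 1; ext ξ
    rw [hLV]; simp only [hw]; ring
  rw [hI, Complex.sub_re, Complex.ofReal_re, sub_sub_cancel_left, abs_neg]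
  refine (Complex.abs_re_le_norm _).trans ?_
  rw [← integral_add_compl (measurableSet_Ioc (a := -A) (b := A)) ild, ← intervalIntegral.integral_of_le (by linarith)]
  refine (norm_add_le _ _).trans ?_
  have htail : ‖∫ ξ in (Set.Ioc (-A) A)ᶜ, ld ξ * w ξ‖ ≤ (2 * v + C * LL 1^2) * (exp (-(3/4 * (π * δ^2 * A^2))) * (2 / δ)) := by
    have i3 : Integrable (fun ξ => (2 * v + C * LL 1^2) * (exp (-(3/4 * (π * δ^2 * A^2))) * gw (δ/2) ξ)) := ((gw_int (by linarith)).const_mul _).const_mul _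
    have h1 : ‖∫ ξ in (Set.Ioc (-A) A)ᶜ, ld ξ * w ξ‖ ≤ ∫ ξ in (Set.Ioc (-A) A)ᶜ, (2 * v + C * LL 1^2) * (exp (-(3/4 * (π * δ^2 * A^2))) * gw (δ/2) ξ) := by
      apply norm_integral_le_of_norm_le i3.integrableOn
      filter_upwards [ae_restrict_mem measurableSet_Ioc.compl] with ξ hξ
      rw [norm_mul, hwn]
      apply mul_le_mul (hldn ξ) _ (gw_pos _ _).le (by positivity)
      apply gw_tail hA0.le
      by_contra hlt
      push Not at hlt
      rw [abs_lt] at hlt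
      exact hξ ⟨hlt.1, hlt.2.le⟩
    refine h1.trans ?_
    have h2 := setIntegral_le_integral (s := (Set.Ioc (-A) A)ᶜ) i3 (by
      filter_upwards with ξ
      have := gw_pos (δ/2) ξ
      simp only [Pi.zero_apply]; positivity)
    refine h2.trans (le_of_eq ?_)
    rw [integral_const_mul, integral_const_mul, gw_integral (by linarith)]
    congr 2; field_simp
  have hCC : C ≤ C * (1 + LL 1^2) := by nlinarith [mul_pos hC0 (show 0 < LL 1^2 by have := LL_ge_one 1; positivity)]
  have hCC2 : C * LL 1^2 ≤ C * (1 + LL 1^2) := by nlinarith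
  have q1 : C * LL T^2 * (T * exp (1 - v * κ / LL T)) ≤ C * (1 + LL 1^2) * LL T^2 * (T * exp (1 - v * κ / LL T)) := by
    have : 0 ≤ T * exp (1 - v * κ / LL T) := by positivity
    exact mul_le_mul_of_nonneg_right (mul_le_mul_of_nonneg_right hCC (by positivity)) this
  have q2 : C * LL T^2 * exp (1 - π * δ^2 * A^2) ≤ C * (1 + LL 1^2) * LL T^2 * exp (1 - π * δ^2 * A^2) :=
    mul_le_mul_of_nonneg_right (mul_le_mul_of_nonneg_right hCC (by positivity)) (exp_pos _).le
  have q3 : (2 * v + C * LL 1^2) * (exp (-(3/4 * (π * δ^2 * A^2))) * (2 / δ)) ≤ (2 * v + C * (1 + LL 1^2)) * (exp (-(3/4 * (π * δ^2 * A^2))) * (2 / δ)) :=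
    mul_le_mul_of_nonneg_right (by linarith) (by positivity)
  linarith
end

section
open Real MeasureTheory Filter

lemma err_small {ε : ℝ} (hε : 0 < ε) : ∃ q0 : ℝ, 1 ≤ q0 ∧ ∀ q δ : ℝ, q0 ≤ q → exp (-q) ≤ δ → δ ≤ 1 →
    |(∫ ξ : ℝ, LV (((1+1/q^4 : ℝ):ℂ) + (2 * π * ξ : ℝ) * Complex.I) * ((gw δ ξ : ℂ) * ee (q^4 * ξ : ℝ))).re - ∫ u in Set.Ioi (0:ℝ), exp (-(1/q^4) * u) * gg δ (q^4 - u)| ≤ ε := by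
  obtain ⟨κ, C, hκ0, hκ1, hC0, hb⟩ := err_explicit
  have t1 : ∀ᶠ q : ℝ in atTop, 4 * q + 1 ≤ κ * q^3 / 3 := by
    filter_upwards [eventually_ge_atTop (15/κ + 1)] with q hq
    have hk : 0 < 15/κ := by positivity
    have h1 : 15 ≤ κ * q := by
      have : κ * (15/κ) = 15 := by field_simp
      nlinarith
    have h2 : 15 * q^2 ≤ κ * q * q^2 := mul_le_mul_of_nonneg_right h1 (by positivity)
    nlinarith
  have t2 : ∀ᶠ q : ℝ in atTop, 32 * (3 * q + 1) ≤ exp (2*q) := by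
    filter_upwards [eventually_ge_atTop 64] with q hq
    have := Real.quadratic_le_exp_of_nonneg (x := 2*q) (by linarith)
    nlinarith
  have t3 : ∀ᶠ q : ℝ in atTop, (27 * C + 4 + 2 * C) * (q^4 * exp (-q)) < ε := by
    have := (tendsto_pow_mul_exp_neg_atTop_nhds_zero 4).const_mul (27 * C + 4 + 2 * C)
    rw [mul_zero] at this
    exact this.eventually_lt_const hε
  have t4 : ∀ᶠ q : ℝ in atTop, 2 + 3/κ ≤ q := eventually_ge_atTop _
  obtain ⟨q0, hq0⟩ := (t1.and (t2.and (t3.and t4))).exists_forall_of_atTop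
  refine ⟨max q0 1, le_max_right _ _, fun q δ hq hδ hδ1 => ?_⟩
  obtain ⟨u1, u2, u3, u4⟩ := hq0 q ((le_max_left _ _).trans hq)
  have hk3 : 0 < 3/κ := by positivity
  have hq2 : 2 ≤ q := by linarith
  have hqκ : 3 ≤ κ * q := by
    have : κ * (3/κ) = 3 := by field_simp
    nlinarith
  have hδ0 : 0 < δ := (exp_pos _).trans_le hδ
  have hT1 : 1 ≤ exp (2*q) := Real.one_le_exp (by linarith)
  have hL : LL (exp (2*q)) ≤ 3 * q := by
    rw [LL, abs_of_pos (exp_pos _)]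
    have h4 : log (exp (2*q) + 3) ≤ log (exp 2 * exp (2*q)) := by
      apply Real.log_le_log (by positivity)
      have := Real.quadratic_le_exp_of_nonneg (x := 2) (by norm_num)
      nlinarith
    rw [← Real.exp_add, Real.log_exp] at h4
    linarith
  have hL1 := LL_ge_one (exp (2*q))
  have hv1 : 1 ≤ q^4 := one_le_pow₀ (by linarith)
  have hvT : 1/q^4 ≤ κ / LL (exp (2*q)) := by
    rw [div_le_div_iff₀ (by positivity) (by linarith)]
    have : q ≤ q^3 := by nlinarith [sq_nonneg q]
    have h5 : 3 * q ≤ κ * q * q^3 := mul_le_mul hqκ this (by linarith) (by positivity)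
    nlinarith
  refine (hb (exp (2*q)) (q^4) δ hT1 hv1 hδ0 hδ1 hvT).trans ?_
  set L := LL (exp (2*q)) with hLd
  have hL2 : L^2 ≤ 9 * q^2 := by nlinarith
  have hp := pi_gt_three
  have hp4 := pi_lt_four
  have hA : exp (2*q) / 16 ≤ π * δ^2 * (exp (2*q)/(2*π))^2 := by
    have e : π * δ^2 * (exp (2*q)/(2*π))^2 = (δ * exp (2*q))^2 / (4 * π) := by field_simp; norm_num
    have h1 : exp q ≤ δ * exp (2*q) := by
      have : exp q = exp (-q) * exp (2*q) := by rw [← Real.exp_add]; ring_nf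
      rw [this]; exact mul_le_mul_of_nonneg_right hδ (exp_pos _).le
    have h2 : exp (2*q) ≤ (δ * exp (2*q))^2 := by
      have : exp (2*q) = exp q ^2 := by rw [← Real.exp_nat_mul]; norm_num
      rw [this] at h1 ⊢; exact pow_le_pow_left₀ (exp_pos _).le h1 2
    rw [e, div_le_div_iff₀ (by norm_num) (by positivity)]
    nlinarith [exp_pos (2*q)]
  set Y := π * δ^2 * (exp (2*q)/(2*π))^2 with hY
  have a1 : exp (2*q) * exp (1 - q^4 * κ / L) ≤ exp (-q) := by
    rw [← Real.exp_add]; apply Real.exp_le_exp.2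
    have : κ * q^3 / 3 ≤ q^4 * κ / L := by
      rw [div_le_div_iff₀ (by norm_num) (by linarith)]
      have : κ * q^3 * L ≤ κ * q^3 * (3 * q) := mul_le_mul_of_nonneg_left hL (by positivity)
      nlinarith
    linarith
  have a2 : exp (1 - Y) ≤ exp (-q) := Real.exp_le_exp.2 (by linarith)
  have a3 : exp (-(3/4 * Y)) * (2/δ) ≤ 2 * exp (-q) := by
    have h1 : 1/δ ≤ exp q := by
      rw [div_le_iff₀ hδ0]
      have : exp q * exp (-q) = 1 := by rw [← Real.exp_add]; simp
      nlinarith [exp_pos q]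
    have h2 : exp (-(3/4 * Y)) ≤ exp (-(2*q)) := Real.exp_le_exp.2 (by linarith)
    have h3 : exp (-(2*q)) * exp q = exp (-q) := by rw [← Real.exp_add]; ring_nf
    have : exp (-(3/4 * Y)) * (1/δ) ≤ exp (-(2*q)) * exp q := mul_le_mul h2 h1 (by positivity) (exp_pos _).le
    have e : exp (-(3/4 * Y)) * (2/δ) = 2 * (exp (-(3/4 * Y)) * (1/δ)) := by ring
    rw [e]; linarith
  have hCL : C * L^2 ≤ 9 * C * q^4 := by
    have : q^2 ≤ q^4 := pow_le_pow_right₀ (by linarith) (by norm_num)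
    have : C * L^2 ≤ C * (9 * q^4) := mul_le_mul_of_nonneg_left (by linarith) hC0.le
    linarith
  have hX := exp_pos (-q)
  have b1 : C * L^2 * (exp (2*q) * exp (1 - q^4 * κ / L)) ≤ 9 * C * q^4 * exp (-q) := mul_le_mul hCL a1 (by positivity) (by positivity)
  have b2 : C * L^2 * exp (1 - Y) ≤ 9 * C * q^4 * exp (-q) := mul_le_mul hCL a2 (by positivity) (by positivity)
  have b3 : (2 * q^4 + C) * (exp (-(3/4 * Y)) * (2/δ)) ≤ ((2 + C) * q^4) * (2 * exp (-q)) :=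
    mul_le_mul (by nlinarith) a3 (by positivity) (by positivity)
  nlinarith
end

section
open Real MeasureTheory Filter

lemma prime_short : ∃ y0 : ℝ, 1 ≤ y0 ∧ ∀ y δ : ℝ, y0 ≤ y → exp (-(log y)^((1:ℝ)/4)) ≤ δ → δ ≤ 1/20 →
    ∀ s : Finset ℕ, (∀ n : ℕ, 1 ≤ n → |log y - log n| < δ → n ∈ s) → y * δ / 80 ≤ ∑ n ∈ s, pw n := by
  obtain ⟨q0, hq01, hq0⟩ := err_small (ε := 1/100) (by norm_num)
  set q1 := max q0 10 with hq1
  refine ⟨exp (q1^4), Real.one_le_exp (by positivity), ?_⟩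
  intro y δ hy hδ hδ1 s hs
  have hy0 : 0 < y := (exp_pos _).trans_le hy
  have hq1p : 10 ≤ q1 := le_max_right _ _
  have hly : q1^4 ≤ log y := by rw [Real.le_log_iff_exp_le hy0]; exact hy
  have hly0 : 0 ≤ log y := le_trans (by positivity) hly
  set q := (log y)^((1:ℝ)/4) with hq
  have hq4 : q^4 = log y := by
    rw [hq, ← Real.rpow_natCast, ← Real.rpow_mul hly0]; norm_num
  have hqq1 : q1 ≤ q := by
    have h0 : 0 ≤ q := by positivity
    rw [← hq4] at hly
    exact le_of_pow_le_pow_left₀ (by norm_num) h0 hly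
  have hqq0 : q0 ≤ q := (le_max_left _ _).trans hqq1
  have hq10 : 10 ≤ q := by linarith
  have hδ0 : 0 < δ := (exp_pos _).trans_le hδ
  have hv1 : 1 ≤ q^4 := one_le_pow₀ (by linarith)
  have E1 := hq0 q δ hqq0 hδ (by linarith)
  have E2 := hq0 q (2*δ) hqq0 (by linarith) (by linarith)
  have hm := main_lower hv1 hδ0 (by linarith)
  set σ := 1 + 1/q^4 with hσ
  have hσ1 : 1 < σ := by
    have : 0 < 1/q^4 := by positivity
    linarith
  have S1 := sum_side hσ1 hδ0 (q^4)
  have S2 := sum_side hσ1 (δ := 2*δ) (by linarith) (q^4)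
  have S := (S1.mul_left 2).sub S2
  set I1 := (∫ ξ : ℝ, LV ((σ:ℂ) + (2 * π * ξ : ℝ) * Complex.I) * ((gw δ ξ : ℂ) * ee (q^4 * ξ))).re with hI1
  set I2 := (∫ ξ : ℝ, LV ((σ:ℂ) + (2 * π * ξ : ℝ) * Complex.I) * ((gw (2*δ) ξ : ℂ) * ee (q^4 * ξ))).re with hI2
  have hI : 1/10 ≤ 2 * I1 - I2 := by
    have := (abs_le.1 E1).1
    have := (abs_le.1 E2).2
    have := Real.exp_neg_one_gt_d9
    linarith
  set M := ⌊2*y⌋₊ with hM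
  set s' := (Finset.Ioc 0 M).filter (fun n : ℕ => |log y - log n| < δ) with hs'
  have hmem : ∀ n : ℕ, 1 ≤ n → |log y - log n| < δ → n ∈ s' ∧ (n:ℝ) ≤ 2 * y ∧ y ≤ 2 * n := by
    intro n hn h
    have hn0 : (0:ℝ) < n := by exact_mod_cast hn
    rw [abs_lt] at h
    have hl2 : 1/20 < log 2 := by linarith [Real.log_two_gt_d9]
    have h1 : (n:ℝ) ≤ 2 * y := by
      rw [← Real.log_le_log_iff hn0 (by positivity), Real.log_mul (by norm_num) hy0.ne']; linarith
    have h2 : y ≤ 2 * n := by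
      rw [← Real.log_le_log_iff hy0 (by positivity), Real.log_mul (by norm_num) hn0.ne']; linarith
    refine ⟨?_, h1, h2⟩
    rw [hs', Finset.mem_filter, Finset.mem_Ioc]
    exact ⟨⟨hn, Nat.le_floor h1⟩, abs_lt.2 h⟩
  have hle : 2 * I1 - I2 ≤ ∑ n ∈ s', (2 / δ) * (2 / y) * ArithmeticFunction.vonMangoldt n := by
    have hnn : ∀ n : ℕ, 0 ≤ ArithmeticFunction.vonMangoldt n * (n:ℝ)^(-σ) := fun n => mul_nonneg ArithmeticFunction.vonMangoldt_nonneg (by positivity)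
    have h1 : 2 * I1 - I2 ≤ ∑ n ∈ s', (2 * (ArithmeticFunction.vonMangoldt n * (n:ℝ)^(-σ) * gg δ (q^4 - log n)) - ArithmeticFunction.vonMangoldt n * (n:ℝ)^(-σ) * gg (2*δ) (q^4 - log n)) := by
      have := sum_le_hasSum s' (fun n hn => ?_) S.neg
      · rw [Finset.sum_neg_distrib] at this
        linarith
      · have hm2 := gg_minorant' hδ0 (q^4 - log n)
        rcases Nat.eq_zero_or_pos n with rfl | hn0
        · simp
        have : ¬ |q^4 - log n| < δ := by
          intro h
          rw [hq4] at h
          exact hn (hmem n hn0 h).1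
        rw [if_neg this] at hm2
        have := mul_nonneg (hnn n) (neg_nonneg.2 hm2)
        linarith
    refine h1.trans (Finset.sum_le_sum fun n hn => ?_)
    rw [hs', Finset.mem_filter, Finset.mem_Ioc] at hn
    obtain ⟨-, hn1, hn2⟩ := hmem n hn.1.1 hn.2
    have hn0 : (1:ℝ) ≤ n := by exact_mod_cast hn.1.1
    have hm2 := gg_minorant' hδ0 (q^4 - log n)
    have h3 : 2 * gg δ (q^4 - log n) - gg (2*δ) (q^4 - log n) ≤ 2 / δ := by
      refine hm2.trans ?_
      split_ifs
      · exact le_rfl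
      · positivity
    have h4 : (n:ℝ)^(-σ) ≤ 2 / y := by
      calc (n:ℝ)^(-σ) ≤ (n:ℝ)^(-1:ℝ) := Real.rpow_le_rpow_of_exponent_le hn0 (by linarith)
        _ = 1 / n := by rw [Real.rpow_neg_one]; ring
        _ ≤ 2 / y := by rw [div_le_div_iff₀ (by linarith) hy0]; linarith
    have h5 := mul_le_mul_of_nonneg_left h3 (hnn n)
    have h6 : ArithmeticFunction.vonMangoldt n * (n:ℝ)^(-σ) * (2/δ) ≤ ArithmeticFunction.vonMangoldt n * (2/y) * (2/δ) :=
      mul_le_mul_of_nonneg_right (mul_le_mul_of_nonneg_left h4 ArithmeticFunction.vonMangoldt_nonneg) (by positivity)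
    linarith
  rw [← Finset.mul_sum] at hle
  have hL : y * δ / 40 ≤ ∑ n ∈ s', ArithmeticFunction.vonMangoldt n := by
    have h1 : 1/10 ≤ 2 / δ * (2 / y) * ∑ n ∈ s', ArithmeticFunction.vonMangoldt n := hI.trans hle
    have e : 2 / δ * (2 / y) * ∑ n ∈ s', ArithmeticFunction.vonMangoldt n = (4 * ∑ n ∈ s', ArithmeticFunction.vonMangoldt n) / (δ * y) := by field_simp; ring
    rw [e, le_div_iff₀ (by positivity)] at h1
    linarith
  have hM1 : 1 ≤ M := by
    apply Nat.le_floor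
    have : 1 ≤ y := le_trans (Real.one_le_exp (by positivity)) hy
    push_cast; linarith
  have hpp : ∑ n ∈ s', (ArithmeticFunction.vonMangoldt n - pw n) ≤ y * δ / 80 := by
    have h1 : ∑ n ∈ s', (ArithmeticFunction.vonMangoldt n - pw n) ≤ ∑ n ∈ Finset.Ioc 0 M, (ArithmeticFunction.vonMangoldt n - pw n) :=
      Finset.sum_le_sum_of_subset_of_nonneg (Finset.filter_subset _ _) (fun n _ _ => sub_nonneg.2 (pw_le_vM n))
    refine h1.trans ((sum_vM_sub_pw M hM1).trans ?_)
    have hMy : (M:ℝ) ≤ 2 * y := Nat.floor_le (by positivity)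
    have hM0 : (1:ℝ) ≤ M := by exact_mod_cast hM1
    have h2 : √(M:ℝ) ≤ 3/2 * exp (q^4/2) := by
      have : √(M:ℝ) ≤ √(2*y) := Real.sqrt_le_sqrt hMy
      refine this.trans ?_
      rw [Real.sqrt_le_left (by positivity)]
      rw [mul_pow, ← Real.exp_nat_mul]
      have : exp (((2:ℕ):ℝ) * (q^4/2)) = y := by
        rw [hq4]; push_cast; rw [mul_div_cancel₀ _ (by norm_num), Real.exp_log hy0]
      rw [this]; linarith
    have h3 : log (M:ℝ) ≤ q^4 + 1 := by
      have : log (M:ℝ) ≤ log (2*y) := Real.log_le_log (by linarith) hMy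
      rw [Real.log_mul (by norm_num) hy0.ne'] at this
      linarith [Real.log_two_lt_d9]
    have hl0 : 0 ≤ log (M:ℝ) := Real.log_natCast_nonneg _
    have h4 : 240 * (q^4 + 1) ≤ exp (q^4/2 - q) := by
      have hX : 10000 ≤ q^4 := by
        have := pow_le_pow_left₀ (by norm_num) hq10 4
        norm_num at this; exact this
      have hq3 : 4 ≤ q^3 := by
        have := pow_le_pow_left₀ (by norm_num) hq10 3
        norm_num at this; linarith
      have h5 : q^4/4 ≤ q^4/2 - q := by nlinarith
      refine le_trans ?_ (Real.exp_le_exp.2 h5)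
      have := Real.quadratic_le_exp_of_nonneg (x := q^4/4) (by positivity)
      nlinarith
    calc 2 * √(M:ℝ) * log M ≤ 2 * (3/2 * exp (q^4/2)) * (q^4 + 1) :=
          mul_le_mul (mul_le_mul_of_nonneg_left h2 (by norm_num)) h3 hl0 (by positivity)
      _ = exp (q^4/2) * (240 * (q^4+1)) / 80 := by ring
      _ ≤ exp (q^4/2) * exp (q^4/2 - q) / 80 := by
          apply div_le_div_of_nonneg_right _ (by norm_num)
          exact mul_le_mul_of_nonneg_left h4 (exp_pos _).le
      _ = y * exp (-q) / 80 := by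
          rw [← Real.exp_add]
          have : q^4/2 + (q^4/2 - q) = log y + -q := by rw [← hq4]; ring
          rw [this, Real.exp_add, Real.exp_log hy0]
      _ ≤ y * δ / 80 := by
          apply div_le_div_of_nonneg_right _ (by norm_num)
          exact mul_le_mul_of_nonneg_left hδ hy0.le
  rw [Finset.sum_sub_distrib] at hpp
  have hfin : ∑ n ∈ s', pw n ≤ ∑ n ∈ s, pw n := by
    apply Finset.sum_le_sum_of_subset_of_nonneg
    · intro n hn
      rw [hs', Finset.mem_filter, Finset.mem_Ioc] at hn
      exact hs n hn.1.1 hn.2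
    · intro n _ _; exact pw_nonneg n
  linarith
end

section
open Real MeasureTheory

lemma gw_mul (h k x : ℝ) : gw h x * gw k x = gw (√(h^2+k^2)) x := by
  unfold gw
  rw [← Real.exp_add, Real.sq_sqrt (by positivity)]; congr 1; ring

lemma gg_conv_fourier {h k : ℝ} (hh : 0 < h) (hk : 0 < k) (u v : ℝ) :
    ((∫ R, gg h (u - R) * gg k (v - R) : ℝ) : ℂ) = ∫ x : ℝ, ((gw h x * gw k x : ℝ) : ℂ) * ee ((u - v) * x) := by
  have hs : 0 < √(h^2+k^2) := Real.sqrt_pos.2 (by positivity)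
  rw [gg_conv hh hk, ← gg_fourier hs]
  simp_rw [gw_mul]

lemma gg_conv_fourier2 {h H : ℝ} (hh : 0 < h) (hH : 0 < H) (u v : ℝ) :
    ((∫ R, (gg h (u - R) - gg H (u - R)) * (gg h (v - R) - gg H (v - R)) : ℝ) : ℂ) = ∫ x : ℝ, (((gw h x - gw H x)^2 : ℝ) : ℂ) * ee ((u - v) * x) := by
  have i : ∀ a b : ℝ, 0 < a → 0 < b → Integrable (fun x : ℝ => ((gw a x * gw b x : ℝ) : ℂ) * ee ((u-v)*x)) := by
    intro a b ha hb
    have c1 := gw_cont a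
    have c2 := gw_cont b
    have c3 : Continuous ee := by unfold ee; fun_prop
    refine Integrable.mono' (gw_int ha) (Continuous.aestronglyMeasurable (by fun_prop)) ?_
    filter_upwards with x
    rw [norm_mul, norm_ee, mul_one, Complex.norm_real, Real.norm_eq_abs, abs_of_pos (mul_pos (gw_pos _ _) (gw_pos _ _))]
    have := gw_le_one b x
    have := gw_pos a x
    nlinarith
  have e1 : ∀ x : ℝ, (((gw h x - gw H x)^2 : ℝ) : ℂ) * ee ((u - v) * x) = (((gw h x * gw h x : ℝ) : ℂ) * ee ((u-v)*x) - ((gw h x * gw H x : ℝ) : ℂ) * ee ((u-v)*x)) - (((gw H x * gw h x : ℝ) : ℂ) * ee ((u-v)*x) - ((gw H x * gw H x : ℝ) : ℂ) * ee ((u-v)*x)) := by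
    intro x; push_cast; ring
  have e2 : ∀ R : ℝ, (gg h (u - R) - gg H (u - R)) * (gg h (v - R) - gg H (v - R)) = (gg h (u-R) * gg h (v-R) - gg h (u-R) * gg H (v-R)) - (gg H (u-R) * gg h (v-R) - gg H (u-R) * gg H (v-R)) := by
    intro R; ring
  simp_rw [e1, e2]
  rw [integral_sub, integral_sub, integral_sub, integral_sub, integral_sub, integral_sub, ← gg_conv_fourier hh hh, ← gg_conv_fourier hh hH, ← gg_conv_fourier hH hh, ← gg_conv_fourier hH hH]
  · push_cast; ring
  all_goals first | exact i _ _ hh hh | exact i _ _ hh hH | exact i _ _ hH hh | exact i _ _ hH hH | exact gg_mul_int hh hh u v | exact gg_mul_int hh hH u v | exact gg_mul_int hH hh u v | exact gg_mul_int hH hH u v | exact (gg_mul_int hh hh u v).sub (gg_mul_int hh hH u v) | exact (gg_mul_int hH hh u v).sub (gg_mul_int hH hH u v) | exact (i _ _ hh hh).sub (i _ _ hh hH) | exact (i _ _ hH hh).sub (i _ _ hH hH)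

lemma ggd_int {h H : ℝ} (hh : 0 < h) (hH : 0 < H) (u v : ℝ) : Integrable (fun R => (gg h (u - R) - gg H (u - R)) * (gg h (v - R) - gg H (v - R))) := by
  have e2 : (fun R : ℝ => (gg h (u - R) - gg H (u - R)) * (gg h (v - R) - gg H (v - R))) = fun R => (gg h (u-R) * gg h (v-R) - gg h (u-R) * gg H (v-R)) - (gg H (u-R) * gg h (v-R) - gg H (u-R) * gg H (v-R)) := by
    ext R; ring
  rw [e2]
  exact ((gg_mul_int hh hh u v).sub (gg_mul_int hh hH u v)).sub ((gg_mul_int hH hh u v).sub (gg_mul_int hH hH u v))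

lemma plancherel {ι : Type*} (s : Finset ι) (w lam : ι → ℝ) {h H : ℝ} (hh : 0 < h) (hH : 0 < H) :
    Integrable (fun R => (∑ p ∈ s, w p * (gg h (lam p - R) - gg H (lam p - R)))^2) ∧
    ∫ R, (∑ p ∈ s, w p * (gg h (lam p - R) - gg H (lam p - R)))^2 = ∫ x, ‖∑ p ∈ s, (w p : ℂ) * ee (lam p * x)‖^2 * (gw h x - gw H x)^2 := by
  have e1 : ∀ R : ℝ, (∑ p ∈ s, w p * (gg h (lam p - R) - gg H (lam p - R)))^2 = ∑ p ∈ s, ∑ q ∈ s, (w p * w q) * ((gg h (lam p - R) - gg H (lam p - R)) * (gg h (lam q - R) - gg H (lam q - R))) := by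
    intro R
    rw [sq, Finset.sum_mul_sum]
    refine Finset.sum_congr rfl fun p _ => Finset.sum_congr rfl fun q _ => by ring
  simp_rw [e1]
  constructor
  · exact integrable_finsetSum _ fun p _ => integrable_finsetSum _ fun q _ => (ggd_int hh hH _ _).const_mul _
  rw [integral_finsetSum _ fun p _ => integrable_finsetSum _ fun q _ => (ggd_int hh hH _ _).const_mul _]
  simp_rw [integral_finsetSum _ fun q _ => (ggd_int hh hH _ _).const_mul _, integral_const_mul]
  rw [← Complex.ofReal_inj, ← integral_complex_ofReal]
  push_cast
  simp_rw [gg_conv_fourier2 hh hH]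
  have i : ∀ u : ℝ, Integrable (fun x : ℝ => (((gw h x - gw H x)^2 : ℝ) : ℂ) * ee (u*x)) := by
    intro u
    have c1 := gw_cont h
    have c2 := gw_cont H
    have c3 : Continuous ee := by unfold ee; fun_prop
    refine Integrable.mono' ((gw_int hh).add (gw_int hH)) (Continuous.aestronglyMeasurable (by fun_prop)) ?_
    filter_upwards with x
    rw [norm_mul, norm_ee, mul_one, Complex.norm_real, Real.norm_eq_abs, abs_of_nonneg (sq_nonneg _)]
    have := gw_le_one h x
    have := gw_pos h x
    have := gw_le_one H x
    have := gw_pos H x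
    simp only [Pi.add_apply]
    nlinarith
  have e3 : ∀ x : ℝ, (‖∑ p ∈ s, (w p : ℂ) * ee (lam p * x)‖ : ℂ)^2 * ((gw h x : ℂ) - (gw H x : ℂ))^2 = ∑ p ∈ s, ∑ q ∈ s, ((w p : ℂ) * (w q : ℂ)) * ((((gw h x - gw H x)^2 : ℝ) : ℂ) * ee ((lam p - lam q) * x)) := by
    intro x
    have : (‖∑ p ∈ s, (w p : ℂ) * ee (lam p * x)‖ : ℂ)^2 = (∑ p ∈ s, (w p : ℂ) * ee (lam p * x)) * (∑ q ∈ s, (w q : ℂ) * ee (-(lam q * x))) := by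
      rw [← Complex.mul_conj', map_sum]
      congr 1
      refine Finset.sum_congr rfl fun p _ => ?_
      rw [map_mul, Complex.conj_ofReal, conj_ee]
    rw [this, Finset.sum_mul_sum, Finset.sum_mul]
    refine Finset.sum_congr rfl fun p _ => ?_
    rw [Finset.sum_mul]
    refine Finset.sum_congr rfl fun q _ => ?_
    have : ee ((lam p - lam q) * x) = ee (lam p * x) * ee (-(lam q * x)) := by rw [← ee_add]; congr 1; ring
    rw [this]; push_cast; ring
  simp_rw [e3]
  rw [integral_finsetSum _ fun p _ => integrable_finsetSum _ fun q _ => (i _).const_mul _]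
  simp_rw [integral_finsetSum _ fun q _ => (i _).const_mul _, integral_const_mul]
end

section
open Real MeasureTheory

noncomputable def AA (c : ℝ) (N : ℕ) (h R : ℝ) : ℝ :=
  ∑ p ∈ Finset.Ioc (N/4) N ×ˢ Finset.Ioc (N/4) N, (pw p.1 * pw p.2) * gg h ((p.1:ℝ)^c + (p.2:ℝ)^c - R)

lemma SS_sq (c : ℝ) (N : ℕ) (x : ℝ) : ∑ p ∈ Finset.Ioc (N/4) N ×ˢ Finset.Ioc (N/4) N, ((pw p.1 * pw p.2 : ℝ) : ℂ) * ee (((p.1:ℝ)^c + (p.2:ℝ)^c) * x) = SS c N x ^ 2 := by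
  unfold SS EE
  rw [sq, Finset.sum_mul_sum, Finset.sum_product]
  refine Finset.sum_congr rfl fun m _ => Finset.sum_congr rfl fun n _ => ?_
  have : ee (((m:ℝ)^c + (n:ℝ)^c) * x) = ee (x * (m:ℝ)^c) * ee (x * (n:ℝ)^c) := by rw [← ee_add]; congr 1; ring
  simp only
  rw [this]; push_cast; ring

lemma AA_l2 (c : ℝ) (N : ℕ) {h H : ℝ} (hh : 0 < h) (hH : 0 < H) :
    Integrable (fun R => (AA c N h R - AA c N H R)^2) ∧ ∫ R, (AA c N h R - AA c N H R)^2 = ∫ x, ‖SS c N x‖^4 * (gw h x - gw H x)^2 := by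
  have := plancherel (Finset.Ioc (N/4) N ×ˢ Finset.Ioc (N/4) N) (fun p => pw p.1 * pw p.2) (fun p => (p.1:ℝ)^c + (p.2:ℝ)^c) hh hH
  have e : ∀ R, ∑ p ∈ Finset.Ioc (N/4) N ×ˢ Finset.Ioc (N/4) N, (pw p.1 * pw p.2) * (gg h ((p.1:ℝ)^c + (p.2:ℝ)^c - R) - gg H ((p.1:ℝ)^c + (p.2:ℝ)^c - R)) = AA c N h R - AA c N H R := by
    intro R; unfold AA; rw [← Finset.sum_sub_distrib]
    exact Finset.sum_congr rfl fun p _ => by ring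
  simp_rw [e, SS_sq, norm_pow, ← pow_mul] at this
  exact this

lemma SS_triv (c : ℝ) (N : ℕ) (x : ℝ) : ‖SS c N x‖ ≤ N * (1 + log N) := by
  have hl0 : 0 ≤ log (N:ℝ) := Real.log_natCast_nonneg N
  unfold SS
  refine (norm_sum_le _ _).trans ?_
  calc ∑ n ∈ Finset.Ioc (N/4) N, ‖(pw n : ℂ) * EE x c n‖ ≤ ∑ n ∈ Finset.Ioc (N/4) N, (1 + log (N:ℝ)) := by
        refine Finset.sum_le_sum fun n hn => ?_
        rw [Finset.mem_Ioc] at hn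
        rw [norm_mul, norm_EE, mul_one, Complex.norm_real, Real.norm_eq_abs, abs_of_nonneg (pw_nonneg n)]
        refine (pw_le_log n).trans ?_
        have : log (n:ℝ) ≤ log (N:ℝ) := Real.log_le_log (by exact_mod_cast (by omega : 0 < n)) (by exact_mod_cast hn.2)
        linarith
    _ = ((N - N/4 : ℕ) : ℝ) * (1 + log N) := by rw [Finset.sum_const, Nat.card_Ioc, nsmul_eq_mul]
    _ ≤ N * (1 + log N) := by
        apply mul_le_mul_of_nonneg_right _ (by linarith)
        exact_mod_cast Nat.sub_le _ _

lemma SS_neg (c : ℝ) (N : ℕ) (x : ℝ) : ‖SS c N (-x)‖ = ‖SS c N x‖ := by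
  have : SS c N (-x) = (starRingEnd ℂ) (SS c N x) := by
    unfold SS EE
    rw [map_sum]
    refine Finset.sum_congr rfl fun n _ => ?_
    rw [map_mul, Complex.conj_ofReal, conj_ee]; congr 2; ring
  rw [this, Complex.norm_conj]

lemma gw_abs (r x : ℝ) : gw r |x| = gw r x := by unfold gw; rw [sq_abs]

lemma gw_diff {h H : ℝ} (hh : 0 < h) (hhH : h ≤ H) (x : ℝ) : 0 ≤ gw h x - gw H x ∧ gw h x - gw H x ≤ gw h x ∧ gw h x - gw H x ≤ π * H^2 * x^2 := by
  have hp := pi_pos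
  refine ⟨?_, ?_, ?_⟩
  · have : gw H x ≤ gw h x := by
      unfold gw; apply Real.exp_le_exp.2
      have h1 : h^2 ≤ H^2 := pow_le_pow_left₀ hh.le hhH 2
      have : π * h^2 * x^2 ≤ π * H^2 * x^2 := mul_le_mul_of_nonneg_right (mul_le_mul_of_nonneg_left h1 hp.le) (sq_nonneg _)
      linarith
    linarith
  · have := gw_pos H x; linarith
  · have h1 := gw_le_one h x
    have h2 : 1 - π * H^2 * x^2 ≤ gw H x := by
      unfold gw
      have := Real.add_one_le_exp (-(π * H^2) * x^2)
      linarith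
    linarith

noncomputable def DC (c : ℝ) : ℝ := 2 * (17 + 2 * mC c)

set_option maxHeartbeats 1000000 in
lemma AA_bound {c : ℝ} (hc : 1 < c) (hc2 : c < 39/29) (N W : ℕ) (hN : 2^50 ≤ N) (hW : 2 ≤ W) (hWN : (W:ℝ) ≤ (N:ℝ)^((1:ℝ)/5000))
    (hbig : 2 * (N:ℝ)^3 ≤ exp ((N:ℝ)^((1:ℝ)/1000))) {h : ℝ} (hh1 : (N:ℝ)^(-(1:ℝ)/2000) ≤ h) (hhH : h ≤ (N:ℝ)^c/W^2) :
    ∫ R, (AA c N h R - AA c N ((N:ℝ)^c/W^2) R)^2 ≤ DC c * (1 + log N)^14 * ((N:ℝ)^(4-c) / W) := by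
  have hp := pi_gt_three
  have hp4 := pi_lt_four
  have hNr : (2:ℝ)^50 ≤ N := by exact_mod_cast hN
  have hN1 : (1:ℝ) ≤ N := le_trans (by norm_num) hNr
  have hN0 : (0:ℝ) < N := by linarith
  have hmono : ∀ {u v : ℝ}, u ≤ v → (N:ℝ)^u ≤ (N:ℝ)^v := fun h => Real.rpow_le_rpow_of_exponent_le hN1 h
  have hadd : ∀ u v : ℝ, (N:ℝ)^u * (N:ℝ)^v = (N:ℝ)^(u+v) := fun u v => (Real.rpow_add hN0 u v).symm
  have hW2 : (2:ℝ) ≤ W := by exact_mod_cast hW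
  have hW0 : (0:ℝ) < W := by linarith
  have hl0 : 0 ≤ log (N:ℝ) := Real.log_natCast_nonneg N
  set H := (N:ℝ)^c/W^2 with hH
  have hNc : 0 < (N:ℝ)^c := by positivity
  have hh : 0 < h := lt_of_lt_of_le (by positivity) hh1
  have hH0 : 0 < H := by positivity
  rw [(AA_l2 c N hh hH0).2]
  set l := 1 + log (N:ℝ) with hl
  have hl1 : 1 ≤ l := by linarith
  set G : ℝ → ℝ := fun x => ‖SS c N x‖^4 * (gw h x - gw H x)^2 with hG
  have hGc : Continuous G := by
    have c1 := gw_cont h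
    have c2 := gw_cont H
    have c3 := cont_SS c N
    simp only [hG]; fun_prop
  have hG0 : ∀ x, 0 ≤ G x := fun x => by simp only [hG]; positivity
  set B := (N * l)^4 with hB
  have hB0 : 0 ≤ B := by positivity
  have hSB : ∀ x, ‖SS c N x‖^4 ≤ B := fun x => pow_le_pow_left₀ (norm_nonneg _) (SS_triv c N x) 4
  have hGg : ∀ x, G x ≤ B * gw h x := by
    intro x
    obtain ⟨d1, d2, d3⟩ := gw_diff hh hhH x
    apply mul_le_mul (hSB x) _ (sq_nonneg _) hB0
    have := gw_le_one h x
    nlinarith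
  have hGi : Integrable G := by
    refine Integrable.mono' ((gw_int hh).const_mul B) hGc.aestronglyMeasurable ?_
    filter_upwards with x
    rw [Real.norm_eq_abs, abs_of_nonneg (hG0 x)]; exact hGg x
  have hGabs : ∀ x, G x = G |x| := by
    intro x
    simp only [hG, gw_abs]
    rcases abs_choice x with h | h
    · rw [h]
    · rw [h, SS_neg]
  have e1 : ∫ x, G x = 2 * ∫ x in Set.Ioi (0:ℝ), G x := by
    rw [← integral_comp_abs]
    exact integral_congr_ae (Filter.Eventually.of_forall hGabs)
  rw [show (∫ x, ‖SS c N x‖^4 * (gw h x - gw H x)^2) = ∫ x, G x from rfl, e1]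
  set X := W / (N:ℝ)^c with hX
  set Q := (N:ℝ)^((1:ℝ)/1000) with hQ
  have hX0 : 0 < X := by positivity
  have hX1 : X ≤ 1 := by
    rw [hX, div_le_one hNc]
    exact hWN.trans (hmono (by linarith))
  have hQ1 : 1 ≤ Q := Real.one_le_rpow hN1 (by norm_num)
  have hXQ : X ≤ Q := hX1.trans hQ1
  have split : ∫ x in Set.Ioi (0:ℝ), G x = (∫ x in (0:ℝ)..X, G x) + (∫ x in X..Q, G x) + ∫ x in Set.Ioi Q, G x := by
    rw [intervalIntegral.integral_add_adjacent_intervals (hGc.intervalIntegrable _ _) (hGc.intervalIntegrable _ _)]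
    rw [intervalIntegral.integral_interval_add_Ioi hGi.integrableOn hGi.integrableOn]
  have p1 : ∫ x in (0:ℝ)..X, G x ≤ 16 * l^14 * ((N:ℝ)^(4-c) / W) := by
    have hpt : ∀ x ∈ Set.uIoc 0 X, ‖G x‖ ≤ B * (π / W^2)^2 := by
      intro x hx
      rw [Set.uIoc_of_le hX0.le] at hx
      rw [Real.norm_eq_abs, abs_of_nonneg (hG0 x)]
      obtain ⟨d1, d2, d3⟩ := gw_diff hh hhH x
      apply mul_le_mul (hSB x) _ (sq_nonneg _) hB0
      apply pow_le_pow_left₀ d1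
      refine d3.trans ?_
      have hx2 : x^2 ≤ X^2 := pow_le_pow_left₀ hx.1.le hx.2 2
      calc π * H^2 * x^2 ≤ π * H^2 * X^2 := mul_le_mul_of_nonneg_left hx2 (by positivity)
        _ = π / W^2 := by rw [hH, hX]; field_simp
    have h2 := (le_abs_self _).trans (intervalIntegral.norm_integral_le_of_norm_le_const hpt)
    refine h2.trans ?_
    rw [sub_zero, abs_of_pos hX0]
    have e2 : B * (π / W^2)^2 * X = π^2 * (l^4 * ((N:ℝ)^(4-c) / W)) * (1/W^2) := by
      have : (N:ℝ)^(4-c) = (N:ℝ)^4 / (N:ℝ)^c := by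
        rw [Real.rpow_sub hN0]; norm_num
      rw [this, hB, hX]; field_simp
    rw [e2]
    have hl4 : l^4 ≤ l^14 := pow_le_pow_right₀ hl1 (by norm_num)
    have h3 : 1/(W:ℝ)^2 ≤ 1 := by rw [div_le_one (by positivity)]; nlinarith
    have h4 : π^2 ≤ 16 := by nlinarith
    have h5 : l^4 * ((N:ℝ)^(4-c) / W) ≤ l^14 * ((N:ℝ)^(4-c) / W) := mul_le_mul_of_nonneg_right hl4 (by positivity)
    have h6 : 0 ≤ l^4 * ((N:ℝ)^(4-c) / W) := by positivity
    calc π^2 * (l^4 * ((N:ℝ)^(4-c) / W)) * (1/(W:ℝ)^2) ≤ π^2 * (l^4 * ((N:ℝ)^(4-c) / W)) * 1 := mul_le_mul_of_nonneg_left h3 (by positivity)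
      _ ≤ 16 * (l^14 * ((N:ℝ)^(4-c) / W)) := by
        rw [mul_one]; exact mul_le_mul h4 h5 h6 (by norm_num)
      _ = _ := by ring
  have p2 : ∫ x in X..Q, G x ≤ 2 * mC c * l^14 * ((N:ℝ)^(4-c) / W) := by
    have hm := minor_pos hc hc2 N W hN hW (hWN.trans (hmono (by norm_num)))
    have h1 : ∫ x in X..Q, G x ≤ ∫ x in X..Q, ‖SS c N x‖^4 := by
      apply intervalIntegral.integral_mono_on hXQ (hGc.intervalIntegrable _ _) (((cont_SS c N).norm.pow 4).intervalIntegrable _ _)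
      intro x _
      obtain ⟨d1, d2, d3⟩ := gw_diff hh hhH x
      have := gw_le_one h x
      have h4 : (gw h x - gw H x)^2 ≤ 1 := by nlinarith
      have h5 : 0 ≤ ‖SS c N x‖^4 := by positivity
      show ‖SS c N x‖^4 * (gw h x - gw H x)^2 ≤ ‖SS c N x‖^4
      nlinarith
    refine h1.trans (hm.trans ?_)
    have hm0 : 0 ≤ mC c := by unfold mC; have := ppC_pos hc; positivity
    have h2 : (N:ℝ)^(4-c-1/5000) ≤ (N:ℝ)^(4-c) / W := by
      rw [le_div_iff₀ hW0]
      calc (N:ℝ)^(4-c-1/5000) * W ≤ (N:ℝ)^(4-c-1/5000) * (N:ℝ)^((1:ℝ)/5000) := mul_le_mul_of_nonneg_left hWN (by positivity)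
        _ = (N:ℝ)^(4-c) := by rw [hadd]; congr 1; ring
    have h3 : mC c * l^14 * ((N:ℝ)^(4-c) / W + (N:ℝ)^(4-c-1/5000)) ≤ mC c * l^14 * ((N:ℝ)^(4-c) / W + (N:ℝ)^(4-c)/W) :=
      mul_le_mul_of_nonneg_left (by linarith) (by positivity)
    linarith
  have p3 : ∫ x in Set.Ioi Q, G x ≤ 1 * l^14 * ((N:ℝ)^(4-c) / W) := by
    have i3 : Integrable (fun x => B * (exp (-(3/4 * (π * h^2 * Q^2))) * gw (h/2) x)) := ((gw_int (by linarith)).const_mul _).const_mul _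
    have h1 : ∫ x in Set.Ioi Q, G x ≤ ∫ x in Set.Ioi Q, B * (exp (-(3/4 * (π * h^2 * Q^2))) * gw (h/2) x) := by
      apply setIntegral_mono_on hGi.integrableOn i3.integrableOn measurableSet_Ioi
      intro x hx
      refine (hGg x).trans (mul_le_mul_of_nonneg_left (gw_tail (by linarith) ?_) hB0)
      exact (le_of_lt hx).trans (le_abs_self x)
    have h2 := setIntegral_le_integral (s := Set.Ioi Q) i3 (by
      filter_upwards with x
      have := gw_pos (h/2) x
      simp only [Pi.zero_apply]; positivity)
    refine (h1.trans h2).trans ?_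
    rw [integral_const_mul, integral_const_mul, gw_integral (by linarith)]
    have hhQ : (N:ℝ)^((1:ℝ)/2000) ≤ h * Q := by
      calc (N:ℝ)^((1:ℝ)/2000) = (N:ℝ)^(-(1:ℝ)/2000) * Q := by rw [hQ, hadd]; norm_num
        _ ≤ h * Q := mul_le_mul_of_nonneg_right hh1 (by linarith)
    have hhQ2 : Q ≤ h^2 * Q^2 := by
      calc Q = ((N:ℝ)^((1:ℝ)/2000))^2 := by rw [hQ, ← Real.rpow_natCast, ← Real.rpow_mul hN0.le]; norm_num
        _ ≤ (h * Q)^2 := pow_le_pow_left₀ (by positivity) hhQ 2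
        _ = _ := by ring
    have h3 : exp (-(3/4 * (π * h^2 * Q^2))) ≤ 1 / (2 * (N:ℝ)^3) := by
      have a1 : -(3/4 * (π * h^2 * Q^2)) ≤ -Q := by nlinarith
      calc exp (-(3/4 * (π * h^2 * Q^2))) ≤ exp (-Q) := Real.exp_le_exp.2 a1
        _ = 1 / exp Q := by rw [Real.exp_neg]; ring
        _ ≤ _ := one_div_le_one_div_of_le (by positivity) hbig
    have h4 : (h/2)⁻¹ ≤ 2 * (N:ℝ)^((1:ℝ)/2000) := by
      have : h⁻¹ ≤ ((N:ℝ)^(-(1:ℝ)/2000))⁻¹ := inv_anti₀ (by positivity) hh1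
      rw [← Real.rpow_neg hN0.le] at this
      norm_num at this ⊢
      have e : (h/2)⁻¹ = 2 * h⁻¹ := by field_simp
      calc _ = 2 * h⁻¹ := by field_simp
        _ ≤ _ := by linarith
    have h5 : exp (-(3/4 * (π * h^2 * Q^2))) * (h/2)⁻¹ ≤ 1 / (2 * (N:ℝ)^3) * (2 * (N:ℝ)^((1:ℝ)/2000)) :=
      mul_le_mul h3 h4 (by positivity) (by positivity)
    have h6 : 1 / (2 * (N:ℝ)^3) * (2 * (N:ℝ)^((1:ℝ)/2000)) ≤ (N:ℝ)^(-c) / W := by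
      have e : 1 / (2 * (N:ℝ)^3) * (2 * (N:ℝ)^((1:ℝ)/2000)) = (N:ℝ)^((1:ℝ)/2000 - 3) := by
        rw [Real.rpow_sub hN0]; norm_num; field_simp
      rw [e, le_div_iff₀ hW0]
      calc (N:ℝ)^((1:ℝ)/2000 - 3) * W ≤ (N:ℝ)^((1:ℝ)/2000 - 3) * (N:ℝ)^((1:ℝ)/5000) := mul_le_mul_of_nonneg_left hWN (by positivity)
        _ = (N:ℝ)^((1:ℝ)/2000 - 3 + 1/5000) := hadd _ _
        _ ≤ _ := hmono (by linarith)
    calc B * (exp (-(3/4 * (π * h^2 * Q^2))) * (h/2)⁻¹) ≤ B * ((N:ℝ)^(-c) / W) := mul_le_mul_of_nonneg_left (h5.trans h6) hB0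
      _ = l^4 * ((N:ℝ)^(4-c) / W) := by
        have : (N:ℝ)^(4-c) = (N:ℝ)^4 * (N:ℝ)^(-c) := by rw [sub_eq_add_neg, Real.rpow_add hN0]; norm_num
        rw [this, hB]; ring
      _ ≤ 1 * l^14 * ((N:ℝ)^(4-c) / W) := by
        rw [one_mul]
        exact mul_le_mul_of_nonneg_right (pow_le_pow_right₀ hl1 (by norm_num)) (by positivity)
  rw [split]
  have : DC c * l^14 * ((N:ℝ)^(4-c) / W) = 2 * (16 * l^14 * ((N:ℝ)^(4-c) / W) + 2 * mC c * l^14 * ((N:ℝ)^(4-c) / W) + 1 * l^14 * ((N:ℝ)^(4-c) / W)) := by unfold DC; ring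
  rw [this]
  linarith
end

section
open Real MeasureTheory

lemma AA_cont (c : ℝ) (N : ℕ) (h : ℝ) : Continuous (AA c N h) := by
  unfold AA
  refine continuous_finsetSum _ fun p _ => ?_
  exact continuous_const.mul ((gg_cont h).comp (by fun_prop))

lemma AA_cheb (c : ℝ) (N : ℕ) {h H ε I : ℝ} (hh : 0 < h) (hH : 0 < H) (hε : 0 < ε)
    (hI : ∫ R, (AA c N h R - AA c N H R)^2 ≤ I) :
    MeasurableSet {R | ε ≤ |AA c N h R - AA c N H R|} ∧
    volume {R | ε ≤ |AA c N h R - AA c N H R|} ≤ ENNReal.ofReal (I / ε^2) := by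
  have hm : MeasurableSet {R | ε ≤ |AA c N h R - AA c N H R|} :=
    (isClosed_le continuous_const (((AA_cont c N h).sub (AA_cont c N H)).abs)).measurableSet
  refine ⟨hm, ?_⟩
  have hintg := (AA_l2 c N hh hH).1
  have h1 := mul_meas_ge_le_lintegral₀ (μ := volume) (f := fun R => ENNReal.ofReal ((AA c N h R - AA c N H R)^2)) hintg.aemeasurable.ennreal_ofReal (ENNReal.ofReal (ε^2))
  rw [← ofReal_integral_eq_lintegral_ofReal hintg (Filter.Eventually.of_forall fun R => sq_nonneg _)] at h1
  have hs : {R | ε ≤ |AA c N h R - AA c N H R|} ⊆ {x | ENNReal.ofReal (ε ^ 2) ≤ ENNReal.ofReal ((AA c N h x - AA c N H x) ^ 2)} := by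
    intro R hR
    apply ENNReal.ofReal_le_ofReal
    rw [← sq_abs (AA c N h R - AA c N H R)]
    exact pow_le_pow_left₀ hε.le hR 2
  rw [ENNReal.ofReal_div_of_pos (by positivity), ENNReal.le_div_iff_mul_le (Or.inl (by simpa using by positivity)) (Or.inl ENNReal.ofReal_ne_top), mul_comm]
  exact (mul_le_mul_right (measure_mono hs) _).trans (h1.trans (ENNReal.ofReal_le_ofReal hI))


lemma count_lower {c η R h : ℝ} (N : ℕ) (hr : ∀ p ∈ Finset.Ioc (N/4) N, R^(1/c)/8 < (p:ℝ) ∧ (p:ℝ) ≤ R^(1/c))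
    (hh : 0 < h) (hhR : h ≤ R^(-η)) :
    2 * AA c N h R - AA c N (2*h) R ≤ 2/h * (log N)^2 * (countSol c η R 2 : ℝ) := by
  classical
  set P := Finset.Ioc (N/4) N ×ˢ Finset.Ioc (N/4) N with hP
  set F := P.filter (fun p => p.1.Prime ∧ p.2.Prime ∧ |(p.1:ℝ)^c + (p.2:ℝ)^c - R| < h) with hF
  have hcard : F.card ≤ countSol c η R 2 := by
    unfold countSol
    set T := {p : Fin 2 → ℕ | (∀ j, (p j).Prime ∧ R ^ (1/c) / 8 < (p j : ℝ) ∧ (p j : ℝ) ≤ R ^ (1/c)) ∧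
      |(∑ j, (p j : ℝ) ^ c) - R| < R ^ (-η)} with hT
    have hfin : T.Finite := by
      refine (Set.finite_Icc (0 : Fin 2 → ℕ) (fun _ => ⌊R^(1/c)⌋₊)).subset ?_
      rintro p ⟨hp, _⟩
      exact ⟨fun _ => Nat.zero_le _, fun j => Nat.le_floor (hp j).2.2⟩
    have : Finite T := hfin
    have hinj : F.card = Nat.card F := by rw [Nat.card_eq_fintype_card, Fintype.card_coe]
    rw [hinj]
    refine Nat.card_le_card_of_injective (β := T) (fun p : F => (⟨![p.1.1, p.1.2], ?_⟩ : T)) ?_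
    · obtain ⟨hpP, q1, q2, q3⟩ := Finset.mem_filter.1 p.2
      obtain ⟨m1, m2⟩ := Finset.mem_product.1 hpP
      refine ⟨fun j => ?_, ?_⟩
      · fin_cases j
        · exact ⟨q1, hr _ m1⟩
        · exact ⟨q2, hr _ m2⟩
      · rw [Fin.sum_univ_two]
        exact q3.trans_le hhR
    · intro p q hpq
      simp only [Subtype.mk.injEq] at hpq
      have h0 := congrFun hpq 0
      have h1 := congrFun hpq 1
      simp at h0 h1
      exact Subtype.ext (Prod.ext h0 h1)
  have h1 : 2 * AA c N h R - AA c N (2*h) R ≤ ∑ p ∈ P, if (p.1.Prime ∧ p.2.Prime ∧ |(p.1:ℝ)^c + (p.2:ℝ)^c - R| < h) then 2/h * (log N)^2 else 0 := by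
    unfold AA
    rw [Finset.mul_sum, ← Finset.sum_sub_distrib]
    refine Finset.sum_le_sum fun p hp => ?_
    rw [Finset.mem_product, Finset.mem_Ioc, Finset.mem_Ioc] at hp
    set u := (p.1:ℝ)^c + (p.2:ℝ)^c - R
    have hm := gg_minorant' hh u
    have l1 : ∀ n : ℕ, N/4 < n ∧ n ≤ N → pw n ≤ log N := fun n hn =>
      (pw_le_log n).trans (Real.log_le_log (by exact_mod_cast (by omega : 0 < n)) (by exact_mod_cast hn.2))
    have a1 := l1 _ hp.1
    have a2 := l1 _ hp.2
    have b1 := pw_nonneg p.1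
    have b2 := pw_nonneg p.2
    have e : 2 * (pw p.1 * pw p.2 * gg h u) - pw p.1 * pw p.2 * gg (2*h) u = pw p.1 * pw p.2 * (2 * gg h u - gg (2*h) u) := by ring
    rw [e]
    have h2 := mul_le_mul_of_nonneg_left hm (mul_nonneg b1 b2)
    refine h2.trans ?_
    by_cases c1 : p.1.Prime
    · by_cases c2 : p.2.Prime
      · by_cases c3 : |u| < h
        · rw [if_pos c3, if_pos ⟨c1, c2, c3⟩]
          have : pw p.1 * pw p.2 ≤ log N * log N := mul_le_mul a1 a2 b2 (b1.trans a1)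
          calc pw p.1 * pw p.2 * (2/h) ≤ log N * log N * (2/h) := mul_le_mul_of_nonneg_right this (by positivity)
            _ = _ := by ring
        · rw [if_neg c3, if_neg (fun t => c3 t.2.2)]; simp
      · simp [pw, c2]
    · simp [pw, c1]
  rw [← Finset.sum_filter, Finset.sum_const, nsmul_eq_mul] at h1
  refine h1.trans ?_
  rw [mul_comm]
  exact mul_le_mul_of_nonneg_left (by exact_mod_cast hcard) (by positivity)
end

section
open Real MeasureTheory

lemma near_pow {c y δ : ℝ} (hc : 0 < c) (hy : 0 < y) {n : ℕ} (hn : 1 ≤ n) (h : |log y - log n| < δ) (ht : c * δ ≤ 1) :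
    |(n:ℝ)^c - y^c| ≤ y^c * (c*δ + (c*δ)^2) := by
  have hn0 : (0:ℝ) < n := by exact_mod_cast hn
  set t := c * (log n - log y) with htd
  have e : (n:ℝ)^c = y^c * exp t := by
    rw [Real.rpow_def_of_pos hn0, Real.rpow_def_of_pos hy, ← Real.exp_add]; congr 1; rw [htd]; ring
  have h1 : |t| ≤ c * δ := by
    rw [htd, abs_mul, abs_of_pos hc, abs_sub_comm]; exact mul_le_mul_of_nonneg_left h.le hc.le
  have h2 := Real.abs_exp_sub_one_sub_id_le (h1.trans ht)
  have h3 : |exp t - 1| ≤ c*δ + (c*δ)^2 := by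
    have : |exp t - 1| ≤ |exp t - 1 - t| + |t| := by
      have := abs_add_le (exp t - 1 - t) t; simpa using this
    have h4 : t^2 ≤ (c*δ)^2 := by rw [← sq_abs]; exact pow_le_pow_left₀ (abs_nonneg _) h1 2
    linarith
  rw [e, show y^c * exp t - y^c = y^c * (exp t - 1) by ring, abs_mul, abs_of_pos (by positivity)]
  exact mul_le_mul_of_nonneg_left h3 (by positivity)

lemma mem_range_pow {c : ℝ} (hc : 1 < c) {N n : ℕ} (hN : 1 ≤ N) (h1 : (N:ℝ)^c/4 < (n:ℝ)^c) (h2 : (n:ℝ)^c ≤ (N:ℝ)^c) : n ∈ Finset.Ioc (N/4) N := by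
  have hN0 : (0:ℝ) < N := by exact_mod_cast hN
  rw [Finset.mem_Ioc]
  constructor
  · by_contra hcon
    push Not at hcon
    have a1 : (n:ℝ) ≤ N/4 := by
      have : 4 * n ≤ N := by omega
      have : (4:ℝ) * n ≤ N := by exact_mod_cast this
      linarith
    have a2 : (n:ℝ)^c ≤ (N/4:ℝ)^c := Real.rpow_le_rpow (by positivity) a1 (by linarith)
    rw [div_eq_mul_inv, Real.mul_rpow hN0.le (by norm_num)] at a2
    have a3 : ((4:ℝ)⁻¹)^c ≤ ((4:ℝ)⁻¹)^(1:ℝ) := Real.rpow_le_rpow_of_exponent_ge (by norm_num) (by norm_num) hc.le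
    rw [Real.rpow_one] at a3
    have a4 := mul_le_mul_of_nonneg_left a3 (by positivity : 0 ≤ (N:ℝ)^c)
    linarith
  · have := (Real.rpow_le_rpow_iff (by positivity) hN0.le (by linarith : 0 < c)).1 h2
    exact_mod_cast this

lemma root_ge {c : ℝ} (hc : 1 < c) {N z : ℝ} (hN : 0 < N) (hz : N^c/4 ≤ z) : N/4 ≤ z^(1/c) := by
  have hz0 : 0 ≤ z := le_trans (by positivity) hz
  have h1 : (N/4)^c ≤ z := by
    rw [div_eq_mul_inv, Real.mul_rpow hN.le (by norm_num)]
    have a3 : ((4:ℝ)⁻¹)^c ≤ ((4:ℝ)⁻¹)^(1:ℝ) := Real.rpow_le_rpow_of_exponent_ge (by norm_num) (by norm_num) hc.le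
    rw [Real.rpow_one] at a3
    have a4 := mul_le_mul_of_nonneg_left a3 (by positivity : 0 ≤ N^c)
    linarith
  have h2 := Real.rpow_le_rpow (by positivity) h1 (by positivity : 0 ≤ 1/c)
  rwa [← Real.rpow_mul (by positivity), mul_one_div_cancel (by linarith), Real.rpow_one] at h2

noncomputable def cE : ℝ := exp (-π) / 6144000

set_option maxHeartbeats 1000000 in
lemma AA_lower : ∃ y0 : ℝ, 1 ≤ y0 ∧ ∀ c : ℝ, 1 < c → c < 39/29 → ∀ N W : ℕ, 3 ≤ W → 4 * y0 ≤ N →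
    exp (-(log ((N:ℝ)/4))^((1:ℝ)/4)) ≤ 1/(3*(W:ℝ)^2) → ∀ R : ℝ, (N:ℝ)^c ≤ R → R ≤ 1.65 * (N:ℝ)^c →
    cE * (N:ℝ)^(2-c) ≤ AA c N ((N:ℝ)^c/W^2) R := by
  classical
  obtain ⟨y0, hy1, hy⟩ := prime_short
  refine ⟨y0, hy1, ?_⟩
  intro c hc hc2 N W hW hN hδ R hR1 hR2
  have hN4 : (4:ℝ) ≤ N := by linarith
  have hN0 : (0:ℝ) < N := by linarith
  have hN1 : 1 ≤ N := by exact_mod_cast (by linarith : (1:ℝ) ≤ N)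
  have hc0 : 0 < c := by linarith
  have hW3 : (3:ℝ) ≤ W := by exact_mod_cast hW
  have hW9 : (9:ℝ) ≤ (W:ℝ)^2 := by nlinarith
  have hW0 : (0:ℝ) < W := by linarith
  set M := (N:ℝ)^c with hM
  have hM0 : 0 < M := by positivity
  set H := M / (W:ℝ)^2 with hH
  have hH0 : 0 < H := by positivity
  set δ : ℝ := 1/(3*(W:ℝ)^2) with hδd
  have hδ0 : 0 < δ := by positivity
  have hδW : δ * (W:ℝ)^2 = 1/3 := by rw [hδd]; field_simp
  have hδ20 : δ ≤ 1/27 := by nlinarith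
  have hmono : ∀ y : ℝ, (N:ℝ)/4 ≤ y → exp (-(log y)^((1:ℝ)/4)) ≤ δ := by
    intro y hyN
    refine le_trans (Real.exp_le_exp.2 (neg_le_neg ?_)) hδ
    refine Real.rpow_le_rpow (Real.log_nonneg (by linarith)) (Real.log_le_log (by positivity) hyN) (by norm_num)
  have hpow : ∀ z : ℝ, 0 ≤ z → (z^(1/c))^c = z := fun z hz => by
    rw [← Real.rpow_mul hz, one_div_mul_cancel (by linarith), Real.rpow_one]
  set y1 := (R/2)^(1/c) with hy1d
  have hR0 : 0 < R := by linarith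
  have hy1N : (N:ℝ)/4 ≤ y1 := root_ge hc hN0 (by linarith)
  set I := Finset.Ioc (N/4) N with hI
  set S1 := I.filter (fun n : ℕ => |(n:ℝ)^c - R/2| ≤ R/2 * (9/125)) with hS1
  have k1 : (N:ℝ)/6400 ≤ ∑ n ∈ S1, pw n := by
    have := hy y1 (1/20) (by linarith) ((hmono y1 hy1N).trans (by linarith)) le_rfl S1 ?_
    · linarith
    · intro n hn hlog
      have h1 := near_pow hc0 (by positivity) hn hlog (by linarith)
      rw [hpow _ (by linarith)] at h1
      have h2 : |(n:ℝ)^c - R/2| ≤ R/2 * (9/125) := by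
        refine h1.trans (mul_le_mul_of_nonneg_left ?_ (by linarith))
        nlinarith
      rw [hS1, Finset.mem_filter]
      rw [abs_le] at h2
      exact ⟨mem_range_pow hc hN1 (by linarith) (by linarith), abs_le.2 h2⟩
  have k2 : ∀ m ∈ S1, (N:ℝ)/(960*(W:ℝ)^2) ≤ ∑ n ∈ I.filter (fun n : ℕ => |(m:ℝ)^c + (n:ℝ)^c - R| ≤ H), pw n := by
    intro m hm
    rw [hS1, Finset.mem_filter, abs_le] at hm
    obtain ⟨_, hm1, hm2⟩ := hm
    set z := R - (m:ℝ)^c with hz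
    have z1 : 0.46 * R ≤ z := by linarith
    have z2 : z ≤ 0.54 * R := by linarith
    have hz0 : 0 < z := by nlinarith
    set y2 := z^(1/c) with hy2
    have hy2N : (N:ℝ)/4 ≤ y2 := root_ge hc hN0 (by linarith)
    have := hy y2 δ (by linarith) (hmono y2 hy2N) (by linarith) (I.filter (fun n : ℕ => |(m:ℝ)^c + (n:ℝ)^c - R| ≤ H)) ?_
    · refine le_trans ?_ this
      have : (N:ℝ)/(960*(W:ℝ)^2) = (N:ℝ)/4 * δ / 80 := by rw [hδd]; field_simp; norm_num
      rw [this]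
      have := mul_le_mul_of_nonneg_right hy2N hδ0.le
      linarith
    · intro n hn hlog
      have hcd : c * δ ≤ 1/20 := by nlinarith
      have hcd0 : 0 < c * δ := by positivity
      have h1 := near_pow hc0 (by positivity) hn hlog (by linarith)
      rw [hpow _ hz0.le] at h1
      have h2 : c*δ + (c*δ)^2 ≤ 1.05 * (c*δ) := by nlinarith
      have h3 : z * (c*δ + (c*δ)^2) ≤ 0.9 * M * (1.05 * (c*δ)) := mul_le_mul (by linarith) h2 (by positivity) (by positivity)
      have h4 : c * δ ≤ 1.35 * δ := mul_le_mul_of_nonneg_right (by linarith) hδ0.le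
      have hH' : H = 3 * δ * M := by rw [hH, hδd]; field_simp
      have h5 : 0.9 * M * (1.05 * (c*δ)) ≤ H := by
        rw [hH']
        nlinarith [mul_le_mul_of_nonneg_left h4 hM0.le, mul_pos hδ0 hM0]
      have h6 : 0.9 * M * (1.05 * (c*δ)) ≤ 0.05 * M := by nlinarith [mul_le_mul_of_nonneg_left hcd hM0.le]
      have h7 := abs_le.1 (h1.trans h3)
      rw [Finset.mem_filter]
      refine ⟨mem_range_pow hc hN1 (by linarith) (by linarith), ?_⟩
      rw [abs_le]; constructor <;> linarith
  have hgg : ∀ u : ℝ, |u| ≤ H → H⁻¹ * exp (-π) ≤ gg H u := by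
    intro u hu
    unfold gg
    refine mul_le_mul_of_nonneg_left (Real.exp_le_exp.2 ?_) (by positivity)
    have : u^2 ≤ H^2 := by rw [← sq_abs]; exact pow_le_pow_left₀ (abs_nonneg _) hu 2
    have h1 : π/H^2 * u^2 ≤ π := by
      rw [div_mul_eq_mul_div, div_le_iff₀ (by positivity)]
      exact mul_le_mul_of_nonneg_left this pi_pos.le
    linarith
  have hterm0 : ∀ m n : ℕ, 0 ≤ (pw m * pw n) * gg H ((m:ℝ)^c + (n:ℝ)^c - R) := fun m n =>
    mul_nonneg (mul_nonneg (pw_nonneg _) (pw_nonneg _)) (gg_pos hH0 _).le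
  have hinner : ∀ m ∈ S1, pw m * ((N:ℝ)/(960*(W:ℝ)^2) * (H⁻¹ * exp (-π))) ≤ ∑ n ∈ I, (pw m * pw n) * gg H ((m:ℝ)^c + (n:ℝ)^c - R) := by
    intro m hm
    calc pw m * ((N:ℝ)/(960*(W:ℝ)^2) * (H⁻¹ * exp (-π))) ≤ pw m * ((∑ n ∈ I.filter (fun n : ℕ => |(m:ℝ)^c + (n:ℝ)^c - R| ≤ H), pw n) * (H⁻¹ * exp (-π))) :=
          mul_le_mul_of_nonneg_left (mul_le_mul_of_nonneg_right (k2 m hm) (by positivity)) (pw_nonneg m)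
      _ = ∑ n ∈ I.filter (fun n : ℕ => |(m:ℝ)^c + (n:ℝ)^c - R| ≤ H), (pw m * pw n) * (H⁻¹ * exp (-π)) := by
          rw [Finset.sum_mul, Finset.mul_sum]
          exact Finset.sum_congr rfl fun n _ => by ring
      _ ≤ ∑ n ∈ I.filter (fun n : ℕ => |(m:ℝ)^c + (n:ℝ)^c - R| ≤ H), (pw m * pw n) * gg H ((m:ℝ)^c + (n:ℝ)^c - R) := by
          refine Finset.sum_le_sum fun n hn => ?_
          rw [Finset.mem_filter] at hn
          exact mul_le_mul_of_nonneg_left (hgg _ hn.2) (mul_nonneg (pw_nonneg _) (pw_nonneg _))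
      _ ≤ _ := Finset.sum_le_sum_of_subset_of_nonneg (Finset.filter_subset _ _) fun n _ _ => hterm0 m n
  have hfin : (N:ℝ)/6400 * ((N:ℝ)/(960*(W:ℝ)^2) * (H⁻¹ * exp (-π))) ≤ AA c N H R := by
    unfold AA
    rw [Finset.sum_product]
    calc (N:ℝ)/6400 * ((N:ℝ)/(960*(W:ℝ)^2) * (H⁻¹ * exp (-π))) ≤ (∑ n ∈ S1, pw n) * ((N:ℝ)/(960*(W:ℝ)^2) * (H⁻¹ * exp (-π))) :=
          mul_le_mul_of_nonneg_right k1 (by positivity)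
      _ = ∑ m ∈ S1, pw m * ((N:ℝ)/(960*(W:ℝ)^2) * (H⁻¹ * exp (-π))) := by rw [Finset.sum_mul]
      _ ≤ ∑ m ∈ S1, ∑ n ∈ I, (pw m * pw n) * gg H ((m:ℝ)^c + (n:ℝ)^c - R) := Finset.sum_le_sum hinner
      _ ≤ _ := Finset.sum_le_sum_of_subset_of_nonneg (Finset.filter_subset _ _) fun m _ _ => Finset.sum_nonneg fun n _ => hterm0 m n
  refine le_trans (le_of_eq ?_) hfin
  have e1 : (N:ℝ)^(2-c) = (N:ℝ)^2 / M := by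
    rw [Real.rpow_sub hN0, hM]; norm_num
  rw [e1, cE, hH]
  field_simp
  norm_num
end

section
open Real MeasureTheory Filter

noncomputable def qN (N : ℕ) : ℝ := (log N)^((1:ℝ)/4)
noncomputable def WN (N : ℕ) : ℕ := ⌈exp (qN N / 4)⌉₊

lemma qN_tendsto : Tendsto qN atTop atTop :=
  (tendsto_rpow_atTop (by norm_num : (0:ℝ) < 1/4)).comp (Real.tendsto_log_atTop.comp tendsto_natCast_atTop_atTop)

lemma qN_pow (N : ℕ) : qN N ^ 4 = log N := by
  unfold qN
  rw [← Real.rpow_natCast, ← Real.rpow_mul (Real.log_natCast_nonneg N)]; norm_num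

lemma ev_pow : ∀ᶠ q : ℝ in atTop, (1 + q^4)^14 ≤ exp (q/8) := by
  have h1 : Tendsto (fun q : ℝ => q/8) atTop atTop := tendsto_id.atTop_div_const (by norm_num)
  have h2 := (Real.tendsto_pow_mul_exp_neg_atTop_nhds_zero 56).comp h1
  have h3 : ∀ᶠ q : ℝ in atTop, ((q/8)^56 * exp (-(q/8))) < 1/(2^14*8^56) :=
    h2.eventually (gt_mem_nhds (by positivity))
  filter_upwards [h3, eventually_ge_atTop 1] with q hq hq1
  have e : exp (-(q/8)) * exp (q/8) = 1 := by rw [← Real.exp_add]; simp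
  have h4 : (1 + q^4)^14 ≤ (2*q^4)^14 := pow_le_pow_left₀ (by positivity) (by nlinarith [one_le_pow₀ hq1 (n := 4)]) 14
  have h5 := mul_le_mul_of_nonneg_right hq.le (Real.exp_pos (q/8)).le
  rw [mul_assoc, e, mul_one, div_pow, one_div_mul_eq_div, div_le_div_iff₀ (by positivity) (by positivity)] at h5
  refine h4.trans ?_
  have h6 : (2*q^4)^14 * 8^56 ≤ exp (q/8) * 8^56 := by
    calc (2*q^4)^14 * 8^56 = q^56 * (2^14*8^56) / 1 := by ring
      _ ≤ exp (q/8) * 8^56 := by rw [div_one]; exact h5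
  exact le_of_mul_le_mul_right h6 (by positivity)

lemma ev_all (y0 : ℝ) : ∀ᶠ N : ℕ in atTop, 2^50 ≤ N ∧ 3 ≤ WN N ∧ ((WN N : ℕ):ℝ) ≤ (N:ℝ)^((1:ℝ)/5000) ∧
    2 * (N:ℝ)^3 ≤ exp ((N:ℝ)^((1:ℝ)/1000)) ∧ exp (-(log ((N:ℝ)/4))^((1:ℝ)/4)) ≤ 1/(3*((WN N : ℕ):ℝ)^2) ∧ 4 * y0 ≤ N ∧
    (1 + log N)^14 ≤ exp (qN N / 8) := by
  have hr : Tendsto (fun N : ℕ => (N:ℝ)^((1:ℝ)/2000)) atTop atTop :=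
    (tendsto_rpow_atTop (by norm_num)).comp tendsto_natCast_atTop_atTop
  filter_upwards [eventually_ge_atTop (2^50), qN_tendsto.eventually ev_pow, qN_tendsto.eventually_ge_atTop 100,
    hr.eventually_ge_atTop 6001, (tendsto_natCast_atTop_atTop (R := ℝ)).eventually_ge_atTop (4*y0)] with N hN hq hq100 hr1 hy
  have hN0 : (0:ℝ) < N := by exact_mod_cast (by omega : 0 < N)
  rw [qN_pow] at hq
  set q := qN N with hqd
  have hq4 : q^4 = log N := qN_pow N
  have hW1 : exp (q/4) ≤ (WN N : ℕ) := Nat.le_ceil _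
  have hW2 : ((WN N : ℕ):ℝ) < exp (q/4) + 1 := Nat.ceil_lt_add_one (Real.exp_pos _).le
  have hx := Real.add_one_le_exp (q/4)
  refine ⟨hN, ?_, ?_, ?_, ?_, hy, hq⟩
  · have : (3:ℝ) ≤ (WN N : ℕ) := by linarith
    exact_mod_cast this
  · have e1 : (N:ℝ)^((1:ℝ)/5000) = exp (q^4/5000) := by
      rw [Real.rpow_def_of_pos hN0, hq4]; congr 1; ring
    have e2 : exp (q/2) = exp (q/4) * exp (q/4) := by rw [← Real.exp_add]; congr 1; ring
    have e3 : exp (q/4) + 1 ≤ exp (q/2) := by rw [e2]; nlinarith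
    have e4 : exp (q/2) ≤ exp (q^4/5000) := by
      apply Real.exp_le_exp.2
      have : (100:ℝ)^3 ≤ q^3 := pow_le_pow_left₀ (by norm_num) hq100 3
      nlinarith
    rw [e1]; linarith
  · have e1 : (2:ℝ) * (N:ℝ)^3 = exp (log 2 + 3 * log N) := by
      rw [Real.exp_add, Real.exp_log (by norm_num), mul_comm 3, Real.exp_mul, Real.exp_log hN0]; norm_num
    rw [e1]; apply Real.exp_le_exp.2
    have e2 := Real.log_le_rpow_div hN0.le (by norm_num : (0:ℝ) < 1/2000)
    have e3 : (N:ℝ)^((1:ℝ)/1000) = (N:ℝ)^((1:ℝ)/2000) * (N:ℝ)^((1:ℝ)/2000) := by rw [← Real.rpow_add hN0]; norm_num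
    have e4 := Real.log_two_lt_d9
    rw [e3]
    have : (N:ℝ)^((1:ℝ)/2000) / (1/2000) = 2000 * (N:ℝ)^((1:ℝ)/2000) := by ring
    rw [this] at e2
    nlinarith
  · have e0 : log ((N:ℝ)/4) = q^4 - log 4 := by rw [Real.log_div hN0.ne' (by norm_num), hq4]
    have e1 : log (4:ℝ) ≤ 3 := by have := Real.log_le_sub_one_of_pos (by norm_num : (0:ℝ) < 4); linarith
    have hq4' : (100:ℝ)^4 ≤ q^4 := pow_le_pow_left₀ (by norm_num) hq100 4
    have e2 : (0.9*q)^4 ≤ log ((N:ℝ)/4) := by rw [e0]; nlinarith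
    have e3 : 0.9*q ≤ (log ((N:ℝ)/4))^((1:ℝ)/4) := by
      have := Real.rpow_le_rpow (by positivity) e2 (by norm_num : (0:ℝ) ≤ 1/4)
      rw [← Real.rpow_natCast, ← Real.rpow_mul (by positivity)] at this
      norm_num at this ⊢
      exact this
    rw [Real.exp_neg, ← one_div]
    have hWp : (0:ℝ) < (WN N : ℕ) := by linarith [Real.exp_pos (q/4)]
    apply one_div_le_one_div_of_le (by positivity)
    have e4 : ((WN N : ℕ):ℝ)^2 ≤ (2 * exp (q/4))^2 := pow_le_pow_left₀ (by positivity) (by linarith) 2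
    have e5 : exp (0.9*q) = exp (q/4) * exp (q/4) * exp (0.4*q) := by rw [← Real.exp_add, ← Real.exp_add]; congr 1; ring
    have e6 := Real.add_one_le_exp (0.4*q)
    have e7 := Real.exp_le_exp.2 e3
    rw [e5] at e7
    refine le_trans ?_ e7
    nlinarith [mul_pos (Real.exp_pos (q/4)) (Real.exp_pos (q/4))]

noncomputable def KC (c : ℝ) : ℝ := 2 * (DC c / (cE/6)^2)

lemma cE_pos : 0 < cE := by unfold cE; positivity
lemma DC_pos {c : ℝ} (hc : 1 < c) : 0 < DC c := by unfold DC mC; have := ppC_pos hc; positivity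

set_option maxHeartbeats 1000000 in
lemma main_N {c η : ℝ} (hc : 1 < c) (hc2 : c < 39/29) (hη : 0 < η) (hη2 : η ≤ 1/4000) : ∀ᶠ N : ℕ in atTop,
    ∃ B : Set ℝ, MeasurableSet B ∧ volume B ≤ ENNReal.ofReal (KC c * (N:ℝ)^c * exp (-(qN N / 8))) ∧
    ∀ R : ℝ, (N:ℝ)^c ≤ R → R ≤ 1.65 * (N:ℝ)^c → (∀ p ∈ Finset.Ioc (N/4) N, R^(1/c)/8 < (p:ℝ) ∧ (p:ℝ) ≤ R^(1/c)) → R ∉ B →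
      cE/4 * (N:ℝ)^(2-c) * (1.65 * (N:ℝ)^c)^(-η) / (log N)^2 ≤ (countSol c η R 2 : ℝ) := by
  obtain ⟨y0, hy1, hlow⟩ := AA_lower
  filter_upwards [ev_all y0] with N hN
  obtain ⟨hN, hW3, hWN, hbig, he, hy, hpow⟩ := hN
  have hNr : (2:ℝ)^50 ≤ N := by exact_mod_cast hN
  have hN0 : (0:ℝ) < N := by linarith [show (0:ℝ) < 2^50 by norm_num]
  have hN1 : (1:ℝ) ≤ N := by linarith [show (1:ℝ) ≤ 2^50 by norm_num]
  set W := WN N with hW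
  have hW0 : (0:ℝ) < W := by exact_mod_cast (by omega : 0 < W)
  set M := (N:ℝ)^c with hM
  have hM0 : 0 < M := by positivity
  set H := M/(W:ℝ)^2 with hH
  have hH0 : 0 < H := by positivity
  set h := (1.65*M)^(-η) with hh
  have hh0 : 0 < h := by positivity
  have hMN : (N:ℝ) ≤ M := by
    calc (N:ℝ) = (N:ℝ)^(1:ℝ) := (Real.rpow_one _).symm
      _ ≤ M := Real.rpow_le_rpow_of_exponent_le hN1 hc.le
  have hM1 : 1.65 * M ≤ (N:ℝ)^(2:ℝ) := by
    have e1 : (N:ℝ)^(2:ℝ) = M * (N:ℝ)^(2-c) := by rw [hM, ← Real.rpow_add hN0]; congr 1; ring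
    have e2 : (N:ℝ)^((1:ℝ)/2) ≤ (N:ℝ)^(2-c) := Real.rpow_le_rpow_of_exponent_le hN1 (by linarith)
    have e3 : ((2:ℝ)^50)^((1:ℝ)/2) ≤ (N:ℝ)^((1:ℝ)/2) := Real.rpow_le_rpow (by norm_num) hNr (by norm_num)
    have e4 : ((2:ℝ)^50)^((1:ℝ)/2) = 2^25 := by
      rw [← Real.rpow_natCast, ← Real.rpow_mul (by norm_num)]; norm_num
    rw [e4] at e3
    rw [e1]
    have : (1.65:ℝ) ≤ (N:ℝ)^(2-c) := by norm_num at e3; linarith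
    have := mul_le_mul_of_nonneg_left this hM0.le
    linarith
  have hhl : (N:ℝ)^(-(1:ℝ)/2000) ≤ h := by
    have e1 : (1.65*M)^η ≤ (N:ℝ)^((1:ℝ)/2000) := by
      calc (1.65*M)^η ≤ ((N:ℝ)^(2:ℝ))^η := Real.rpow_le_rpow (by positivity) hM1 hη.le
        _ = (N:ℝ)^(2*η) := by rw [← Real.rpow_mul hN0.le]
        _ ≤ _ := Real.rpow_le_rpow_of_exponent_le hN1 (by linarith)
    rw [hh, show -(1:ℝ)/2000 = -((1:ℝ)/2000) by ring, Real.rpow_neg hN0.le, Real.rpow_neg (by positivity)]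
    exact inv_anti₀ (by positivity) e1
  have hh1 : h ≤ 1 := Real.rpow_le_one_of_one_le_of_nonpos (by linarith) (by linarith)
  have hH2 : 2 ≤ H := by
    rw [hH, le_div_iff₀ (by positivity)]
    have e1 : (W:ℝ)^2 ≤ (N:ℝ)^((1:ℝ)/2500) := by
      calc (W:ℝ)^2 ≤ ((N:ℝ)^((1:ℝ)/5000))^2 := pow_le_pow_left₀ hW0.le hWN 2
        _ = _ := by rw [← Real.rpow_natCast, ← Real.rpow_mul hN0.le]; norm_num
    have e2 : (N:ℝ)^((1:ℝ)/2500) ≤ (N:ℝ)^((1:ℝ)/2) := Real.rpow_le_rpow_of_exponent_le hN1 (by norm_num)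
    have e3 : (N:ℝ)^((1:ℝ)/2) * (N:ℝ)^((1:ℝ)/2) = N := by rw [← Real.rpow_add hN0]; norm_num
    have e4 : 0 < (N:ℝ)^((1:ℝ)/2) := by positivity
    have e5 : 2 ≤ (N:ℝ)^((1:ℝ)/2) := by
      by_contra hcon
      push Not at hcon
      have := show (4:ℝ) < 2^50 by norm_num
      nlinarith
    nlinarith
  have hcE := cE_pos
  have hDC := DC_pos hc
  set ε := cE/6 * (N:ℝ)^(2-c) with hε
  have hε0 : 0 < ε := by positivity
  obtain ⟨m1, v1⟩ := AA_cheb c N hh0 hH0 hε0 (AA_bound hc hc2 N W hN (by omega) hWN hbig hhl (by linarith))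
  obtain ⟨m2, v2⟩ := AA_cheb c N (by positivity : 0 < 2*h) hH0 hε0 (AA_bound hc hc2 N W hN (by omega) hWN hbig (by linarith : (N:ℝ)^(-(1:ℝ)/2000) ≤ 2*h) (by linarith))
  refine ⟨_, m1.union m2, ?_, ?_⟩
  · refine (measure_union_le _ _).trans ((add_le_add v1 v2).trans ?_)
    rw [← ENNReal.ofReal_add (by positivity) (by positivity)]
    apply ENNReal.ofReal_le_ofReal
    have e1 : (N:ℝ)^(4-c) = M * ((N:ℝ)^(2-c))^2 := by
      rw [hM, ← Real.rpow_natCast, ← Real.rpow_mul hN0.le, ← Real.rpow_add hN0]; congr 1; push_cast; ring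
    have e2 : DC c * (1 + log N)^14 * ((N:ℝ)^(4-c) / W) / ε^2 = DC c / (cE/6)^2 * M * ((1 + log N)^14 / W) := by
      rw [e1, hε]
      have : (N:ℝ)^(2-c) ≠ 0 := by positivity
      field_simp
    rw [e2]
    have e3 : (1 + log N)^14 / (W:ℝ) ≤ exp (-(qN N / 8)) := by
      rw [div_le_iff₀ hW0]
      have : exp (qN N / 4) ≤ W := Nat.le_ceil _
      calc (1 + log N)^14 ≤ exp (qN N / 8) := hpow
        _ = exp (-(qN N / 8)) * exp (qN N / 4) := by rw [← Real.exp_add]; congr 1; ring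
        _ ≤ _ := mul_le_mul_of_nonneg_left this (Real.exp_pos _).le
    have e4 := mul_le_mul_of_nonneg_left e3 (by positivity : 0 ≤ DC c / (cE/6)^2 * M)
    unfold KC
    linarith
  · intro R hR1 hR2 hr hRB
    rw [Set.mem_union, not_or] at hRB
    obtain ⟨b1, b2⟩ := hRB
    simp only [Set.mem_ofPred_eq, not_le] at b1 b2
    rw [abs_lt] at b1 b2
    have hl := hlow c hc hc2 N W hW3 hy he R hR1 hR2
    have hhR : h ≤ R^(-η) := Real.rpow_le_rpow_of_nonpos (by linarith) hR2 (by linarith)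
    have hcnt := count_lower N hr hh0 hhR
    have hlog : 0 < log (N:ℝ) := Real.log_pos (by linarith [show (1:ℝ) < 2^50 by norm_num])
    have k : cE/2 * (N:ℝ)^(2-c) ≤ 2/h * (log N)^2 * (countSol c η R 2 : ℝ) := by
      refine le_trans ?_ hcnt
      have : cE/2 * (N:ℝ)^(2-c) = cE * (N:ℝ)^(2-c) - 3 * ε := by rw [hε]; ring
      rw [this]
      linarith [b1.1, b2.2]
    rw [div_le_iff₀ (by positivity)]
    have k2 := mul_le_mul_of_nonneg_left k (by positivity : 0 ≤ h/2)
    have e : h/2 * (2/h * (log N)^2 * (countSol c η R 2 : ℝ)) = (countSol c η R 2 : ℝ) * (log N)^2 := by field_simp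
    rw [e] at k2
    linarith
end

open Real MeasureTheory Filter

set_option maxHeartbeats 1000000 in
lemma main_V {c η : ℝ} (hc : 1 < c) (hc2 : c < 39/29) (hη : 0 < η) (hη2 : η ≤ 1/4000) : ∀ᶠ V : ℝ in atTop,
    ∃ B : Set ℝ, MeasurableSet B ∧ volume B ≤ ENNReal.ofReal (KC c * V * exp (-((log V)^((1:ℝ)/4) / 16))) ∧
    ∀ R : ℝ, V ≤ R → R ≤ 1.5 * V → R ∉ B → cE/16 * R^(2/c-1-η) / (log R)^2 ≤ (countSol c η R 2 : ℝ) := by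
  have hc0 : 0 < c := by linarith
  have ht : Tendsto (fun V : ℝ => ⌊V^(1/c)⌋₊) atTop atTop :=
    tendsto_nat_floor_atTop.comp (tendsto_rpow_atTop (by positivity))
  filter_upwards [ht.eventually (main_N hc hc2 hη hη2), ht.eventually_ge_atTop 100, eventually_ge_atTop 1] with V hV hN100 hV1
  set N := ⌊V^(1/c)⌋₊ with hNd
  obtain ⟨B, mB, vB, hB⟩ := hV
  have hNr : (100:ℝ) ≤ N := by exact_mod_cast hN100
  have hN0 : (0:ℝ) < N := by linarith
  have hV0 : 0 < V := by linarith
  have hVc0 : 0 ≤ V^(1/c) := by positivity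
  have a1 : (N:ℝ) ≤ V^(1/c) := Nat.floor_le hVc0
  have a2 : V^(1/c) < N + 1 := Nat.lt_floor_add_one _
  have hinv : (V^(1/c))^c = V := by rw [← Real.rpow_mul hV0.le, one_div_mul_cancel hc0.ne', Real.rpow_one]
  have b1 : (N:ℝ)^c ≤ V := by
    have := Real.rpow_le_rpow hN0.le a1 hc0.le
    rwa [hinv] at this
  have b2 : V ≤ 1.1 * (N:ℝ)^c := by
    have h1 := Real.rpow_le_rpow hVc0 a2.le hc0.le
    rw [hinv] at h1
    have h2 : (N:ℝ) + 1 ≤ 1.01 * N := by linarith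
    have h3 := Real.rpow_le_rpow (by positivity) h2 hc0.le
    rw [Real.mul_rpow (by norm_num) hN0.le] at h3
    have h4 : (1.01:ℝ)^c ≤ (1.01:ℝ)^(2:ℝ) := Real.rpow_le_rpow_of_exponent_le (by norm_num) (by linarith)
    have h5 : (1.01:ℝ)^(2:ℝ) ≤ 1.1 := by norm_num
    have h6 := mul_le_mul_of_nonneg_right (h4.trans h5) (by positivity : 0 ≤ (N:ℝ)^c)
    linarith
  have hlogN : 0 < log (N:ℝ) := Real.log_pos (by linarith)
  have hK : 0 < KC c := by unfold KC; have := cE_pos; have := DC_pos hc; positivity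
  refine ⟨B, mB, vB.trans (ENNReal.ofReal_le_ofReal ?_), ?_⟩
  · have h1 : (log V)^((1:ℝ)/4) ≤ 2 * qN N := by
      have h2 : log V ≤ 16 * log N := by
        have : V ≤ (N:ℝ)^(16:ℝ) := by
          refine b2.trans ?_
          have e1 : (N:ℝ)^c ≤ (N:ℝ)^(15:ℝ) := Real.rpow_le_rpow_of_exponent_le (by linarith) (by linarith)
          have e2 : (N:ℝ)^(16:ℝ) = (N:ℝ)^(15:ℝ) * N := by
            rw [show (16:ℝ) = 15 + 1 by norm_num, Real.rpow_add hN0, Real.rpow_one]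
          have e3 : 0 < (N:ℝ)^(15:ℝ) := by positivity
          rw [e2]; nlinarith
        have := Real.log_le_log hV0 this
        rwa [Real.log_rpow hN0] at this
      have h3 := Real.rpow_le_rpow (Real.log_nonneg hV1) h2 (by norm_num : (0:ℝ) ≤ 1/4)
      rw [Real.mul_rpow (by norm_num) hlogN.le] at h3
      have h4 : (16:ℝ)^((1:ℝ)/4) = 2 := by
        rw [show (16:ℝ) = 2^(4:ℝ) by norm_num, ← Real.rpow_mul (by norm_num)]; norm_num
      rw [h4] at h3; exact h3
    have h2 : exp (-(qN N / 8)) ≤ exp (-((log V)^((1:ℝ)/4) / 16)) := Real.exp_le_exp.2 (by linarith)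
    exact mul_le_mul (mul_le_mul_of_nonneg_left b1 hK.le) h2 (Real.exp_pos _).le (by positivity)
  · intro R hR1 hR2 hRB
    have hR0 : 0 < R := by linarith
    have hRc : V^(1/c) ≤ R^(1/c) := Real.rpow_le_rpow hV0.le hR1 (by positivity)
    have hRc2 : R^(1/c) ≤ 1.5 * V^(1/c) := by
      have h1 := Real.rpow_le_rpow hR0.le hR2 (by positivity : 0 ≤ 1/c)
      rw [Real.mul_rpow (by norm_num) hV0.le] at h1
      have h2 : (1.5:ℝ)^(1/c) ≤ (1.5:ℝ)^(1:ℝ) := Real.rpow_le_rpow_of_exponent_le (by norm_num) (by rw [div_le_one hc0]; exact hc.le)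
      rw [Real.rpow_one] at h2
      exact h1.trans (mul_le_mul_of_nonneg_right h2 hVc0)
    have hcount := hB R (b1.trans hR1) (by linarith) (by
      intro p hp
      rw [Finset.mem_Ioc] at hp
      have p1 : (p:ℝ) ≤ N := by exact_mod_cast hp.2
      have p2 : (N:ℝ) + 1 ≤ 4 * p := by exact_mod_cast (by omega : N + 1 ≤ 4 * p)
      constructor <;> linarith) hRB
    refine le_trans ?_ hcount
    set M := (N:ℝ)^c with hM
    have hM0 : 0 < M := by positivity
    have hcE := cE_pos
    have hMR : M ≤ R := b1.trans hR1
    have hRM : R ≤ 1.65 * M := by linarith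
    have hNM : (N:ℝ) ≤ M := by
      calc (N:ℝ) = (N:ℝ)^(1:ℝ) := (Real.rpow_one _).symm
        _ ≤ M := Real.rpow_le_rpow_of_exponent_le (by linarith) hc.le
    have hlogR : log (N:ℝ) ≤ log R := Real.log_le_log hN0 (hNM.trans hMR)
    have hpw : ∀ x : ℝ, 0 ≤ x → x ≤ 1 → (1.65:ℝ)^x ≤ 1.65 := fun x _ hx => by
      have := Real.rpow_le_rpow_of_exponent_le (by norm_num : (1:ℝ) ≤ 1.65) hx
      rwa [Real.rpow_one] at this
    have hex0 : 0 ≤ 2/c - 1 := by rw [sub_nonneg, le_div_iff₀ hc0]; linarith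
    have hex1 : 2/c - 1 ≤ 1 := by
      have : 2/c ≤ 2 := by rw [div_le_iff₀ hc0]; linarith
      linarith
    have k1 : R^(2/c-1) ≤ 1.65 * (N:ℝ)^(2-c) := by
      have h1 := Real.rpow_le_rpow hR0.le hRM hex0
      rw [Real.mul_rpow (by norm_num) hM0.le] at h1
      have h2 : M^(2/c-1) = (N:ℝ)^(2-c) := by
        rw [hM, ← Real.rpow_mul hN0.le]; congr 1; field_simp
      rw [h2] at h1
      exact h1.trans (mul_le_mul_of_nonneg_right (hpw _ hex0 hex1) (by positivity))
    have k2 : R^(-η) ≤ 1.65 * (1.65*M)^(-η) := by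
      have h1 : R^(-η) ≤ M^(-η) := Real.rpow_le_rpow_of_nonpos hM0 hMR (by linarith)
      rw [Real.mul_rpow (by norm_num) hM0.le]
      have h2 := hpw η hη.le (by linarith)
      have h3 : (1.65:ℝ)^(-η) * (1.65:ℝ)^η = 1 := by rw [← Real.rpow_add (by norm_num)]; simp
      have h4 : 0 < (1.65:ℝ)^(-η) := by positivity
      have h5 : 1 ≤ 1.65 * (1.65:ℝ)^(-η) := by nlinarith
      have h6 := mul_le_mul_of_nonneg_right h5 (by positivity : 0 ≤ M^(-η))
      linarith
    have k3 : R^(2/c-1-η) ≤ 4 * ((N:ℝ)^(2-c) * (1.65*M)^(-η)) := by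
      rw [show 2/c-1-η = (2/c-1) + -η by ring, Real.rpow_add hR0]
      have h1 := mul_le_mul k1 k2 (by positivity) (by positivity)
      have h2 : 0 ≤ (N:ℝ)^(2-c) * (1.65*M)^(-η) := by positivity
      linarith
    apply div_le_div₀ (by positivity) _ (by positivity) (pow_le_pow_left₀ hlogN.le hlogR 2)
    nlinarith [mul_le_mul_of_nonneg_left k3 hcE.le]

theorem baker_thm1 (c : ℝ) (hc1 : 1 < c) (hc2 : c < 39/29) (hc3 : c ≠ 4/3) :
    ∃ η₀ > 0, ∀ η : ℝ, 0 < η → η ≤ η₀ →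
    ∃ C > 0, ∃ c₀ > 0, ∃ V₀ > 0, ∀ V : ℝ, V₀ ≤ V →
    ∃ Ebad : Set ℝ, MeasurableSet Ebad ∧
      volume Ebad ≤ ENNReal.ofReal (C * V * Real.exp (-(Real.log V ^ ((1:ℝ)/4)) / C)) ∧
      ∀ R ∈ Set.Icc V (2*V), R ∉ Ebad →
        c₀ * R ^ (2/c - 1 - η) / (Real.log R) ^ 2 ≤ (countSol c η R 2 : ℝ) := by
  refine ⟨1/4000, by norm_num, fun η hη hη2 => ?_⟩
  have hK : 0 < KC c := by unfold KC; have := cE_pos; have := DC_pos hc1; positivity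
  obtain ⟨V1, hV1⟩ := eventually_atTop.1 (main_V hc1 hc2 hη hη2)
  refine ⟨3 * KC c + 16, by positivity, cE/16, by have := cE_pos; positivity, max V1 1, by positivity, ?_⟩
  intro V hV
  have hVa : V1 ≤ V := (le_max_left _ _).trans hV
  have hVb : 1 ≤ V := (le_max_right _ _).trans hV
  obtain ⟨B1, m1, v1, h1⟩ := hV1 V hVa
  obtain ⟨B2, m2, v2, h2⟩ := hV1 (1.5*V) (by linarith)
  refine ⟨B1 ∪ B2, m1.union m2, ?_, ?_⟩
  · refine (measure_union_le _ _).trans ((add_le_add v1 v2).trans ?_)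
    rw [← ENNReal.ofReal_add (by positivity) (by positivity)]
    apply ENNReal.ofReal_le_ofReal
    set L := (log V)^((1:ℝ)/4) with hL
    have hL0 : 0 ≤ L := Real.rpow_nonneg (Real.log_nonneg hVb) _
    have e1 : L ≤ (log (1.5*V))^((1:ℝ)/4) :=
      Real.rpow_le_rpow (Real.log_nonneg hVb) (Real.log_le_log (by linarith) (by linarith)) (by norm_num)
    have e2 : exp (-((log (1.5*V))^((1:ℝ)/4) / 16)) ≤ exp (-(L/16)) := Real.exp_le_exp.2 (by linarith)
    have e3 : exp (-(L/16)) ≤ exp (-L/(3*KC c + 16)) := by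
      apply Real.exp_le_exp.2
      rw [neg_div, neg_le_neg_iff]
      exact div_le_div_of_nonneg_left hL0 (by norm_num) (by linarith)
    have e4 : KC c * (1.5*V) * exp (-((log (1.5*V))^((1:ℝ)/4) / 16)) ≤ KC c * (1.5*V) * exp (-(L/16)) :=
      mul_le_mul_of_nonneg_left e2 (by positivity)
    have e5 : (3 * KC c + 16) * V * exp (-(L/16)) ≤ (3 * KC c + 16) * V * exp (-L/(3*KC c + 16)) :=
      mul_le_mul_of_nonneg_left e3 (by positivity)
    have e6 : 0 ≤ KC c * V * exp (-(L/16)) := by positivity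
    have e7 : 0 ≤ V * exp (-(L/16)) := by positivity
    nlinarith
  · intro R hR hRB
    rw [Set.mem_union, not_or] at hRB
    rcases le_total R (1.5*V) with h | h
    · exact h1 R hR.1 h hRB.1
    · exact h2 R h (by linarith [hR.2]) hRB.2
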